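/- arXiv:2105.05452 — 4 statements merged into one kernel-verified Lean document; each statement's English description precedes it below -/
import Mathlib

section
/- Let f be a transcendental entire function. Then the holomorphic flow ż = f(z) has infinitely many pairwise disjoint trajectories which tend to infinity in finite increasing time. -/
open Filter Set

noncomputable section

/-- `z` solves `ż = f(z)` on the interval `(a, b) ⊆ ℝ` (endpoints in `EReal`). -/
def FlowSol (f : ℂ → ℂ) (a b : EReal) (z : ℝ → ℂ) : Prop :=
  a < b ∧ ∀ t : ℝ, a < (t : EReal) → (t : EReal) < b → HasDerivAt z (f (z t)) t

/-- `z` is a maximal solution of `ż = f(z)` on `(a, b)`. -/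
def MaxFlowSol (f : ℂ → ℂ) (a b : EReal) (z : ℝ → ℂ) : Prop :=
  FlowSol f a b z ∧
  ∀ a' b' : EReal, ∀ w : ℝ → ℂ, FlowSol f a' b' w → a' ≤ a → b ≤ b' →
    (∀ t : ℝ, a < (t : EReal) → (t : EReal) < b → w t = z t) → a' = a ∧ b' = b

/-- The image (as a curve in `ℂ`) of the solution `z` on `(a, b)`. -/
def Traj (a b : EReal) (z : ℝ → ℂ) : Set ℂ :=
  z '' {t : ℝ | a < (t : EReal) ∧ (t : EReal) < b}

/-- The maximal trajectory `z` on `(a,b)` tends to infinity in finite increasing time. -/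
def EscapesInFiniteTime (f : ℂ → ℂ) (a b : EReal) (z : ℝ → ℂ) : Prop :=
  MaxFlowSol f a b z ∧ ∃ c : ℝ, b = (c : EReal) ∧
    Tendsto z (nhdsWithin c (Set.Iio c)) (Bornology.cobounded ℂ)

def TranscendentalEntire (f : ℂ → ℂ) : Prop :=
  Differentiable ℂ f ∧ ¬ ∃ p : Polynomial ℂ, ∀ z : ℂ, f z = p.eval z

theorem flow_eqOn {v : ℂ → ℂ} (hv : Differentiable ℂ v) {S : Set ℝ} (hS : S.OrdConnected)
    {z w : ℝ → ℂ} (hz : ∀ t ∈ S, HasDerivAt z (v (z t)) t)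
    (hw : ∀ t ∈ S, HasDerivAt w (v (w t)) t) {t₀ : ℝ} (ht₀ : t₀ ∈ S) (h : z t₀ = w t₀) :
    EqOn z w S := by
  have key : ∀ a b : ℝ, Icc a b ⊆ S → ∃ (K : NNReal) (s : Set ℂ), LipschitzOnWith K v s ∧
      (∀ t ∈ Icc a b, z t ∈ s) ∧ ∀ t ∈ Icc a b, w t ∈ s := by
    intro a b hab
    have hzc : ContinuousOn z (Icc a b) :=
      fun t ht => (hz t (hab ht)).continuousAt.continuousWithinAt
    have hwc : ContinuousOn w (Icc a b) :=
      fun t ht => (hw t (hab ht)).continuousAt.continuousWithinAt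
    obtain ⟨R, hR⟩ := ((isCompact_Icc.image_of_continuousOn hzc).union
      (isCompact_Icc.image_of_continuousOn hwc)).isBounded.subset_closedBall 0
    obtain ⟨K, hK⟩ := (((hv.contDiff (n := 1)).restrict_scalars ℝ).contDiffOn
      (s := Metric.closedBall (0 : ℂ) R)).exists_lipschitzOnWith one_ne_zero
      (convex_closedBall _ _) (isCompact_closedBall _ _)
    exact ⟨K, _, hK, fun t ht => hR (Or.inl ⟨t, ht, rfl⟩), fun t ht => hR (Or.inr ⟨t, ht, rfl⟩)⟩
  intro t ht
  rcases le_total t₀ t with hle | hle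
  · have hsub : Icc t₀ t ⊆ S := hS.out ht₀ ht
    obtain ⟨K, s, hK, h1, h2⟩ := key _ _ hsub
    exact ODE_solution_unique_of_mem_Icc_right (v := fun _ => v) (s := fun _ => s)
      (fun _ _ => hK)
      (fun x hx => (hz x (hsub hx)).continuousAt.continuousWithinAt)
      (fun x hx => (hz x (hsub (Ico_subset_Icc_self hx))).hasDerivWithinAt)
      (fun x hx => h1 x (Ico_subset_Icc_self hx))
      (fun x hx => (hw x (hsub hx)).continuousAt.continuousWithinAt)
      (fun x hx => (hw x (hsub (Ico_subset_Icc_self hx))).hasDerivWithinAt)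
      (fun x hx => h2 x (Ico_subset_Icc_self hx)) h ⟨hle, le_rfl⟩
  · have hsub : Icc t t₀ ⊆ S := hS.out ht ht₀
    obtain ⟨K, s, hK, h1, h2⟩ := key _ _ hsub
    exact ODE_solution_unique_of_mem_Icc_left (v := fun _ => v) (s := fun _ => s)
      (fun _ _ => hK)
      (fun x hx => (hz x (hsub hx)).continuousAt.continuousWithinAt)
      (fun x hx => (hz x (hsub (Ioc_subset_Icc_self hx))).hasDerivWithinAt)
      (fun x hx => h1 x (Ioc_subset_Icc_self hx))
      (fun x hx => (hw x (hsub hx)).continuousAt.continuousWithinAt)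
      (fun x hx => (hw x (hsub (Ioc_subset_Icc_self hx))).hasDerivWithinAt)
      (fun x hx => h2 x (Ioc_subset_Icc_self hx)) h ⟨le_rfl, hle⟩

theorem ordConnected_coe_Ioo (a b : EReal) :
    {t : ℝ | a < (t : EReal) ∧ (t : EReal) < b}.OrdConnected :=
  ⟨fun _ hx _ hy _ ht => ⟨hx.1.trans_le (EReal.coe_le_coe_iff.2 ht.1),
    (EReal.coe_le_coe_iff.2 ht.2).trans_lt hy.2⟩⟩

theorem isOpen_coe_Ioo (a b : EReal) :
    IsOpen {t : ℝ | a < (t : EReal) ∧ (t : EReal) < b} :=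
  (isOpen_Ioo (a := a) (b := b)).preimage continuous_coe_real_ereal

theorem FlowSol.eqOn {f : ℂ → ℂ} (hf : Differentiable ℂ f) {a b a' b' : EReal} {z w : ℝ → ℂ}
    (hz : FlowSol f a b z) (hw : FlowSol f a' b' w) {t₀ : ℝ} (h : z t₀ = w t₀)
    (ha : a < t₀) (hb : t₀ < b) (ha' : a' < t₀) (hb' : t₀ < b') {t : ℝ}
    (hta : a < t) (htb : t < b) (hta' : a' < t) (htb' : t < b') : z t = w t :=
  flow_eqOn hf ((ordConnected_coe_Ioo a b).inter (ordConnected_coe_Ioo a' b'))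
    (fun t ht => hz.2 t ht.1.1 ht.1.2) (fun t ht => hw.2 t ht.2.1 ht.2.2)
    (t₀ := t₀) ⟨⟨ha, hb⟩, ha', hb'⟩ h ⟨⟨hta, htb⟩, hta', htb'⟩

/-- Through every point passes a maximal solution, defined on an interval around `0` containing
the interval of definition of every other solution with the same value at `0`. -/
theorem exists_maximal_flowSol {f : ℂ → ℂ} (hf : Differentiable ℂ f) (p : ℂ) :
    ∃ (A B : EReal) (z : ℝ → ℂ), A < 0 ∧ 0 < B ∧ z 0 = p ∧ FlowSol f A B z ∧
      ∀ a b w, FlowSol f a b w → a < 0 → 0 < b → w 0 = p →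
        A ≤ a ∧ b ≤ B ∧ ∀ t : ℝ, a < t → t < b → w t = z t := by
  classical
  let Sol : EReal → EReal → (ℝ → ℂ) → Prop :=
    fun a b w => FlowSol f a b w ∧ a < 0 ∧ 0 < b ∧ w 0 = p
  have huniq : ∀ {a b w a' b' w'} {t : ℝ}, Sol a b w → Sol a' b' w' → a < t → t < b →
      a' < t → t < b' → w t = w' t := by
    rintro a b w a' b' w' t ⟨h1, h2, h3, h4⟩ ⟨h1', h2', h3', h4'⟩ k1 k2 k3 k4
    exact h1.eqOn hf h1' (t₀ := 0) (h4.trans h4'.symm) (by simpa) (by simpa) (by simpa) (by simpa)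
      k1 k2 k3 k4
  let A : EReal := sInf {a | ∃ b w, Sol a b w}
  let B : EReal := sSup {b | ∃ a w, Sol a b w}
  have hcov : ∀ t : ℝ, A < t → t < B → ∃ a b w, Sol a b w ∧ a < t ∧ t < b := by
    intro t h1 h2
    obtain ⟨a, ⟨b, w, hw⟩, ha⟩ := sInf_lt_iff.1 h1
    obtain ⟨b', ⟨a', w', hw'⟩, hb'⟩ := lt_sSup_iff.1 h2
    rcases le_total t 0 with h | h
    · exact ⟨a, b, w, hw, ha, lt_of_le_of_lt (by exact_mod_cast h) hw.2.2.1⟩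
    · exact ⟨a', b', w', hw', lt_of_lt_of_le hw'.2.1 (by exact_mod_cast h), hb'⟩
  let z : ℝ → ℂ := fun t =>
    if h : ∃ a b w, Sol a b w ∧ a < t ∧ t < b then h.choose_spec.choose_spec.choose t else 0
  have hzeq : ∀ {a b w} {t : ℝ}, Sol a b w → a < t → t < b → w t = z t := by
    intro a b w t hw h1 h2
    have h : ∃ a b w, Sol a b w ∧ a < (t : EReal) ∧ (t : EReal) < b := ⟨a, b, w, hw, h1, h2⟩
    have hs := h.choose_spec.choose_spec.choose_spec
    have : z t = h.choose_spec.choose_spec.choose t := dif_pos h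
    rw [this]
    exact huniq hw hs.1 h1 h2 hs.2.1 hs.2.2
  obtain ⟨α, hα0, ε, hε, hα⟩ := (((hf.contDiff (n := 1)).restrict_scalars ℝ).contDiffAt
    (x := p)).exists_forall_mem_closedBall_exists_eq_forall_mem_Ioo_hasDerivAt₀ 0
  have hαs : Sol ((-ε : ℝ) : EReal) (ε : ℝ) α := by
    refine ⟨⟨by exact_mod_cast (by linarith), fun t h1 h2 => hα t ⟨?_, ?_⟩⟩,
      by exact_mod_cast (by linarith), by exact_mod_cast hε, hα0⟩
    · have := EReal.coe_lt_coe_iff.1 h1; linarith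
    · have := EReal.coe_lt_coe_iff.1 h2; linarith
  have hA : A < 0 := lt_of_le_of_lt (sInf_le ⟨_, _, hαs⟩) hαs.2.1
  have hB : 0 < B := lt_of_lt_of_le hαs.2.2.1 (le_sSup ⟨_, _, hαs⟩)
  refine ⟨A, B, z, hA, hB, ?_, ⟨hA.trans hB, fun t h1 h2 => ?_⟩, fun a b w hw ha hb hp => ?_⟩
  · rw [← hzeq hαs (t := 0) (by simpa using hαs.2.1) (by simpa using hαs.2.2.1), hα0]
  · obtain ⟨a, b, w, hw, h3, h4⟩ := hcov t h1 h2
    have hev : z =ᶠ[nhds t] w := by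
      filter_upwards [(isOpen_coe_Ioo a b).mem_nhds ⟨h3, h4⟩] with s hs
      exact (hzeq hw hs.1 hs.2).symm
    rw [hev.eq_of_nhds]
    exact (hw.1.2 t h3 h4).congr_of_eventuallyEq hev
  · have hs : Sol a b w := ⟨hw, ha, hb, hp⟩
    exact ⟨sInf_le ⟨_, _, hs⟩, le_sSup ⟨_, _, hs⟩, fun t h1 h2 => hzeq hs h1 h2⟩

/-- A solution that cannot be extended beyond a finite time `c` tends to infinity there. -/
theorem tendsto_cobounded_of_not_extendable {f : ℂ → ℂ} (hf : Differentiable ℂ f) {A : EReal}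
    {c : ℝ} {z : ℝ → ℂ} (hz : FlowSol f A c z)
    (hmax : ∀ (b : ℝ) w, FlowSol f A b w → c ≤ b →
      (∀ t : ℝ, A < t → t < c → w t = z t) → b ≤ c) :
    Tendsto z (nhdsWithin c (Set.Iio c)) (Bornology.cobounded ℂ) := by
  classical
  by_contra hcon
  rw [← tendsto_norm_atTop_iff_cobounded, tendsto_atTop] at hcon
  push Not at hcon
  obtain ⟨R, hR⟩ := hcon
  have hR' : ∃ᶠ t in nhdsWithin c (Set.Iio c), z t ∈ Metric.closedBall (0 : ℂ) R := by
    refine hR.mono fun t ht => ?_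
    rw [mem_closedBall_zero_iff]; exact ht.le
  obtain ⟨q, -, hq⟩ := (isCompact_closedBall (0 : ℂ) R).exists_mapClusterPt_of_frequently hR'
  obtain ⟨r, hr, ε, hε, hex⟩ := (((hf.contDiff (n := 1)).restrict_scalars ℝ).contDiffAt
    (x := q)).exists_forall_mem_closedBall_exists_eq_forall_mem_Ioo_hasDerivAt 0
  have hfr := mapClusterPt_iff_frequently.1 hq _ (Metric.closedBall_mem_nhds q hr)
  have hev : ∀ᶠ t : ℝ in nhdsWithin c (Set.Iio c), A < t ∧ t < c ∧ c - ε < t := by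
    have h1 : ∀ᶠ t : ℝ in nhdsWithin c (Set.Iio c), A < t :=
      nhdsWithin_le_nhds (((isOpen_Ioi (a := A)).preimage continuous_coe_real_ereal).mem_nhds hz.1)
    filter_upwards [h1, self_mem_nhdsWithin,
      nhdsWithin_le_nhds (Ioi_mem_nhds (show c - ε < c by linarith))] with t h1 h2 h3
    exact ⟨h1, h2, h3⟩
  obtain ⟨t₁, ht₁, hA1, hc1, hε1⟩ := (hfr.and_eventually hev).exists
  obtain ⟨α₀, hα₀, hα₀'⟩ := hex _ ht₁
  let α : ℝ → ℂ := fun t => α₀ (t - t₁)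
  have hα : ∀ t ∈ Ioo (t₁ - ε) (t₁ + ε), HasDerivAt α (f (α t)) t := by
    intro t ht
    have := hα₀' (t - t₁) ⟨by linarith [ht.1], by linarith [ht.2]⟩
    exact HasDerivAt.comp_sub_const t t₁ this
  have hαz : ∀ t ∈ Ico t₁ c, z t = α t := by
    have hsub : ∀ t ∈ Ico t₁ c, t ∈ Ioo (t₁ - ε) (t₁ + ε) :=
      fun t ht => ⟨by linarith [ht.1], by linarith [ht.2]⟩
    refine flow_eqOn hf (S := Ico t₁ c) ordConnected_Ico (fun t ht => hz.2 t
      (hA1.trans_le (by exact_mod_cast ht.1)) (by exact_mod_cast ht.2))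
      (fun t ht => hα t (hsub t ht)) (t₀ := t₁) ⟨le_rfl, hc1⟩ ?_
    simp [α, hα₀]
  let w : ℝ → ℂ := fun t => if t < c then z t else α t
  have hw : FlowSol f A ((t₁ + ε : ℝ) : EReal) w := by
    refine ⟨hA1.trans (by exact_mod_cast (by linarith)), fun t h1 h2 => ?_⟩
    have h2 : t < t₁ + ε := by exact_mod_cast h2
    rcases lt_or_ge t c with h | h
    · have hev : w =ᶠ[nhds t] z := by
        filter_upwards [Iio_mem_nhds h] with s hs
        exact if_pos hs
      rw [hev.eq_of_nhds]
      exact (hz.2 t h1 (by exact_mod_cast h)).congr_of_eventuallyEq hev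
    · have hev : w =ᶠ[nhds t] α := by
        filter_upwards [Ioi_mem_nhds (hc1.trans_le h)] with s hs
        by_cases hsc : s < c
        · simp only [w, if_pos hsc]; exact hαz s ⟨le_of_lt hs, hsc⟩
        · simp only [w, if_neg hsc]
      rw [hev.eq_of_nhds]
      exact (hα t ⟨by linarith, h2⟩).congr_of_eventuallyEq hev
  have := hmax _ w hw (by linarith) (fun t _ h2 => if_pos (by exact_mod_cast h2))
  linarith

/-- `z` is the maximal solution with `z 0 = p`, and its interval of definition `(A, B)` contains
that of every solution starting at `p`. -/
def IsMaximalFrom (f : ℂ → ℂ) (p : ℂ) (A B : EReal) (z : ℝ → ℂ) : Prop :=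
  A < 0 ∧ 0 < B ∧ z 0 = p ∧ FlowSol f A B z ∧
    ∀ a b w, FlowSol f a b w → a < 0 → 0 < b → w 0 = p →
      A ≤ a ∧ b ≤ B ∧ ∀ t : ℝ, a < t → t < b → w t = z t

theorem IsMaximalFrom.maxFlowSol {f : ℂ → ℂ} {p : ℂ} {A B : EReal} {z : ℝ → ℂ}
    (h : IsMaximalFrom f p A B z) : MaxFlowSol f A B z := by
  obtain ⟨hA, hB, h0, hs, hu⟩ := h
  refine ⟨hs, fun a' b' w hw ha hb hwz => ?_⟩
  have hw0 : w 0 = p := by rw [hwz 0 (by simpa using hA) (by simpa using hB), h0]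
  obtain ⟨h1, h2, -⟩ := hu a' b' w hw (ha.trans_lt hA) (hB.trans_le hb) hw0
  exact ⟨le_antisymm ha h1, le_antisymm h2 hb⟩

theorem IsMaximalFrom.escapesInFiniteTime {f : ℂ → ℂ} (hf : Differentiable ℂ f) {p : ℂ}
    {A B : EReal} {z : ℝ → ℂ} (h : IsMaximalFrom f p A B z) (hB : B ≠ ⊤) :
    EscapesInFiniteTime f A B z := by
  refine ⟨h.maxFlowSol, ?_⟩
  obtain ⟨hA, hB0, h0, hs, hu⟩ := h
  lift B to ℝ using ⟨hB, (lt_of_le_of_lt bot_le hB0).ne'⟩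
  refine ⟨B, rfl, tendsto_cobounded_of_not_extendable hf hs fun b w hw hb hwz => ?_⟩
  have hw0 : w 0 = p := by rw [hwz 0 (by simpa using hA) (by exact_mod_cast hB0), h0]
  exact_mod_cast (hu A b w hw hA (hB0.trans_le (by exact_mod_cast hb)) hw0).2.1

theorem EReal.sub_coe_lt_coe_iff {a : EReal} {t s : ℝ} :
    a - t < s ↔ a < ((s + t : ℝ) : EReal) := by
  rw [EReal.sub_lt_iff (by simp) (by simp), EReal.coe_add]

theorem EReal.coe_lt_sub_coe_iff {b : EReal} {t s : ℝ} :
    (s : EReal) < b - t ↔ ((s + t : ℝ) : EReal) < b := by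
  rw [EReal.lt_sub_iff_add_lt (by simp) (by simp), EReal.coe_add]

theorem IsMaximalFrom.shift_aux {f : ℂ → ℂ} {p : ℂ} {A B A' B' : EReal} {z z' : ℝ → ℂ}
    (h : IsMaximalFrom f p A B z) {t : ℝ} (hA : A < t) (hB : t < B)
    (h' : IsMaximalFrom f (z t) A' B' z') :
    Traj A B z ⊆ Traj A' B' z' ∧ B - t ≤ B' ∧ A' < ((-t : ℝ) : EReal) ∧
      ((-t : ℝ) : EReal) < B' ∧ z' (-t) = p := by
  obtain ⟨hA0, hB0, h0, hs, -⟩ := h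
  have hw : FlowSol f (A - t) (B - t) (fun s => z (s + t)) :=
    ⟨lt_trans (b := ((0 : ℝ) : EReal)) (EReal.sub_coe_lt_coe_iff.2 (by simpa))
      (EReal.coe_lt_sub_coe_iff.2 (by simpa)),
      fun s hs1 hs2 => (hs.2 (s + t) (EReal.sub_coe_lt_coe_iff.1 hs1)
        (EReal.coe_lt_sub_coe_iff.1 hs2)).comp_add_const s t⟩
  obtain ⟨h1, h2, h3⟩ := h'.2.2.2.2 _ _ _ hw
    (by simpa using (EReal.sub_coe_lt_coe_iff (s := 0)).2 (by simpa))
    (by simpa using (EReal.coe_lt_sub_coe_iff (s := 0)).2 (by simpa)) (by simp)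
  have hm : A - t < ((-t : ℝ) : EReal) := EReal.sub_coe_lt_coe_iff.2 (by simpa)
  have hm' : ((-t : ℝ) : EReal) < B - t := EReal.coe_lt_sub_coe_iff.2 (by simpa)
  refine ⟨?_, h2, h1.trans_lt hm, hm'.trans_le h2, ?_⟩
  · rintro _ ⟨s, ⟨hs1, hs2⟩, rfl⟩
    have k1 : A - t < ((s - t : ℝ) : EReal) := EReal.sub_coe_lt_coe_iff.2 (by simpa)
    have k2 : ((s - t : ℝ) : EReal) < B - t := EReal.coe_lt_sub_coe_iff.2 (by simpa)
    exact ⟨s - t, ⟨h1.trans_lt k1, k2.trans_le h2⟩, by simp [← h3 (s - t) k1 k2]⟩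
  · simp [← h3 (-t) hm hm', h0]

theorem IsMaximalFrom.shift {f : ℂ → ℂ} {p : ℂ} {A B A' B' : EReal} {z z' : ℝ → ℂ}
    (h : IsMaximalFrom f p A B z) {t : ℝ} (hA : A < t) (hB : t < B)
    (h' : IsMaximalFrom f (z t) A' B' z') :
    Traj A B z = Traj A' B' z' ∧ B = B' + t := by
  obtain ⟨h1, h2, h3, h4, h5⟩ := h.shift_aux hA hB h'
  obtain ⟨k1, k2, -⟩ := h'.shift_aux h3 h4 (h5.symm ▸ h)
  refine ⟨h1.antisymm k1, le_antisymm ?_ ?_⟩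
  · rwa [EReal.sub_le_iff_le_add (by simp) (by simp)] at h2
  · simpa [sub_eq_add_neg] using k2

/-- If, for every `n`, there are `n` points of finite forward escape time whose trajectories are
distinct, then there are infinitely many escaping trajectories. -/
theorem exists_disjoint_escaping_of_finite {f : ℂ → ℂ} (hf : Differentiable ℂ f)
    {A B : ℂ → EReal} {Z : ℂ → ℝ → ℂ} (hm : ∀ p, IsMaximalFrom f p (A p) (B p) (Z p))
    (hn : ∀ n : ℕ, ∃ p : Fin n → ℂ, (∀ i, B (p i) ≠ ⊤) ∧
      ∀ i j, ∀ t : ℝ, A (p i) < t → t < B (p i) → Z (p i) t = p j → i = j) :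
    ∃ (Z : ℕ → ℝ → ℂ) (A B : ℕ → EReal),
      (∀ n, EscapesInFiniteTime f (A n) (B n) (Z n)) ∧
      Pairwise fun m n =>
        Disjoint (Traj (A m) (B m) (Z m)) (Traj (A n) (B n) (Z n)) := by
  let O : ℂ → Set ℂ := fun p => Traj (A p) (B p) (Z p)
  have hself : ∀ p, p ∈ O p := fun p =>
    ⟨0, ⟨by simpa using (hm p).1, by simpa using (hm p).2.1⟩, (hm p).2.2.1⟩
  have hO : ∀ p q, q ∈ O p → O p = O q := by
    rintro p _ ⟨t, ⟨h1, h2⟩, rfl⟩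
    exact ((hm p).shift h1 h2 (hm _)).1
  have hdisj : ∀ p q, O p ≠ O q → Disjoint (O p) (O q) := by
    intro p q hpq
    rw [Set.disjoint_left]
    intro x hx hx'
    exact hpq ((hO p x hx).trans (hO q x hx').symm)
  have hinf : (O '' {p | B p ≠ ⊤}).Infinite := by
    intro hfin
    obtain ⟨p, hp, hinj⟩ := hn (hfin.toFinset.card + 1)
    have := Finset.card_le_card_of_injOn (s := Finset.univ) (t := hfin.toFinset)
      (fun i => O (p i)) (fun i _ => by simpa using ⟨p i, hp i, rfl⟩) (by
        intro i _ j _ hij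
        obtain ⟨t, ⟨h1, h2⟩, h3⟩ : p j ∈ O (p i) := by
          have := hself (p j)
          simp only at hij
          rwa [← hij] at this
        exact hinj i j t h1 h2 h3)
    simp at this
  let e := hinf.natEmbedding
  choose P hP hPe using fun n => (e n).2
  refine ⟨fun n => Z (P n), fun n => A (P n), fun n => B (P n),
    fun n => (hm _).escapesInFiniteTime hf (hP n), fun m n hmn => hdisj _ _ ?_⟩
  rw [hPe, hPe]
  exact fun h => hmn (e.injective (Subtype.ext h))

theorem exists_local_complex_flow {f : ℂ → ℂ} (hf : Differentiable ℂ f) (q : ℂ) :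
    ∃ η > 0, ∃ u : ℂ → ℂ, u 0 = q ∧ ∀ T ∈ Metric.ball (0 : ℂ) η, HasDerivAt u (f (u T)) T := by
  by_cases hq : f q = 0
  · exact ⟨1, one_pos, fun _ => q, rfl, fun T _ => by simpa [hq] using hasDerivAt_const T q⟩
  obtain ⟨ρ, hρ, hρf⟩ := Metric.eventually_nhds_iff_ball.1
    (hf.continuous.continuousAt.eventually_ne hq)
  have hd : DifferentiableOn ℂ (fun z => (f z)⁻¹) (Metric.ball q ρ) :=
    fun z hz => ((hf z).inv (hρf z hz)).differentiableWithinAt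
  obtain ⟨g, hg0, hg⟩ := hd.isExactOn_ball.with_val_at q 0
  have hgs : HasStrictDerivAt g ((f q)⁻¹) q := by
    have hgd : DifferentiableOn ℂ g (Metric.ball q ρ) :=
      fun z hz => (hg z hz).differentiableAt.differentiableWithinAt
    have := (hgd.analyticAt (Metric.ball_mem_nhds q hρ)).hasStrictDerivAt
    rwa [(hg q (Metric.mem_ball_self hρ)).deriv] at this
  let e := (hgs.hasStrictFDerivAt_equiv (inv_ne_zero hq)).toOpenPartialHomeomorph g
  have hqs : q ∈ e.source :=
    (hgs.hasStrictFDerivAt_equiv (inv_ne_zero hq)).mem_toOpenPartialHomeomorph_source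
  have heq : e q = 0 := hg0
  have ht : (0 : ℂ) ∈ e.target := heq ▸ e.map_source hqs
  have hs0 : e.symm 0 = q := by rw [← heq, e.left_inv hqs]
  have hnear : ∀ᶠ T in nhds (0 : ℂ), T ∈ e.target ∧ e.symm T ∈ Metric.ball q ρ :=
    Filter.Eventually.and (e.open_target.mem_nhds ht) ((e.symm.continuousAt ht).preimage_mem_nhds
      (by rw [hs0]; exact Metric.ball_mem_nhds q hρ))
  obtain ⟨η, hη, hηe⟩ := Metric.eventually_nhds_iff_ball.1 hnear
  refine ⟨η, hη, e.symm, hs0, fun T hT => ?_⟩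
  obtain ⟨h1, h2⟩ := hηe T hT
  simpa using e.hasDerivAt_symm h1 (inv_ne_zero (hρf _ h2)) (hg _ h2)

/-- If `Y · s` are solutions of `ż = f(z)` and the initial values `Y 0 s` move along the flow of
`i f`, then so do the values `Y a s`. -/
theorem hasDerivAt_transversal {f : ℂ → ℂ} (hf : Differentiable ℂ f) {Y : ℝ → ℝ → ℂ} {a s₀ : ℝ}
    (ha : 0 ≤ a)
    (hY : ∀ᶠ s in nhds s₀, ∀ t ∈ Icc 0 a, HasDerivAt (fun t => Y t s) (f (Y t s)) t)
    (h0 : ∀ᶠ s in nhds s₀, HasDerivAt (Y 0) (Complex.I * f (Y 0 s)) s) :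
    HasDerivAt (Y a) (Complex.I * f (Y a s₀)) s₀ := by
  let Q : ℝ → Prop := fun t => ∀ᶠ s in nhds s₀, HasDerivAt (Y t) (Complex.I * f (Y t s)) s
  have hIf : Differentiable ℂ (fun z => Complex.I * f z) := hf.const_mul _
  have hstep : ∀ t ∈ Icc 0 a, ∃ ε > 0, ∀ t₁ ∈ Icc 0 a, |t₁ - t| < ε → Q t₁ →
      ∀ t₂ ∈ Icc 0 a, |t₂ - t| < ε → Q t₂ := by
    intro t ht
    obtain ⟨η, hη, u, hu0, hu⟩ := exists_local_complex_flow hf (Y t s₀)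
    let U : ℝ → ℝ → ℂ := fun x s => u ((x - t : ℝ) + (s - s₀ : ℝ) * Complex.I)
    have hball : ∀ x s : ℝ, |x - t| < η / 2 → |s - s₀| < η / 2 →
        ((x - t : ℝ) + (s - s₀ : ℝ) * Complex.I : ℂ) ∈ Metric.ball (0 : ℂ) η := by
      intro x s hx hs
      rw [mem_ball_zero_iff]
      refine (norm_add_le _ _).trans_lt ?_
      rw [norm_mul, Complex.norm_I, mul_one, Complex.norm_real, Complex.norm_real]
      simp only [Real.norm_eq_abs]
      linarith
    have hUx : ∀ x s : ℝ, |x - t| < η / 2 → |s - s₀| < η / 2 →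
        HasDerivAt (fun x => U x s) (f (U x s)) x := by
      intro x s hx hs
      have h1 : HasDerivAt (fun x : ℝ => ((x - t : ℝ) + (s - s₀ : ℝ) * Complex.I : ℂ)) 1 x := by
        have := ((hasDerivAt_id x).sub_const t).ofReal_comp
        simpa using this.add_const (((s - s₀ : ℝ) : ℂ) * Complex.I)
      have h2 := (hu _ (hball x s hx hs)).comp x h1
      rw [mul_one] at h2
      exact h2
    have hUs : ∀ x s : ℝ, |x - t| < η / 2 → |s - s₀| < η / 2 →
        HasDerivAt (U x) (Complex.I * f (U x s)) s := by
      intro x s hx hs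
      have h1 : HasDerivAt (fun s : ℝ => ((x - t : ℝ) + (s - s₀ : ℝ) * Complex.I : ℂ))
          Complex.I s := by
        have := (((hasDerivAt_id s).sub_const s₀).ofReal_comp).mul_const Complex.I
        simpa using this.const_add ((x - t : ℝ) : ℂ)
      have h2 := (hu _ (hball x s hx hs)).comp s h1
      rw [mul_comm] at h2
      exact h2
    refine ⟨η / 2, by linarith, fun t₁ ht₁ ht₁t hQ t₂ ht₂ ht₂t => ?_⟩
    have hoc : (Icc 0 a ∩ Ioo (t - η / 2) (t + η / 2)).OrdConnected :=
      ordConnected_Icc.inter ordConnected_Ioo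
    have hmem : ∀ x ∈ Icc 0 a, |x - t| < η / 2 → x ∈ Icc 0 a ∩ Ioo (t - η / 2) (t + η / 2) :=
      fun x hx hxt => ⟨hx, by linarith [(abs_lt.1 hxt).1], by linarith [(abs_lt.1 hxt).2]⟩
    have hmem' : ∀ x ∈ Icc 0 a ∩ Ioo (t - η / 2) (t + η / 2), |x - t| < η / 2 :=
      fun x hx => abs_lt.2 ⟨by linarith [hx.2.1], by linarith [hx.2.2]⟩
    have hs₀ : |s₀ - s₀| < η / 2 := by simpa using hη
    have hinit : Y t₁ s₀ = U t₁ s₀ :=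
      flow_eqOn hf hoc (z := fun x => Y x s₀) (w := fun x => U x s₀)
        (fun x hx => hY.self_of_nhds x hx.1) (fun x hx => hUx x s₀ (hmem' x hx) hs₀)
        (t₀ := t) (hmem t ht (by simpa using hη)) (by simp [U, hu0]) (hmem t₁ ht₁ ht₁t)
    obtain ⟨δ, hδ, hδs⟩ := Metric.eventually_nhds_iff_ball.1 (hY.and (hQ.and
      (Metric.ball_mem_nhds s₀ (show 0 < η / 2 by linarith))))
    have hvert : ∀ s ∈ Metric.ball s₀ δ, Y t₁ s = U t₁ s :=
      flow_eqOn hIf (S := Metric.ball s₀ δ) (by rw [Real.ball_eq_Ioo]; exact ordConnected_Ioo)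
        (fun s hs => (hδs s hs).2.1) (fun s hs => hUs t₁ s ht₁t (hδs s hs).2.2)
        (Metric.mem_ball_self hδ) hinit
    have hhor : ∀ s ∈ Metric.ball s₀ δ, Y t₂ s = U t₂ s := fun s hs =>
      flow_eqOn hf hoc (z := fun x => Y x s) (w := fun x => U x s)
        (fun x hx => (hδs s hs).1 x hx.1) (fun x hx => hUx x s (hmem' x hx) (hδs s hs).2.2)
        (t₀ := t₁) (hmem t₁ ht₁ ht₁t) (hvert s hs) (hmem t₂ ht₂ ht₂t)
    filter_upwards [Metric.ball_mem_nhds s₀ hδ] with s hs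
    have hev : Y t₂ =ᶠ[nhds s] U t₂ := by
      filter_upwards [Metric.isOpen_ball.mem_nhds hs] with s' hs' using hhor s' hs'
    rw [hev.eq_of_nhds]
    exact (hUs t₂ s ht₂t (hδs s hs).2.2).congr_of_eventuallyEq hev
  have hQ : Q 0 → Q a := by
    refine isPreconnected_Icc.induction₂' (s := Icc 0 a) (fun x y => Q x → Q y) (fun t ht => ?_)
      (fun x y z _ _ _ h1 h2 h => h2 (h1 h)) ⟨le_rfl, ha⟩ ⟨ha, le_rfl⟩
    obtain ⟨ε, hε, h⟩ := hstep t ht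
    filter_upwards [self_mem_nhdsWithin, nhdsWithin_le_nhds (Metric.ball_mem_nhds t hε)]
      with y hy hyt
    exact ⟨fun hQ => h t ht (by simpa using hε) hQ y hy hyt,
      fun hQ => h y hy hyt hQ t ht (by simpa using hε)⟩
  exact (hQ h0).self_of_nhds

theorem exists_polynomial_of_norm_le_pow {f : ℂ → ℂ} (hf : Differentiable ℂ f) {C : ℝ} {n : ℕ}
    (h : ∀ z, 1 ≤ ‖z‖ → ‖f z‖ ≤ C * ‖z‖ ^ n) : ∃ p : Polynomial ℂ, ∀ z, f z = p.eval z := by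
  have hzero : ∀ m, n < m → iteratedDeriv m f 0 = 0 := by
    intro m hm
    have hle : ∀ R : ℝ, 1 ≤ R → ‖iteratedDeriv m f 0‖ * R ≤ m.factorial * C := by
      intro R hR
      have hR0 : 0 < R := by linarith
      have h1 := Complex.norm_iteratedDeriv_le_of_forall_mem_sphere_norm_le m hR0
        (hf.diffContOnCl (s := Metric.ball 0 R)) (C := C * R ^ n) (fun z hz => by
          rw [mem_sphere_zero_iff_norm] at hz
          simpa [hz] using h z (by rw [hz]; exact hR))
      have hC : 0 ≤ C := by
        have := h 1 (by simp)
        simp only [norm_one, one_pow, mul_one] at this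
        exact (norm_nonneg _).trans this
      rw [le_div_iff₀ (by positivity)] at h1
      have h2 : R ^ (n + 1) ≤ R ^ m := pow_le_pow_right₀ hR hm
      have h3 : ‖iteratedDeriv m f 0‖ * R * R ^ n ≤ m.factorial * C * R ^ n := by
        calc ‖iteratedDeriv m f 0‖ * R * R ^ n = ‖iteratedDeriv m f 0‖ * R ^ (n + 1) := by ring
          _ ≤ ‖iteratedDeriv m f 0‖ * R ^ m := by gcongr
          _ ≤ m.factorial * (C * R ^ n) := h1
          _ = m.factorial * C * R ^ n := by ring
      exact le_of_mul_le_mul_right h3 (by positivity)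
    by_contra hne
    have hpos : 0 < ‖iteratedDeriv m f 0‖ := norm_pos_iff.2 hne
    have h1 := hle (max 1 (m.factorial * C / ‖iteratedDeriv m f 0‖ + 1)) (le_max_left _ _)
    have h2 := mul_le_mul_of_nonneg_left
      (le_max_right 1 (m.factorial * C / ‖iteratedDeriv m f 0‖ + 1)) hpos.le
    rw [mul_add, mul_div_cancel₀ _ hpos.ne'] at h2
    linarith
  refine ⟨∑ m ∈ Finset.range (n + 1),
    Polynomial.C ((m.factorial : ℂ)⁻¹ * iteratedDeriv m f 0) * Polynomial.X ^ m, fun z => ?_⟩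
  rw [← Complex.taylorSeries_eq_of_entire hf 0 z, tsum_eq_sum (s := Finset.range (n + 1))]
  · rw [Polynomial.eval_finsetSum]
    refine Finset.sum_congr rfl fun m _ => ?_
    simp only [sub_zero, smul_eq_mul, Polynomial.eval_mul, Polynomial.eval_C, Polynomial.eval_pow,
      Polynomial.eval_X]
    ring
  · intro m hm
    rw [hzero m (by simpa using hm)]
    simp

theorem one_le_one_sub_mul_exp {u : ℝ} (hu : u ≤ 1 / 2) :
    1 ≤ (1 - u) * Real.exp (u + 2 * u ^ 2) := by
  have h1 : 1 ≤ (1 - u) * (1 + u + 2 * u ^ 2) := by nlinarith [sq_nonneg u]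
  have h2 := Real.add_one_le_exp (u + 2 * u ^ 2)
  refine h1.trans (mul_le_mul_of_nonneg_left ?_ (by linarith))
  linarith

theorem TranscendentalEntire.exists_norm_le_exp {f : ℂ → ℂ} (hf : TranscendentalEntire f) (L : ℝ)
    {ε : ℝ} (hε : 0 < ε) :
    ∃ z₀ : ℂ, ∃ b : ℝ, f z₀ ≠ 0 ∧ z₀ ≠ 0 ∧ 1 ≤ b ∧ L ≤ b ∧ ∀ ζ : ℂ, ‖ζ‖ ≤ L →
      ‖f (z₀ * Complex.exp (ζ / b))‖ * Real.exp (-(ζ.re / b)) ≤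
        ‖f z₀‖ * Real.exp (ζ.re + ε) := by
  obtain ⟨A, hA⟩ := exists_nat_ge (max L 1)
  obtain ⟨K, hK⟩ := exists_nat_ge (max (2 * max L 1) (2 * L ^ 2 / ε))
  have hAL := (le_max_left _ _).trans hA
  have hA1 := (le_max_right _ _).trans hA
  have hK1 := (le_max_left _ _).trans hK
  have hKε := (le_max_right _ _).trans hK
  have hKL : 2 * L ≤ K := by linarith [le_max_left L 1]
  have hK2 : (2 : ℝ) ≤ K := by linarith [le_max_right L 1]
  have hK0 : K ≠ 0 := by rintro rfl; norm_num at hK2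
  obtain ⟨M, hM⟩ := (isCompact_closedBall (0 : ℂ) (Real.exp 1)).exists_bound_of_continuousOn
    hf.1.continuous.continuousOn
  have hM0 : 0 ≤ M := (norm_nonneg _).trans
    (hM 0 (Metric.mem_closedBall_self (Real.exp_pos 1).le))
  obtain ⟨z₂, hz₂, hfz₂⟩ : ∃ z, 1 ≤ ‖z‖ ∧ M * ‖z‖ ^ (A + 1 + K) < ‖f z‖ := by
    by_contra! h
    exact hf.2 (exists_polynomial_of_norm_le_pow hf.1 h)
  set S := Real.log ‖z₂‖ + 1 with hS
  let Φ : ℂ → ℝ := fun z => ‖f z‖ / ‖z‖ ^ (A + 1) * (S - Real.log ‖z‖) ^ K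
  let D : Set ℂ := {z | 1 ≤ ‖z‖ ∧ Real.log ‖z‖ ≤ S}
  have hlogpos : 0 ≤ Real.log ‖z₂‖ := Real.log_nonneg hz₂
  have hDeq : D = Metric.closedBall 0 (Real.exp S) ∩ {z | 1 ≤ ‖z‖} := by
    ext z
    simp only [D, mem_ofPred_eq, mem_inter_iff, mem_closedBall_zero_iff]
    constructor
    · rintro ⟨h1, h2⟩
      exact ⟨(Real.log_le_iff_le_exp (by linarith)).1 h2, h1⟩
    · rintro ⟨h1, h2⟩
      exact ⟨h2, (Real.log_le_iff_le_exp (by linarith)).2 h1⟩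
  have hDc : IsCompact D := by
    rw [hDeq]
    exact (isCompact_closedBall _ _).inter_right (isClosed_le continuous_const continuous_norm)
  have hΦc : ContinuousOn Φ D := by
    intro z hz
    have hz0 : ‖z‖ ≠ 0 := by linarith [hz.1]
    have hfc := hf.1.continuous
    exact ContinuousAt.continuousWithinAt (by fun_prop (disch := first | assumption | positivity))
  have hz₂D : z₂ ∈ D := ⟨hz₂, by linarith⟩
  obtain ⟨z₀, hz₀, hmax⟩ := hDc.exists_isMaxOn ⟨z₂, hz₂D⟩ hΦc
  have hΦ₂ : M * S ^ K < Φ z₂ := by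
    have h1 : S ≤ ‖z₂‖ := by linarith [Real.log_le_sub_one_of_pos (show 0 < ‖z₂‖ by linarith)]
    have h2 : Φ z₂ = ‖f z₂‖ / ‖z₂‖ ^ (A + 1) := by simp [Φ, hS]
    rw [h2, lt_div_iff₀ (by positivity)]
    refine lt_of_le_of_lt ?_ hfz₂
    calc M * S ^ K * ‖z₂‖ ^ (A + 1) ≤ M * ‖z₂‖ ^ K * ‖z₂‖ ^ (A + 1) := by gcongr
      _ = M * ‖z₂‖ ^ (A + 1 + K) := by ring
  have hΦ₀ : M * S ^ K < Φ z₀ := hΦ₂.trans_le (hmax hz₂D)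
  have hn0 : 0 < ‖z₀‖ := by linarith [hz₀.1]
  have hΦpos : 0 < Φ z₀ := lt_of_le_of_lt (by positivity) hΦ₀
  have hf₀ : f z₀ ≠ 0 := fun h => by simp [Φ, h] at hΦpos
  have hd : 0 < S - Real.log ‖z₀‖ := by
    refine lt_of_le_of_ne (by linarith [hz₀.2]) fun h => ?_
    simp only [Φ, ← h, zero_pow hK0, mul_zero, lt_irrefl] at hΦpos
  have hlog1 : 1 < Real.log ‖z₀‖ := by
    by_contra! h
    have h1 := hM z₀ (by
      rw [mem_closedBall_zero_iff]; exact (Real.log_le_iff_le_exp hn0).1 h)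
    have h2 : Φ z₀ ≤ M * S ^ K := by
      have h3 : ‖f z₀‖ / ‖z₀‖ ^ (A + 1) ≤ M :=
        (div_le_self (norm_nonneg _) (one_le_pow₀ hz₀.1)).trans h1
      have h4 : S - Real.log ‖z₀‖ ≤ S := by linarith [Real.log_nonneg hz₀.1]
      simp only [Φ]
      gcongr
    linarith
  obtain ⟨d, hd'⟩ : ∃ d, d = S - Real.log ‖z₀‖ := ⟨_, rfl⟩
  rw [← hd'] at hd
  have hKd : 0 < (K : ℝ) / d := by positivity
  have hb1 : 1 ≤ A + K / d := by linarith
  have hb0 : 0 < A + K / d := by linarith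
  obtain ⟨b, hb⟩ : ∃ b, b = A + K / d := ⟨_, rfl⟩
  rw [← hb] at hb0 hb1
  refine ⟨z₀, b, hf₀, norm_pos_iff.1 hn0, hb1, by linarith, fun ζ hζ => ?_⟩
  obtain ⟨x, hx⟩ : ∃ x, x = ζ.re / b := ⟨_, rfl⟩
  rw [← hx]
  have hζre : |ζ.re| ≤ L := (Complex.abs_re_le_norm ζ).trans hζ
  have hL0 : 0 ≤ L := (abs_nonneg _).trans hζre
  have hbd : K ≤ b * d := by
    rw [hb, add_mul, div_mul_cancel₀ _ hd.ne']
    have : 0 ≤ A * d := by positivity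
    linarith
  have hxb : x * b = ζ.re := hx ▸ div_mul_cancel₀ _ hb0.ne'
  have hx1 : |x| ≤ 1 := by
    rw [hx, abs_div, abs_of_pos hb0, div_le_one hb0]
    linarith
  obtain ⟨u, hu⟩ : ∃ u, u = x / d := ⟨_, rfl⟩
  have hud : u * d = x := hu ▸ div_mul_cancel₀ _ hd.ne'
  have huK : |u| * K ≤ L := by
    calc |u| * K ≤ |u| * (b * d) := by gcongr
      _ = |u * (b * d)| := by rw [abs_mul, abs_of_pos (mul_pos hb0 hd)]
      _ = |ζ.re| := by rw [← hxb, ← hud]; ring_nf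
      _ ≤ L := hζre
  have hu2 : |u| ≤ 1 / 2 := by
    by_contra! h
    nlinarith
  have hux : x < d := by
    rw [← hud]
    nlinarith [(abs_le.1 hu2).2]
  have huε : 2 * K * u ^ 2 ≤ ε := by
    rw [div_le_iff₀ hε] at hKε
    have h1 : (K * u ^ 2) * K ≤ L ^ 2 := by
      calc (K * u ^ 2) * K = (|u| * K) ^ 2 := by rw [mul_pow, sq_abs]; ring
        _ ≤ L ^ 2 := by gcongr
    by_contra! h
    nlinarith
  have hn : ‖z₀ * Complex.exp (ζ / b)‖ = ‖z₀‖ * Real.exp x := by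
    rw [norm_mul, Complex.norm_exp, hx]
    congr 2
    exact Complex.div_ofReal_re ζ b
  obtain ⟨z, hz⟩ : ∃ z, z = z₀ * Complex.exp (ζ / b) := ⟨_, rfl⟩
  rw [← hz] at hn ⊢
  have hnlog : Real.log ‖z‖ = Real.log ‖z₀‖ + x := by
    rw [hn, Real.log_mul hn0.ne' (Real.exp_pos _).ne', Real.log_exp]
  have hzD : z ∈ D := by
    have h1 : 0 < ‖z‖ := by rw [hn]; positivity
    refine ⟨?_, by rw [hnlog]; linarith⟩
    by_contra! h
    have := Real.log_neg h1 h
    rw [hnlog] at this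
    linarith [(abs_le.1 hx1).1]
  have hΦz : Φ z ≤ Φ z₀ := hmax hzD
  have h1 : ‖f z‖ * (1 - u) ^ K ≤ ‖f z₀‖ * Real.exp ((A + 1) * x) := by
    have e1 : S - Real.log ‖z‖ = (1 - u) * d := by rw [hnlog, one_sub_mul, hud, hd']; ring
    have e2 : Real.exp ((A + 1) * x) = Real.exp x ^ (A + 1) := by
      rw [← Real.exp_nat_mul]; push_cast; rfl
    simp only [Φ] at hΦz
    rw [e1, hn, mul_pow, mul_pow, ← hd'] at hΦz
    rw [e2]
    have e3 : ‖f z‖ / (‖z₀‖ ^ (A + 1) * Real.exp x ^ (A + 1)) * ((1 - u) ^ K * d ^ K) =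
        (‖f z‖ * (1 - u) ^ K / Real.exp x ^ (A + 1)) * (d ^ K / ‖z₀‖ ^ (A + 1)) := by
      field_simp
    have e4 : ‖f z₀‖ / ‖z₀‖ ^ (A + 1) * d ^ K = ‖f z₀‖ * (d ^ K / ‖z₀‖ ^ (A + 1)) := by
      field_simp
    rw [e3, e4] at hΦz
    exact (div_le_iff₀ (by positivity)).1 (le_of_mul_le_mul_right hΦz (by positivity))
  have h2 : 1 ≤ (1 - u) ^ K * Real.exp (K * (u + 2 * u ^ 2)) := by
    rw [Real.exp_nat_mul, ← mul_pow]
    exact one_le_pow₀ (one_le_one_sub_mul_exp (abs_le.1 hu2).2)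
  calc ‖f z‖ * Real.exp (-x)
      ≤ ‖f z‖ * ((1 - u) ^ K * Real.exp (K * (u + 2 * u ^ 2))) * Real.exp (-x) := by
        gcongr
        exact le_mul_of_one_le_right (norm_nonneg _) h2
    _ = ‖f z‖ * (1 - u) ^ K * (Real.exp (K * (u + 2 * u ^ 2)) * Real.exp (-x)) := by ring
    _ ≤ ‖f z₀‖ * Real.exp ((A + 1) * x) * (Real.exp (K * (u + 2 * u ^ 2)) * Real.exp (-x)) := by
        gcongr
    _ = ‖f z₀‖ * Real.exp ((A + 1) * x + (K * (u + 2 * u ^ 2) + -x)) := by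
        rw [Real.exp_add, Real.exp_add]; ring
    _ ≤ ‖f z₀‖ * Real.exp (ζ.re + ε) := by
        gcongr ‖f z₀‖ * Real.exp ?_
        have : K * u = x * b - A * x := by
          rw [hb, hu]; ring
        rw [hxb] at this
        linarith

theorem exists_inverse_of_norm_deriv_sub_one_le {χ χ' : ℂ → ℂ} {r : ℝ} (hr : 0 < r)
    (h0 : χ 0 = 0) (hχ : ∀ ζ ∈ Metric.ball (0 : ℂ) r, HasDerivAt χ (χ' ζ) ζ)
    (hχ' : ∀ ζ ∈ Metric.ball (0 : ℂ) r, ‖χ' ζ - 1‖ ≤ 1 / 2) :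
    ∃ Ψ : ℂ → ℂ, ∀ w ∈ Metric.ball (0 : ℂ) (r / 4),
      Ψ w ∈ Metric.ball (0 : ℂ) r ∧ χ (Ψ w) = w ∧ HasDerivAt Ψ ((χ' (Ψ w))⁻¹) w := by
  have happ : ApproximatesLinearOn χ ((ContinuousLinearEquiv.refl ℂ ℂ : ℂ ≃L[ℂ] ℂ) : ℂ →L[ℂ] ℂ)
      (Metric.ball 0 r) (1 / 2) := by
    intro x hx y hy
    have := (convex_ball (0 : ℂ) r).norm_image_sub_le_of_norm_hasDerivWithin_le
      (f := fun z => χ z - z) (f' := fun z => χ' z - 1)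
      (fun z hz => ((hχ z hz).sub (hasDerivAt_id z)).hasDerivWithinAt) hχ' hy hx
    simp only [ContinuousLinearEquiv.coe_coe, ContinuousLinearEquiv.coe_refl', id_eq, NNReal.coe_div,
      NNReal.coe_one, NNReal.coe_ofNat]
    convert this using 2
    ring
  have hN : ‖(((ContinuousLinearEquiv.refl ℂ ℂ : ℂ ≃L[ℂ] ℂ).symm : ℂ ≃L[ℂ] ℂ) : ℂ →L[ℂ] ℂ)‖₊
      = 1 := by
    simp
  have hc : Subsingleton ℂ ∨ (1 / 2 : NNReal) <
      ‖(((ContinuousLinearEquiv.refl ℂ ℂ : ℂ ≃L[ℂ] ℂ).symm : ℂ ≃L[ℂ] ℂ) : ℂ →L[ℂ] ℂ)‖₊⁻¹ := by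
    right
    rw [hN, inv_one]
    exact NNReal.half_lt_self one_ne_zero
  let e := happ.toOpenPartialHomeomorph χ (Metric.ball 0 r) hc Metric.isOpen_ball
  have htarget := happ.closedBall_subset_target hc Metric.isOpen_ball (b := 0) (ε := r / 2)
    (by positivity) (Metric.closedBall_subset_ball (by linarith))
  rw [h0, hN] at htarget
  refine ⟨e.symm, fun w hw => ?_⟩
  have hwt : w ∈ e.target := htarget (by
    refine Metric.ball_subset_closedBall (Metric.ball_subset_ball (le_of_eq ?_) hw)
    push_cast
    ring)
  have hs : e.symm w ∈ Metric.ball (0 : ℂ) r := e.map_target hwt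
  refine ⟨hs, e.right_inv hwt, e.hasDerivAt_symm hwt (fun h => ?_) (hχ _ hs)⟩
  have := hχ' _ hs
  rw [h] at this
  norm_num at this

theorem norm_inv_sub_one_le {w : ℂ} {ρ : ℝ} (hρ : ρ < 1) (h : ‖w - 1‖ ≤ ρ) :
    w ≠ 0 ∧ ‖w⁻¹ - 1‖ ≤ ρ / (1 - ρ) := by
  have h1 : 1 - ρ ≤ ‖w‖ := by
    have := norm_sub_norm_le (1 : ℂ) (1 - w)
    rw [sub_sub_cancel, norm_one, norm_sub_rev] at this
    linarith
  have hw : w ≠ 0 := norm_pos_iff.1 (by linarith)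
  refine ⟨hw, ?_⟩
  rw [show w⁻¹ - 1 = (1 - w) / w by rw [sub_div, div_self hw, one_div], norm_div, norm_sub_rev]
  have : 0 < 1 - ρ := by linarith
  exact div_le_div₀ ((norm_nonneg _).trans h) h this h1

theorem exists_primitive_near_id {h : ℂ → ℂ} {r : ℝ} (hr : 1 ≤ r)
    (hh : DifferentiableOn ℂ h (Metric.ball 0 r))
    (hle : ∀ ζ ∈ Metric.ball (0 : ℂ) r, ‖h ζ - 1‖ ≤ 1 / (16 * r * Real.exp (2 * r))) :
    ∃ χ : ℂ → ℂ, χ 0 = 0 ∧ ∀ ζ ∈ Metric.ball (0 : ℂ) r,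
      HasDerivAt χ (Complex.exp (χ ζ - ζ) / h ζ) ζ ∧
        ‖Complex.exp (χ ζ - ζ) / h ζ - 1‖ ≤ 1 / 2 := by
  have hr0 : 0 < r := by linarith
  obtain ⟨μ, hμ⟩ : ∃ μ, μ = 1 / (16 * r * Real.exp (2 * r)) := ⟨_, rfl⟩
  rw [← hμ] at hle
  have hμ0 : 0 < μ := by rw [hμ]; positivity
  have hμr : μ * r * Real.exp (2 * r) = 1 / 16 := by rw [hμ]; field_simp
  have hμ8 : μ ≤ 1 / 8 := by
    have h1 : 1 ≤ r * Real.exp (2 * r) :=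
      one_le_mul_of_one_le_of_one_le hr (Real.one_le_exp (by linarith))
    nlinarith
  have hinv : ∀ ζ ∈ Metric.ball (0 : ℂ) r, h ζ ≠ 0 ∧ ‖(h ζ)⁻¹ - 1‖ ≤ 2 * μ := by
    intro ζ hζ
    obtain ⟨h1, h2⟩ := norm_inv_sub_one_le (by linarith) (hle ζ hζ)
    refine ⟨h1, h2.trans ?_⟩
    rw [div_le_iff₀ (by linarith)]
    nlinarith
  have hd : DifferentiableOn ℂ (fun ζ => Complex.exp (-ζ) * ((h ζ)⁻¹ - 1)) (Metric.ball 0 r) :=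
    (Complex.differentiable_exp.comp differentiable_neg).differentiableOn.mul
      ((hh.inv fun ζ hζ => (hinv ζ hζ).1).sub_const 1)
  obtain ⟨τ, hτ0, hτ⟩ := hd.isExactOn_ball.with_val_at 0 0
  have hexp : ∀ ζ ∈ Metric.ball (0 : ℂ) r,
      ‖Complex.exp ζ‖ ≤ Real.exp r ∧ ‖Complex.exp (-ζ)‖ ≤ Real.exp r := by
    intro ζ hζ
    rw [mem_ball_zero_iff] at hζ
    have := Complex.abs_re_le_norm ζ
    rw [Complex.norm_exp, Complex.norm_exp, Real.exp_le_exp, Real.exp_le_exp, Complex.neg_re]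
    exact ⟨by linarith [(abs_le.1 this).2], by linarith [(abs_le.1 this).1]⟩
  have hτle : ∀ ζ ∈ Metric.ball (0 : ℂ) r, ‖Complex.exp ζ * τ ζ‖ ≤ 1 / 8 := by
    intro ζ hζ
    have h1 := (convex_ball (0 : ℂ) r).norm_image_sub_le_of_norm_hasDerivWithin_le
      (C := Real.exp r * (2 * μ)) (fun z hz => (hτ z hz).hasDerivWithinAt) (fun z hz => by
        rw [norm_mul]
        exact mul_le_mul (hexp z hz).2 (hinv z hz).2 (norm_nonneg _) (Real.exp_pos _).le)
      (Metric.mem_ball_self hr0) hζ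
    rw [hτ0, sub_zero, sub_zero] at h1
    have hζr := (mem_ball_zero_iff.1 hζ).le
    calc ‖Complex.exp ζ * τ ζ‖ = ‖Complex.exp ζ‖ * ‖τ ζ‖ := norm_mul _ _
      _ ≤ Real.exp r * (Real.exp r * (2 * μ) * r) := by
          gcongr
          · exact (hexp ζ hζ).1
          · exact h1.trans (by gcongr)
      _ = 2 * (μ * r * Real.exp (2 * r)) := by rw [two_mul r, Real.exp_add]; ring
      _ = 1 / 8 := by rw [hμr]; norm_num
  have hslit : ∀ ζ ∈ Metric.ball (0 : ℂ) r, 1 - Complex.exp ζ * τ ζ ∈ Complex.slitPlane := by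
    intro ζ hζ
    refine Or.inl ?_
    have := (Complex.abs_re_le_norm (Complex.exp ζ * τ ζ)).trans (hτle ζ hζ)
    rw [Complex.sub_re, Complex.one_re]
    linarith [(abs_le.1 this).2]
  refine ⟨fun ζ => ζ - Complex.log (1 - Complex.exp ζ * τ ζ), by simp [hτ0], fun ζ hζ => ?_⟩
  have hv := hτle ζ hζ
  have hs := hslit ζ hζ
  have hs0 := Complex.slitPlane_ne_zero hs
  obtain ⟨hh0, -⟩ := hinv ζ hζ
  have hval : Complex.exp (ζ - Complex.log (1 - Complex.exp ζ * τ ζ) - ζ) / h ζ =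
      ((1 - Complex.exp ζ * τ ζ) * h ζ)⁻¹ := by
    rw [show ζ - Complex.log (1 - Complex.exp ζ * τ ζ) - ζ =
      -Complex.log (1 - Complex.exp ζ * τ ζ) by ring, Complex.exp_neg, Complex.exp_log hs0,
      mul_inv, div_eq_mul_inv]
  simp only [hval]
  constructor
  · have h1 := (hasDerivAt_id ζ).sub
      ((((Complex.hasDerivAt_exp ζ).mul (hτ ζ hζ)).const_sub 1).clog hs)
    refine h1.congr_deriv ?_
    have h2 : Complex.exp ζ * Complex.exp (-ζ) = 1 := by
      rw [← Complex.exp_add, add_neg_cancel, Complex.exp_zero]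
    simp only [Pi.mul_apply]
    rw [← mul_assoc (Complex.exp ζ), h2]
    field_simp
    ring
  · have h1 : ‖(1 - Complex.exp ζ * τ ζ) * h ζ - 1‖ ≤ 1 / 3 := by
      have h2 : (1 - Complex.exp ζ * τ ζ) * h ζ - 1 =
        (h ζ - 1) - (Complex.exp ζ * τ ζ) * (h ζ - 1) - Complex.exp ζ * τ ζ := by ring
      rw [h2]
      have h3 := hle ζ hζ
      have h4 : ‖(Complex.exp ζ * τ ζ) * (h ζ - 1)‖ ≤ 1 / 8 * (1 / 8) := by
        rw [norm_mul]
        exact mul_le_mul hv (h3.trans hμ8) (norm_nonneg _) (by norm_num)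
      refine (norm_sub_le _ _).trans ?_
      have := norm_sub_le (h ζ - 1) ((Complex.exp ζ * τ ζ) * (h ζ - 1))
      linarith
    refine (norm_inv_sub_one_le (by norm_num) h1).2.trans ?_
    norm_num

theorem TranscendentalEntire.exists_exp_coordinate {f : ℂ → ℂ} (hf : TranscendentalEntire f) {L : ℝ}
    (hL : 0 < L) : ∃ x₀ : ℝ, ∃ P : ℂ → ℂ, InjOn P (Metric.ball (x₀ : ℂ) L) ∧
      ∀ ξ ∈ Metric.ball (x₀ : ℂ) L, HasDerivAt P (f (P ξ) * Complex.exp (-ξ)) ξ := by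
  obtain ⟨r, hr⟩ : ∃ r, r = 4 * (L + 4) := ⟨_, rfl⟩
  have hr1 : 1 ≤ r := by linarith
  have hr0 : 0 < r := by linarith
  obtain ⟨μ, hμ⟩ : ∃ μ, μ = 1 / (16 * r * Real.exp (2 * r)) := ⟨_, rfl⟩
  have hμ0 : 0 < μ := by rw [hμ]; positivity
  obtain ⟨z₀, b, hf₀, hz₀, hb1, hbr, hgrowth⟩ :=
    hf.exists_norm_le_exp (2 * r) (Real.log_pos (show 1 < 1 + μ / 2 by linarith))
  have hb0 : 0 < b := by linarith
  have hbC : (b : ℂ) ≠ 0 := by exact_mod_cast hb0.ne'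
  let h : ℂ → ℂ := fun ζ =>
    f (z₀ * Complex.exp (ζ / b)) * Complex.exp (-(ζ / b)) * Complex.exp (-ζ) / f z₀
  have hhd : Differentiable ℂ h := by
    have h1 : Differentiable ℂ fun ζ : ℂ => f (z₀ * Complex.exp (ζ / b)) :=
      hf.1.comp (by fun_prop)
    have h2 : Differentiable ℂ fun ζ : ℂ => Complex.exp (-(ζ / b)) * Complex.exp (-ζ) := by fun_prop
    have h3 := (h1.mul h2).div_const (f z₀)
    simp only [Pi.mul_apply, ← mul_assoc] at h3
    exact h3
  have hh0 : h 0 = 1 := by simp [h, hf₀]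
  have hhle : ∀ ζ ∈ Metric.ball (0 : ℂ) (2 * r), ‖h ζ‖ ≤ 1 + μ / 2 := by
    intro ζ hζ
    have h1 := hgrowth ζ (mem_ball_zero_iff.1 hζ).le
    have h2 : ‖Complex.exp (-(ζ / b))‖ = Real.exp (-(ζ.re / b)) := by
      rw [Complex.norm_exp, Complex.neg_re, Complex.div_ofReal_re]
    rw [Real.exp_add, Real.exp_log (by linarith)] at h1
    simp only [h, norm_div, norm_mul]
    rw [h2, Complex.norm_exp (-ζ), Complex.neg_re, div_le_iff₀ (norm_pos_iff.2 hf₀)]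
    calc _ ≤ ‖f z₀‖ * (Real.exp ζ.re * (1 + μ / 2)) * Real.exp (-ζ.re) := by gcongr
      _ = (1 + μ / 2) * ‖f z₀‖ * (Real.exp ζ.re * Real.exp (-ζ.re)) := by ring
      _ = (1 + μ / 2) * ‖f z₀‖ := by rw [← Real.exp_add, add_neg_cancel, Real.exp_zero, mul_one]
  have hh1 : ∀ ζ ∈ Metric.ball (0 : ℂ) r, ‖h ζ - 1‖ ≤ 1 / (16 * r * Real.exp (2 * r)) := by
    intro ζ hζ
    have hζr := mem_ball_zero_iff.1 hζ
    have h1 := Complex.borelCaratheodory_zero (f := fun ζ => h ζ - 1) (M := μ / 2) (R := 2 * r)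
      (z := ζ) (by positivity) (hhd.sub_const 1).differentiableOn (fun z hz => by
        have := (Complex.re_le_norm (h z)).trans (hhle z hz)
        simp only [mem_ofPred_eq, Complex.sub_re, Complex.one_re]
        linarith) (by positivity) (Metric.ball_subset_ball (by linarith) hζ) (by simp [hh0])
    rw [← hμ]
    refine h1.trans ?_
    rw [div_le_iff₀ (by linarith)]
    nlinarith
  obtain ⟨χ, hχ0, hχ⟩ := exists_primitive_near_id hr1 hhd.differentiableOn hh1
  obtain ⟨Ψ, hΨ⟩ := exists_inverse_of_norm_deriv_sub_one_le hr0 hχ0 (fun ζ hζ => (hχ ζ hζ).1)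
    (fun ζ hζ => (hχ ζ hζ).2)
  have hc0 : (b : ℂ) * f z₀ / z₀ ≠ 0 := div_ne_zero (mul_ne_zero hbC hf₀) hz₀
  obtain ⟨κ, hκ⟩ : ∃ κ, κ = Complex.log (b * f z₀ / z₀) := ⟨_, rfl⟩
  have hκe : Complex.exp κ = b * f z₀ / z₀ := by rw [hκ, Complex.exp_log hc0]
  have hκim : |κ.im| ≤ Real.pi := by
    rw [hκ, Complex.log_im]
    exact Complex.abs_arg_le_pi _
  have hmem : ∀ ξ ∈ Metric.ball ((κ.re : ℝ) : ℂ) L, ξ - κ ∈ Metric.ball (0 : ℂ) (r / 4) := by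
    intro ξ hξ
    rw [mem_ball_zero_iff, hr]
    rw [mem_ball_iff_norm] at hξ
    have h1 : ξ - κ = (ξ - (κ.re : ℝ)) - κ.im * Complex.I := by
      nth_rewrite 1 [← Complex.re_add_im κ]
      ring
    have h2 : ‖(κ.im : ℂ) * Complex.I‖ ≤ Real.pi := by simpa using hκim
    rw [h1]
    have h3 := norm_sub_le (ξ - (κ.re : ℝ)) (κ.im * Complex.I)
    linarith [Real.pi_lt_four]
  refine ⟨κ.re, fun ξ => z₀ * Complex.exp (Ψ (ξ - κ) / b), fun ξ₁ h₁ ξ₂ h₂ heq => ?_, fun ξ hξ => ?_⟩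
  · obtain ⟨hm₁, hχ₁, -⟩ := hΨ _ (hmem _ h₁)
    obtain ⟨hm₂, hχ₂, -⟩ := hΨ _ (hmem _ h₂)
    have him : ∀ w ∈ Metric.ball (0 : ℂ) r, |(w / b).im| ≤ 1 / 2 := by
      intro w hw
      rw [mem_ball_zero_iff] at hw
      refine (Complex.abs_im_le_norm _).trans ?_
      rw [norm_div, Complex.norm_real, Real.norm_of_nonneg hb0.le, div_le_iff₀ hb0]
      linarith
    have hpi := Real.pi_gt_three
    have e1 := Complex.exp_inj_of_neg_pi_lt_of_le_pi
      (by linarith [(abs_le.1 (him _ hm₁)).1]) (by linarith [(abs_le.1 (him _ hm₁)).2])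
      (by linarith [(abs_le.1 (him _ hm₂)).1]) (by linarith [(abs_le.1 (him _ hm₂)).2])
      (mul_left_cancel₀ hz₀ heq)
    have e2 := (div_left_inj' hbC).1 e1
    rw [e2, hχ₂] at hχ₁
    exact (sub_left_injective hχ₁).symm
  · obtain ⟨hm, hχΨ, hd⟩ := hΨ _ (hmem _ hξ)
    have h1 : HasDerivAt (fun ξ => Ψ (ξ - κ)) _ ξ := hd.comp_sub_const ξ κ
    have h2 := ((h1.div_const (b : ℂ)).cexp).const_mul z₀
    refine h2.congr_deriv ?_
    rw [hχΨ]
    simp only [h, inv_div]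
    rw [show ξ - κ - Ψ (ξ - κ) = ξ + -κ + -Ψ (ξ - κ) by ring, Complex.exp_add, Complex.exp_add,
      Complex.exp_neg κ, hκe, Complex.exp_neg ξ, Complex.exp_neg, Complex.exp_neg]
    have := Complex.exp_ne_zero
    field_simp

/-- In the logarithmic coordinate the punctured annulus around the origin unrolls into solutions
`Z k` (slit along the positive axis) and `W k` (slit along the negative axis) of `ż = f(z)` in
complex time, which agree in the lower half plane but not in the upper half plane. -/
theorem TranscendentalEntire.exists_slit_flows {f : ℂ → ℂ} (hf : TranscendentalEntire f) (n : ℕ) :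
    ∃ X : ℝ, 0 < X ∧ ∃ Z W : Fin n → ℂ → ℂ, ∀ T : ℂ, X / 20 < ‖T‖ → ‖T‖ < 20 * X →
      (-T ∈ Complex.slitPlane → ∀ k, HasDerivAt (Z k) (f (Z k T)) T) ∧
      (T ∈ Complex.slitPlane → ∀ k, HasDerivAt (W k) (f (W k T)) T) ∧
      (T.im < 0 → ∀ k, Z k T = W k T) ∧
      (0 < T.im → ∀ k, Z k T ≠ W k T) ∧
      ∀ T' : ℂ, X / 20 < ‖T'‖ → ‖T'‖ < 20 * X → -T ∈ Complex.slitPlane →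
        -T' ∈ Complex.slitPlane → ∀ j k, Z j T = Z k T' → j = k := by
  have hpi0 := Real.pi_pos
  obtain ⟨x₀, P, hinj, hP⟩ := hf.exists_exp_coordinate
    (L := 3 + 2 * Real.pi * n + 2 * Real.pi) (by positivity)
  obtain ⟨L, hL⟩ : ∃ L, L = 3 + 2 * Real.pi * n + 2 * Real.pi := ⟨_, rfl⟩
  rw [← hL] at hinj hP
  have hmem : ∀ θ : ℝ, -Real.pi ≤ θ → θ ≤ 2 * Real.pi * n → ∀ T : ℂ, Real.exp (-x₀) / 20 < ‖T‖ →
      ‖T‖ < 20 * Real.exp (-x₀) → (θ * Complex.I - Complex.log T : ℂ) ∈ Metric.ball (x₀ : ℂ) L := by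
    intro θ hθ1 hθ2 T hT1 hT2
    have hexp : (20 : ℝ) < Real.exp 3 := by
      have h1 := Real.exp_one_gt_d9
      have h2 : Real.exp 3 = Real.exp 1 ^ 3 := by rw [← Real.exp_nat_mul]; norm_num
      rw [h2]
      calc (20 : ℝ) < 2.718 ^ 3 := by norm_num
        _ ≤ Real.exp 1 ^ 3 := by gcongr; linarith
    have hT0 : 0 < ‖T‖ := lt_trans (by positivity) hT1
    have hlog1 : Real.log ‖T‖ < 3 - x₀ := by
      rw [Real.log_lt_iff_lt_exp hT0, sub_eq_add_neg, Real.exp_add]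
      exact hT2.trans (by gcongr)
    have hlog2 : -3 - x₀ < Real.log ‖T‖ := by
      rw [Real.lt_log_iff_exp_lt hT0, sub_eq_add_neg, Real.exp_add, Real.exp_neg]
      refine lt_trans ?_ hT1
      rw [div_eq_inv_mul]
      gcongr
    rw [mem_ball_iff_norm]
    refine (Complex.norm_le_abs_re_add_abs_im _).trans_lt ?_
    have harg := Complex.abs_arg_le_pi T
    rw [abs_le] at harg
    simp only [Complex.sub_re, Complex.sub_im, Complex.mul_re, Complex.mul_im, Complex.ofReal_re,
      Complex.ofReal_im, Complex.I_re, Complex.I_im, Complex.log_re, Complex.log_im]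
    have h1 : |θ * 0 - 0 * 1 - Real.log ‖T‖ - x₀| < 3 := abs_lt.2 ⟨by linarith, by linarith⟩
    have h2 : |θ * 1 + 0 * 0 - T.arg - 0| ≤ 2 * Real.pi * n + 2 * Real.pi :=
      abs_le.2 ⟨by nlinarith [(n.cast_nonneg : (0 : ℝ) ≤ n)], by linarith⟩
    linarith
  have hθ1 : ∀ k : Fin n, -Real.pi ≤ 2 * Real.pi * k ∧ 2 * Real.pi * k ≤ 2 * Real.pi * n := by
    intro k
    have h1 : (0 : ℝ) ≤ 2 * Real.pi * k := by positivity
    have h2 : ((k : ℕ) : ℝ) ≤ n := by exact_mod_cast k.2.le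
    exact ⟨by linarith, by gcongr⟩
  have hθ2 : ∀ k : Fin n, -Real.pi ≤ 2 * Real.pi * k - Real.pi ∧
      2 * Real.pi * k - Real.pi ≤ 2 * Real.pi * n := fun k =>
    ⟨by have : (0 : ℝ) ≤ 2 * Real.pi * k := by positivity
        linarith, by linarith [(hθ1 k).2]⟩
  have hexpk : ∀ k : Fin n, Complex.exp (((2 * Real.pi * k : ℝ) : ℂ) * Complex.I) = 1 := by
    intro k
    rw [Complex.exp_eq_one_iff]
    exact ⟨k, by push_cast; ring⟩
  refine ⟨Real.exp (-x₀), Real.exp_pos _,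
    fun k T => P ((2 * Real.pi * k : ℝ) * Complex.I - Complex.log (-T)),
    fun k T => P ((2 * Real.pi * k - Real.pi : ℝ) * Complex.I - Complex.log T),
    fun T hT1 hT2 => ?_⟩
  have hT0 : T ≠ 0 := norm_pos_iff.1 (lt_trans (by positivity) hT1)
  refine ⟨fun hs k => ?_, fun hs k => ?_, fun him k => ?_, fun him k heq => ?_,
    fun T' hT1' hT2' hs hs' j k heq => ?_⟩
  · have h1 := hP _ (hmem _ (hθ1 k).1 (hθ1 k).2 (-T) (by rwa [norm_neg]) (by rwa [norm_neg]))
    have h2 := h1.comp T (((hasDerivAt_neg T).clog hs).const_sub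
      (((2 * Real.pi * k : ℝ) : ℂ) * Complex.I))
    refine h2.congr_deriv ?_
    rw [neg_sub, Complex.exp_sub, Complex.exp_log (neg_ne_zero.2 hT0), hexpk]
    field_simp
  · have h1 := hP _ (hmem _ (hθ2 k).1 (hθ2 k).2 T hT1 hT2)
    have h2 := h1.comp T (((hasDerivAt_id T).clog hs).const_sub
      (((2 * Real.pi * k - Real.pi : ℝ) : ℂ) * Complex.I))
    refine h2.congr_deriv ?_
    have h3 : Complex.exp (-(((2 * Real.pi * k - Real.pi : ℝ) : ℂ) * Complex.I - Complex.log T)) =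
        -T := by
      rw [neg_sub, Complex.exp_sub, Complex.exp_log hT0, Complex.ofReal_sub, sub_mul,
        Complex.exp_sub, hexpk, Complex.exp_pi_mul_I]
      rw [one_div, inv_neg, inv_one, div_neg, div_one]
    have h4 : -T * -(1 / id T) = 1 := by
      rw [id_eq]
      field_simp
    rw [h3, mul_assoc, h4, mul_one]
  · have h1 : Complex.log (-T) = Complex.log T + Real.pi * Complex.I := by
      apply Complex.ext <;>
        simp [Complex.log_re, Complex.log_im, Complex.arg_neg_eq_arg_add_pi_of_im_neg him]
    beta_reduce
    rw [h1]
    congr 1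
    push_cast
    ring
  · have h1 := hinj (hmem _ (hθ1 k).1 (hθ1 k).2 (-T) (by rwa [norm_neg]) (by rwa [norm_neg]))
      (hmem _ (hθ2 k).1 (hθ2 k).2 T hT1 hT2) heq
    have h2 := congrArg Complex.im h1
    simp only [Complex.sub_im, Complex.im_ofReal_mul, Complex.I_im, Complex.log_im,
      Complex.arg_neg_eq_arg_sub_pi_of_im_pos him] at h2
    linarith
  · have h1 := hinj (hmem _ (hθ1 j).1 (hθ1 j).2 (-T) (by rwa [norm_neg]) (by rwa [norm_neg]))
      (hmem _ (hθ1 k).1 (hθ1 k).2 (-T') (by rwa [norm_neg]) (by rwa [norm_neg])) heq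
    have h2 := congrArg Complex.im h1
    simp only [Complex.sub_im, Complex.im_ofReal_mul, Complex.I_im, Complex.log_im] at h2
    have h3 := (Complex.arg_le_pi (-T)).lt_of_ne (Complex.slitPlane_arg_ne_pi hs)
    have h4 := (Complex.arg_le_pi (-T')).lt_of_ne (Complex.slitPlane_arg_ne_pi hs')
    have h3' := Complex.neg_pi_lt_arg (-T)
    have h4' := Complex.neg_pi_lt_arg (-T')
    have h5 : ((j : ℕ) : ℝ) < (k : ℕ) + 1 := by
      by_contra! h
      nlinarith
    have h6 : ((k : ℕ) : ℝ) < (j : ℕ) + 1 := by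
      by_contra! h
      nlinarith
    have h7 : (j : ℕ) < k + 1 := by exact_mod_cast h5
    have h8 : (k : ℕ) < j + 1 := by exact_mod_cast h6
    exact Fin.ext (by omega)

theorem hasDerivAt_comp_horizontal {v Z : ℂ → ℂ} {c x s : ℝ}
    (h : HasDerivAt Z (v (Z ((x + c : ℝ) + s * Complex.I))) ((x + c : ℝ) + s * Complex.I)) :
    HasDerivAt (fun t : ℝ => Z ((t + c : ℝ) + s * Complex.I))
      (v (Z ((x + c : ℝ) + s * Complex.I))) x := by
  have h1 : HasDerivAt (fun t : ℝ => ((t + c : ℝ) + s * Complex.I : ℂ)) 1 x := by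
    have := ((hasDerivAt_id x).add_const c).ofReal_comp
    exact this.add_const ((s : ℂ) * Complex.I)
  have h2 := h.comp x h1
  rw [mul_one] at h2
  exact h2

theorem hasDerivAt_comp_vertical {v Z : ℂ → ℂ} {c s : ℝ}
    (h : HasDerivAt Z (v (Z (c + s * Complex.I))) (c + s * Complex.I)) :
    HasDerivAt (fun t : ℝ => Z (c + t * Complex.I))
      (Complex.I * v (Z (c + s * Complex.I))) s := by
  have h1 : HasDerivAt (fun t : ℝ => (c + t * Complex.I : ℂ)) Complex.I s := by
    have := ((hasDerivAt_id s).ofReal_comp.mul_const Complex.I).const_add (c : ℂ)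
    simpa using this
  have h2 := h.comp s h1
  rw [mul_comm] at h2
  exact h2

theorem mem_annulus_of_abs {X x s : ℝ} (h1 : X / 20 < |x| ∨ X / 20 < |s|)
    (h2 : |x| + |s| < 20 * X) :
    X / 20 < ‖(x + s * Complex.I : ℂ)‖ ∧ ‖(x + s * Complex.I : ℂ)‖ < 20 * X := by
  have hre := Complex.abs_re_le_norm (x + s * Complex.I)
  have him := Complex.abs_im_le_norm (x + s * Complex.I)
  have hle := Complex.norm_le_abs_re_add_abs_im (x + s * Complex.I)
  simp only [Complex.add_re, Complex.add_im, Complex.ofReal_re, Complex.ofReal_im, Complex.mul_I_re,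
    Complex.mul_I_im, neg_zero, add_zero, zero_add] at hre him hle
  refine ⟨?_, by linarith⟩
  rcases h1 with h1 | h1 <;> linarith

theorem neg_mem_slitPlane_of {x s : ℝ} (h : x < 0 ∨ s ≠ 0) :
    -(x + s * Complex.I : ℂ) ∈ Complex.slitPlane := by
  rw [Complex.mem_slitPlane_iff]
  simpa using h

theorem le_time_of_slit_flow {f : ℂ → ℂ} {A B : ℂ → EReal} {Y : ℂ → ℝ → ℂ}
    (hm : ∀ p, IsMaximalFrom f p (A p) (B p) (Y p)) {X : ℝ} (hX : 0 < X) {Z : ℂ → ℂ}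
    (hZ : ∀ T, X / 20 < ‖T‖ → ‖T‖ < 20 * X → -T ∈ Complex.slitPlane → HasDerivAt Z (f (Z T)) T)
    {s : ℝ} (hs : |s| < X / 5) {p : ℂ} (hp : p = Z ((-X : ℝ) + s * Complex.I)) :
    ((9 / 10 * X : ℝ) : EReal) ≤ B p ∧ ∀ t : ℝ, -X < t → t < 9 / 10 * X →
      A p < t ∧ t < B p ∧ Y p t = Z ((t + -X : ℝ) + s * Complex.I) := by
  obtain ⟨-, -, -, -, hu⟩ := hm p
  have hw : FlowSol f ((-X : ℝ) : EReal) ((9 / 10 * X : ℝ) : EReal)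
      (fun t => Z ((t + -X : ℝ) + s * Complex.I)) := by
    refine ⟨EReal.coe_lt_coe_iff.2 (by linarith), fun t ht1 ht2 => hasDerivAt_comp_horizontal ?_⟩
    rw [EReal.coe_lt_coe_iff] at ht1 ht2
    have h1 : |t + -X| = X - t := by rw [abs_of_neg (by linarith)]; ring
    obtain ⟨h2, h3⟩ := mem_annulus_of_abs (X := X) (x := t + -X) (s := s)
      (Or.inl (by rw [h1]; linarith)) (by rw [h1]; linarith)
    exact hZ _ h2 h3 (neg_mem_slitPlane_of (Or.inl (by linarith)))
  obtain ⟨h1, h2, h3⟩ := hu _ _ _ hw (by exact_mod_cast neg_lt_zero.2 hX)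
    (by exact_mod_cast (by positivity : 0 < 9 / 10 * X)) (by rw [hp]; simp)
  refine ⟨h2, fun t ht1 ht2 => ?_⟩
  have h4 := EReal.coe_lt_coe_iff.2 ht1
  have h5 := EReal.coe_lt_coe_iff.2 ht2
  exact ⟨h1.trans_lt h4, h5.trans_le h2, (h3 t h4 h5).symm⟩

/-- Some solution starting near `Z (-X)` does not live much longer than time `X`: otherwise the
flow would continue `Z` across the positive axis to the solution `W`. -/
theorem exists_time_le_of_slit_flow {f : ℂ → ℂ} (hf : Differentiable ℂ f) {A B : ℂ → EReal}
    {Y : ℂ → ℝ → ℂ} (hm : ∀ p, IsMaximalFrom f p (A p) (B p) (Y p)) {X : ℝ} (hX : 0 < X)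
    {Z W : ℂ → ℂ}
    (hZ : ∀ T, X / 20 < ‖T‖ → ‖T‖ < 20 * X → -T ∈ Complex.slitPlane → HasDerivAt Z (f (Z T)) T)
    (hW : ∀ T, X / 20 < ‖T‖ → ‖T‖ < 20 * X → T ∈ Complex.slitPlane → HasDerivAt W (f (W T)) T)
    (hlow : ∀ T, X / 20 < ‖T‖ → ‖T‖ < 20 * X → T.im < 0 → Z T = W T)
    (hup : ∀ T, X / 20 < ‖T‖ → ‖T‖ < 20 * X → 0 < T.im → Z T ≠ W T) :
    ∃ s : ℝ, |s| < X / 5 ∧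
      B (Z ((-X : ℝ) + s * Complex.I)) ≤ ((11 / 10 * X : ℝ) : EReal) := by
  by_contra! hcon
  obtain ⟨δ, hδ⟩ : ∃ δ, δ = X / 10 := ⟨_, rfl⟩
  have hIf : Differentiable ℂ (fun z => Complex.I * f z) := hf.const_mul _
  let p : ℝ → ℂ := fun s => Z ((-X : ℝ) + s * Complex.I)
  have habsX : |(-X)| = X := by rw [abs_neg, abs_of_pos hX]
  have hYt : ∀ s, |s| < X / 5 → ∀ t ∈ Icc 0 (11 / 10 * X),
      HasDerivAt (fun t => Y (p s) t) (f (Y (p s) t)) t := by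
    intro s hs t ht
    obtain ⟨hA, -, -, hsol, -⟩ := hm (p s)
    exact hsol.2 t (hA.trans_le (by exact_mod_cast ht.1))
      ((EReal.coe_le_coe_iff.2 ht.2).trans_lt (hcon s hs))
  have hYs : ∀ s, |s| < X / 5 →
      HasDerivAt (fun s => Y (p s) 0) (Complex.I * f (Y (p s) 0)) s := by
    intro s hs
    have hY0 : (fun s => Y (p s) 0) = p := funext fun s => (hm (p s)).2.2.1
    rw [hY0, (hm (p s)).2.2.1]
    obtain ⟨h2, h3⟩ := mem_annulus_of_abs (X := X) (x := -X) (s := s)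
      (Or.inl (by rw [habsX]; linarith)) (by rw [habsX]; linarith)
    exact hasDerivAt_comp_vertical (hZ _ h2 h3 (neg_mem_slitPlane_of (Or.inl (by linarith))))
  have hopen : ∀ s : ℝ, |s| < X / 5 → ∀ᶠ s' in nhds s, |s'| < X / 5 := fun s hs =>
    continuous_abs.continuousAt.eventually_lt continuousAt_const hs
  have he : ∀ s ∈ Ioo (-(X / 5)) (X / 5), HasDerivAt (fun s => Y (p s) (11 / 10 * X))
      (Complex.I * f (Y (p s) (11 / 10 * X))) s := fun s hs =>
    hasDerivAt_transversal hf (Y := fun t s => Y (p s) t) (a := 11 / 10 * X) (by positivity)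
      ((hopen s (abs_lt.2 hs)).mono hYt) ((hopen s (abs_lt.2 hs)).mono hYs)
  have hg : ∀ s ∈ Ioo (-(X / 5)) (X / 5), HasDerivAt (fun s : ℝ => W (δ + s * Complex.I))
      (Complex.I * f (W (δ + s * Complex.I))) s := by
    intro s hs
    have h1 : |δ| = X / 10 := by rw [hδ, abs_of_pos (by positivity)]
    obtain ⟨h2, h3⟩ := mem_annulus_of_abs (X := X) (x := δ) (s := s)
      (Or.inl (by rw [h1]; linarith)) (by rw [h1]; linarith [abs_lt.2 hs])
    refine hasDerivAt_comp_vertical (hW _ h2 h3 (Or.inl ?_))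
    simp only [Complex.add_re, Complex.ofReal_re, Complex.mul_I_re, Complex.ofReal_im, neg_zero,
      add_zero]
    rw [hδ]
    positivity
  have hend : ∀ s, |s| = X / 10 → Y (p s) (11 / 10 * X) = Z (δ + s * Complex.I) := by
    intro s hs
    have hs0 : s ≠ 0 := by
      rintro rfl
      rw [abs_zero] at hs
      linarith
    have h := flow_eqOn hf (ordConnected_Icc (a := (0 : ℝ)) (b := 11 / 10 * X))
      (z := fun t => Y (p s) t) (w := fun t => Z ((t + -X : ℝ) + s * Complex.I))
      (hYt s (by linarith)) (fun t ht => by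
        have h1 : |t + -X| ≤ X := abs_le.2 ⟨by linarith [ht.1], by linarith [ht.2]⟩
        obtain ⟨h2, h3⟩ := mem_annulus_of_abs (X := X) (x := t + -X) (s := s)
          (Or.inr (by linarith)) (by linarith)
        exact hasDerivAt_comp_horizontal (hZ _ h2 h3 (neg_mem_slitPlane_of (Or.inr hs0))))
      (t₀ := 0) ⟨le_rfl, by positivity⟩ (by
        rw [(hm (p s)).2.2.1, zero_add])
      (show 11 / 10 * X ∈ Icc 0 (11 / 10 * X) from ⟨by positivity, le_rfl⟩)
    beta_reduce at h
    rw [h, show 11 / 10 * X + -X = δ by rw [hδ]; ring]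
  have hann : ∀ s, |s| = X / 10 →
      X / 20 < ‖(δ + s * Complex.I : ℂ)‖ ∧ ‖(δ + s * Complex.I : ℂ)‖ < 20 * X := by
    intro s hs
    have h1 : |δ| = X / 10 := by rw [hδ, abs_of_pos (by positivity)]
    exact mem_annulus_of_abs (Or.inr (by linarith)) (by linarith)
  have hd1 : |(-δ)| = X / 10 := by rw [abs_neg, hδ, abs_of_pos (by positivity)]
  have hd2 : |δ| = X / 10 := by rw [hδ, abs_of_pos (by positivity)]
  have key := flow_eqOn hIf ordConnected_Ioo he hg (t₀ := -δ) ⟨by linarith, by linarith⟩ (by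
      rw [hend _ hd1]
      refine hlow _ (hann _ hd1).1 (hann _ hd1).2 ?_
      simp only [Complex.add_im, Complex.ofReal_im, Complex.mul_I_im, Complex.ofReal_re, zero_add]
      linarith)
    (show δ ∈ Ioo (-(X / 5)) (X / 5) from ⟨by linarith, by linarith⟩)
  beta_reduce at key
  rw [hend _ hd2] at key
  refine hup _ (hann _ hd2).1 (hann _ hd2).2 ?_ key
  simp only [Complex.add_im, Complex.ofReal_im, Complex.mul_I_im, Complex.ofReal_re, zero_add]
  linarith

/-- Theorem (Langley, Theorem 1.1 of [Latraj]): if `f` is transcendental entire, the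
holomorphic flow `ż = f(z)` has infinitely many pairwise disjoint trajectories which tend
to infinity in finite increasing time. -/
theorem holomorphic_flow_infinitely_many_escaping_trajectories
    (f : ℂ → ℂ) (hf : TranscendentalEntire f) :
    ∃ (Z : ℕ → ℝ → ℂ) (A B : ℕ → EReal),
      (∀ n, EscapesInFiniteTime f (A n) (B n) (Z n)) ∧
      Pairwise fun m n =>
        Disjoint (Traj (A m) (B m) (Z m)) (Traj (A n) (B n) (Z n)) := by
  choose A B Y hm using exists_maximal_flowSol hf.1
  have hm' : ∀ p, IsMaximalFrom f p (A p) (B p) (Y p) := hm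
  refine exists_disjoint_escaping_of_finite hf.1 hm' fun n => ?_
  obtain ⟨X, hX, Z, W, h⟩ := hf.exists_slit_flows n
  have hesc := fun k => exists_time_le_of_slit_flow hf.1 hm' hX (Z := Z k) (W := W k)
    (fun T h1 h2 h3 => (h T h1 h2).1 h3 k) (fun T h1 h2 h3 => (h T h1 h2).2.1 h3 k)
    (fun T h1 h2 h3 => (h T h1 h2).2.2.1 h3 k) (fun T h1 h2 h3 => (h T h1 h2).2.2.2.1 h3 k)
  choose s hs hB using hesc
  have hlong := fun k => le_time_of_slit_flow hm' hX (Z := Z k)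
    (fun T h1 h2 h3 => (h T h1 h2).1 h3 k) (hs k) rfl
  refine ⟨fun k => Z k ((-X : ℝ) + s k * Complex.I),
    fun k => ((hB k).trans_lt (EReal.coe_lt_top _)).ne, fun i j t hA hBt heq => ?_⟩
  have hshift := ((hm' _).shift hA hBt (by rw [heq]; exact hm' _)).2
  have h1 := (hlong i).1.trans (hshift.le.trans (add_le_add_left (hB j) (t : EReal)))
  have h2 := (add_le_add_left (hlong j).1 (t : EReal)).trans (hshift.ge.trans (hB i))
  rw [← EReal.coe_add, EReal.coe_le_coe_iff] at h1 h2
  obtain ⟨-, -, hval⟩ := (hlong i).2 t (by linarith) (by linarith)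
  have h3 : |t + -X| = X - t := by rw [abs_of_neg (by linarith)]; ring
  have h4 : |(-X)| = X := by rw [abs_neg, abs_of_pos hX]
  obtain ⟨a1, a2⟩ := mem_annulus_of_abs (X := X) (x := t + -X) (s := s i)
    (Or.inl (by rw [h3]; linarith)) (by rw [h3]; linarith [hs i])
  obtain ⟨b1, b2⟩ := mem_annulus_of_abs (X := X) (x := -X) (s := s j)
    (Or.inl (by rw [h4]; linarith)) (by rw [h4]; linarith [hs j])
  exact (h _ a1 a2).2.2.2.2 _ b1 b2 (neg_mem_slitPlane_of (Or.inl (by linarith)))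
    (neg_mem_slitPlane_of (Or.inl (by linarith))) i j (hval.symm.trans heq)
end
end

section
/- Let f be a transcendental entire function, let z₀ ∈ ℂ with f(z₀) ≠ 0, and let F(z) = ∫_{z₀}^{z} du/f(u), defined and univalent on a neighbourhood of z₀. For small δ > 0, let Y_δ be the set of y ∈ (−δ, δ) such that the trajectory of the flow ż = f(z) starting at F⁻¹(iy) tends to infinity in finite increasing time. Then Y_δ has Lebesgue measure 0. -/
open Filter Set

noncomputable section

open Metric MeasureTheory Topology

theorem eqOn_Icc_of_hasDerivAt_smul {f : ℂ → ℂ} (hf : Differentiable ℂ f) (c : ℂ) {u v : ℝ → ℂ}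
    {a b t₀ : ℝ} (hu : ∀ t ∈ Icc a b, HasDerivAt u (c * f (u t)) t)
    (hv : ∀ t ∈ Icc a b, HasDerivAt v (c * f (v t)) t) (ht₀ : t₀ ∈ Icc a b) (h : u t₀ = v t₀) :
    EqOn u v (Icc a b) := by
  have huc : ContinuousOn u (Icc a b) := fun t ht => (hu t ht).continuousAt.continuousWithinAt
  have hvc : ContinuousOn v (Icc a b) := fun t ht => (hv t ht).continuousAt.continuousWithinAt
  obtain ⟨R, hR⟩ := ((isCompact_Icc.image_of_continuousOn huc).union
    (isCompact_Icc.image_of_continuousOn hvc)).isBounded.subset_closedBall 0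
  have hlip : ∃ K, LipschitzOnWith K (fun x => c * f x) (closedBall (0 : ℂ) R) := by
    have hd : Differentiable ℂ (fun x => c * f x) := hf.const_mul c
    have hc : Continuous (deriv (fun x => c * f x)) :=
      (hd.contDiff (n := 1)).continuous_deriv le_rfl
    obtain ⟨K, hK⟩ := (isCompact_closedBall (0 : ℂ) R).exists_bound_of_continuousOn hc.continuousOn
    refine ⟨K.toNNReal, (convex_closedBall _ _).lipschitzOnWith_of_nnnorm_deriv_le
      (fun x _ => hd x) fun x hx => ?_⟩
    rw [← NNReal.coe_le_coe, coe_nnnorm]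
    exact (hK x hx).trans (Real.le_coe_toNNReal K)
  obtain ⟨K, hK⟩ := hlip
  have key : ∀ a' b', Icc a' b' ⊆ Icc a b → (∀ t ∈ Icc a' b', u t ∈ closedBall 0 R) ∧
      (∀ t ∈ Icc a' b', v t ∈ closedBall 0 R) := fun a' b' hs =>
    ⟨fun t ht => hR (Or.inl ⟨t, hs ht, rfl⟩), fun t ht => hR (Or.inr ⟨t, hs ht, rfl⟩)⟩
  have hr : Icc t₀ b ⊆ Icc a b := Icc_subset_Icc_left ht₀.1
  have hl : Icc a t₀ ⊆ Icc a b := Icc_subset_Icc_right ht₀.2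
  have e1 : EqOn u v (Icc t₀ b) := by
    refine ODE_solution_unique_of_mem_Icc_right (v := fun _ x => c * f x)
      (s := fun _ => closedBall 0 R) (K := K) (fun _ _ => hK) (huc.mono hr)
      (fun t ht => (hu t (hr (Ico_subset_Icc_self ht))).hasDerivWithinAt)
      (fun t ht => (key _ _ hr).1 t (Ico_subset_Icc_self ht)) (hvc.mono hr)
      (fun t ht => (hv t (hr (Ico_subset_Icc_self ht))).hasDerivWithinAt)
      (fun t ht => (key _ _ hr).2 t (Ico_subset_Icc_self ht)) h
  have e2 : EqOn u v (Icc a t₀) := by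
    refine ODE_solution_unique_of_mem_Icc_left (v := fun _ x => c * f x)
      (s := fun _ => closedBall 0 R) (K := K) (fun _ _ => hK) (huc.mono hl)
      (fun t ht => (hu t (hl (Ioc_subset_Icc_self ht))).hasDerivWithinAt)
      (fun t ht => (key _ _ hl).1 t (Ioc_subset_Icc_self ht)) (hvc.mono hl)
      (fun t ht => (hv t (hl (Ioc_subset_Icc_self ht))).hasDerivWithinAt)
      (fun t ht => (key _ _ hl).2 t (Ioc_subset_Icc_self ht)) h
  rw [← Icc_union_Icc_eq_Icc ht₀.1 ht₀.2]
  exact e2.union e1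

theorem eqOn_Icc_of_hasDerivAt {f : ℂ → ℂ} (hf : Differentiable ℂ f) {u v : ℝ → ℂ}
    {a b t₀ : ℝ} (hu : ∀ t ∈ Icc a b, HasDerivAt u (f (u t)) t)
    (hv : ∀ t ∈ Icc a b, HasDerivAt v (f (v t)) t) (ht₀ : t₀ ∈ Icc a b) (h : u t₀ = v t₀) :
    EqOn u v (Icc a b) :=
  eqOn_Icc_of_hasDerivAt_smul hf 1 (by simpa using hu) (by simpa using hv) ht₀ h

theorem eqOn_convex_of_hasDerivAt {f : ℂ → ℂ} (hf : Differentiable ℂ f) {g h : ℂ → ℂ}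
    {A : Set ℂ} (hA : Convex ℝ A) (hg : ∀ ζ ∈ A, HasDerivAt g (f (g ζ)) ζ)
    (hh : ∀ ζ ∈ A, HasDerivAt h (f (h ζ)) ζ) {p : ℂ} (hp : p ∈ A) (hgh : g p = h p) :
    EqOn g h A := by
  intro q hq
  have hmem : ∀ t ∈ Icc (0 : ℝ) 1, p + t * (q - p) ∈ A := by
    intro t ht
    have := hA.add_smul_sub_mem hp hq ht
    simpa using this
  have hline : ∀ t : ℝ, HasDerivAt (fun s : ℝ => p + (s : ℂ) * (q - p)) (q - p) t := by
    intro t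
    simpa using (((hasDerivAt_id t).ofReal_comp).mul_const (q - p)).const_add p
  have := eqOn_Icc_of_hasDerivAt_smul hf (q - p) (u := fun t : ℝ => g (p + t * (q - p)))
    (v := fun t : ℝ => h (p + t * (q - p))) (a := 0) (b := 1) (t₀ := 0)
    (fun t ht => by
      rw [mul_comm]; exact (hg _ (hmem t ht)).comp_of_eq t (hline t) rfl)
    (fun t ht => by
      rw [mul_comm]; exact (hh _ (hmem t ht)).comp_of_eq t (hline t) rfl)
    (by simp) (by simpa using hgh)
  simpa using this (right_mem_Icc.2 zero_le_one)

/-- Near a point where `f ≠ 0`, a primitive of `1 / f` has a local inverse, which solves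
`g' = f ∘ g`. -/
theorem exists_local_inverse_of_primitive {f F : ℂ → ℂ} (hf : Differentiable ℂ f) {V : Set ℂ}
    (hV : IsOpen V) {z₀ : ℂ} (hz₀V : z₀ ∈ V) (hz₀ : f z₀ ≠ 0)
    (hF : ∀ z ∈ V, HasDerivAt F (f z)⁻¹ z) :
    ∃ r > 0, ∃ g : ℂ → ℂ, g (F z₀) = z₀ ∧ ∀ ζ ∈ ball (F z₀) r,
      g ζ ∈ V ∧ F (g ζ) = ζ ∧ HasDerivAt g (f (g ζ)) ζ := by
  have hdiff : DifferentiableOn ℂ F V := fun z hz => (hF z hz).differentiableAt.differentiableWithinAt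
  have hstrict : HasStrictDerivAt F (f z₀)⁻¹ z₀ := by
    have h1 := (hdiff.analyticAt (hV.mem_nhds hz₀V)).hasStrictDerivAt
    rwa [(hF z₀ hz₀V).deriv] at h1
  have hs' := hstrict.hasStrictFDerivAt_equiv (inv_ne_zero hz₀)
  set P := hs'.toOpenPartialHomeomorph F with hP
  have hPF : ∀ z, P z = F z := fun z => by rw [hP, hs'.toOpenPartialHomeomorph_coe]
  have hz₀s : z₀ ∈ P.source := hs'.mem_toOpenPartialHomeomorph_source
  have hFt : F z₀ ∈ P.target := hs'.image_mem_toOpenPartialHomeomorph_target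
  have hsymm : P.symm (F z₀) = z₀ := by rw [← hPF, P.left_inv hz₀s]
  have hev : ∀ᶠ ζ in 𝓝 (F z₀), ζ ∈ P.target ∧ P.symm ζ ∈ V ∧ f (P.symm ζ) ≠ 0 := by
    have hc : ContinuousAt P.symm (F z₀) := P.symm.continuousAt hFt
    have ht : ∀ᶠ ζ in 𝓝 (F z₀), ζ ∈ P.target := P.open_target.mem_nhds hFt
    refine ht.and ((hc.eventually_mem ?_).and ?_)
    · rw [hsymm]; exact hV.mem_nhds hz₀V
    · exact (hf.continuous.continuousAt.comp hc).eventually_ne (by simpa [hsymm] using hz₀)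
  obtain ⟨r, hr, hball⟩ := Metric.eventually_nhds_iff_ball.1 hev
  refine ⟨r, hr, P.symm, hsymm, fun ζ hζ => ?_⟩
  obtain ⟨h1, h2, h3⟩ := hball ζ hζ
  refine ⟨h2, by rw [← hPF, P.right_inv h1], ?_⟩
  have h4 : HasDerivAt P (f (P.symm ζ))⁻¹ (P.symm ζ) := by
    have : (P : ℂ → ℂ) = F := funext hPF
    rw [this]; exact hF _ h2
  simpa using P.hasDerivAt_symm h1 (inv_ne_zero h3) h4

theorem exists_local_solution {f : ℂ → ℂ} (hf : Differentiable ℂ f) (ζ₀ z₀ : ℂ) :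
    ∃ r > 0, ∃ g : ℂ → ℂ, g ζ₀ = z₀ ∧ ∀ ζ ∈ ball ζ₀ r, HasDerivAt g (f (g ζ)) ζ := by
  by_cases hz₀ : f z₀ = 0
  · exact ⟨1, one_pos, fun _ => z₀, rfl, fun ζ _ => by simpa [hz₀] using hasDerivAt_const ζ z₀⟩
  obtain ⟨s, hs, hne⟩ := Metric.eventually_nhds_iff_ball.1
    (hf.continuous.continuousAt.eventually_ne hz₀)
  obtain ⟨F, hF⟩ : Complex.IsExactOn (fun z => (f z)⁻¹) (ball z₀ s) :=
    DifferentiableOn.isExactOn_ball (fun z hz => ((hf z).inv (hne z hz)).differentiableWithinAt)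
  obtain ⟨r, hr, g, hg₀, hg⟩ :=
    exists_local_inverse_of_primitive hf isOpen_ball (mem_ball_self hs) hz₀ hF
  refine ⟨r, hr, fun ζ => g (ζ + (F z₀ - ζ₀)), by simp [hg₀], fun ζ hζ => ?_⟩
  have hm : ζ + (F z₀ - ζ₀) ∈ ball (F z₀) r := by
    rw [mem_ball, dist_eq_norm] at hζ ⊢
    convert hζ using 2; ring
  exact (hg _ hm).2.2.comp_add_const ζ _

theorem convex_reProdIm {s t : Set ℝ} (hs : Convex ℝ s) (ht : Convex ℝ t) :
    Convex ℝ (s ×ℂ t) :=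
  (hs.linear_preimage Complex.reLm).inter (ht.linear_preimage Complex.imLm)

theorem hasDerivAt_comp_add_mul_I {f h : ℂ → ℂ} {y t : ℝ}
    (hh : HasDerivAt h (f (h (t + y * Complex.I))) (t + y * Complex.I)) :
    HasDerivAt (fun s : ℝ => h (s + y * Complex.I)) (f (h (t + y * Complex.I))) t := by
  have hline : HasDerivAt (fun s : ℝ => (s : ℂ) + y * Complex.I) 1 t := by
    simpa using ((hasDerivAt_id t).ofReal_comp).add_const (y * Complex.I)
  rw [← mul_one (f _)]
  exact hh.comp_of_eq t hline rfl

/-- A real-time solution on a compact interval extends to a holomorphic solution on a complex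
neighbourhood of that interval. -/
theorem exists_holomorphic_extension {f : ℂ → ℂ} (hf : Differentiable ℂ f) {z : ℝ → ℂ} {T : ℝ}
    (hT : 0 ≤ T) (hz : ∀ t ∈ Icc 0 T, HasDerivAt z (f (z t)) t) (y₀ : ℝ) :
    ∃ ε > 0, ∃ h : ℂ → ℂ, h (y₀ * Complex.I) = z 0 ∧
      ∀ ζ ∈ Ioo (-ε) (T + ε) ×ℂ Ioo (y₀ - ε) (y₀ + ε), HasDerivAt h (f (h ζ)) ζ := by
  let P : ℝ → Prop := fun s => ∃ ε > 0, ∃ h : ℂ → ℂ, h (y₀ * Complex.I) = z 0 ∧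
      ∀ ζ ∈ Ioo (-ε) (s + ε) ×ℂ Ioo (y₀ - ε) (y₀ + ε), HasDerivAt h (f (h ζ)) ζ
  have hloc : ∀ t₁ ∈ Icc 0 T, ∃ r > 0, ∀ s ∈ Icc 0 T, ∀ s' ∈ Icc 0 T, |s - t₁| < r →
      |s' - t₁| < r → P s → P s' := by
    intro t₁ ht₁
    obtain ⟨r, hr, h, h₀, hh⟩ := exists_local_solution hf (t₁ + y₀ * Complex.I) (z t₁)
    have hball : ∀ ζ : ℂ, |ζ.re - t₁| + |ζ.im - y₀| < r → ζ ∈ ball (t₁ + y₀ * Complex.I : ℂ) r := by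
      intro ζ hζ
      rw [mem_ball, dist_eq_norm]
      refine (Complex.norm_le_abs_re_add_abs_im _).trans_lt ?_
      simpa using hζ
    refine ⟨r / 2, by positivity, fun s hs s' hs' hst hst' => ?_⟩
    rintro ⟨ε, hε, h₁, h₁0, hh₁⟩
    have e₁ : h₁ (s + y₀ * Complex.I) = z s := by
      refine eqOn_Icc_of_hasDerivAt hf (u := fun t : ℝ => h₁ (t + y₀ * Complex.I)) (v := z)
        (a := 0) (b := s) (t₀ := 0) (fun t ht => ?_) (fun t ht => hz t ⟨ht.1, ht.2.trans hs.2⟩)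
        ⟨le_rfl, hs.1⟩ (by simpa using h₁0) ⟨hs.1, le_rfl⟩
      refine hasDerivAt_comp_add_mul_I (hh₁ _ ?_)
      simp only [Complex.mem_reProdIm, mem_Ioo]
      simp
      exact ⟨⟨by linarith [ht.1], by linarith [ht.2]⟩, hε⟩
    have e₂ : h (s + y₀ * Complex.I) = z s := by
      have hmin : ∀ t ∈ Icc (min s t₁) (max s t₁), |t - t₁| < r ∧ t ∈ Icc 0 T := by
        intro t ht
        rw [abs_lt] at hst ⊢
        rcases le_total s t₁ with hle | hle <;>
          simp only [hle, min_eq_left, max_eq_right, min_eq_right, max_eq_left, mem_Icc] at ht <;>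
          exact ⟨⟨by linarith [ht.1, ht.2], by linarith [ht.1, ht.2]⟩,
            by linarith [ht.1, ht₁.1, hs.1], by linarith [ht.2, ht₁.2, hs.2]⟩
      refine eqOn_Icc_of_hasDerivAt hf (u := fun t : ℝ => h (t + y₀ * Complex.I)) (v := z)
        (t₀ := t₁) (fun t ht => ?_) (fun t ht => hz t (hmin t ht).2)
        ⟨min_le_right _ _, le_max_right _ _⟩ h₀ ⟨min_le_left _ _, le_max_left _ _⟩
      refine hasDerivAt_comp_add_mul_I (hh _ (hball _ ?_))
      simpa using (hmin t ht).1
    obtain ⟨η, hη, hηε, hηr⟩ : ∃ η > 0, η ≤ ε ∧ η ≤ r / 4 :=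
      ⟨min ε (r / 4), by positivity, min_le_left _ _, min_le_right _ _⟩
    rw [abs_lt] at hst hst'
    have hover : EqOn h₁ h (Ioo (s - η) (s + η) ×ℂ Ioo (y₀ - η) (y₀ + η)) := by
      refine eqOn_convex_of_hasDerivAt hf (convex_reProdIm (convex_Ioo _ _) (convex_Ioo _ _))
        (fun ζ hζ => hh₁ ζ ?_) (fun ζ hζ => hh ζ (hball ζ ?_))
        (p := s + y₀ * Complex.I) ?_ (e₁.trans e₂.symm)
      · simp only [Complex.mem_reProdIm, mem_Ioo] at hζ ⊢
        refine ⟨⟨?_, ?_⟩, ?_, ?_⟩ <;> linarith [hs.1, hζ.1.1, hζ.1.2, hζ.2.1, hζ.2.2]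
      · simp only [Complex.mem_reProdIm, mem_Ioo] at hζ
        have a1 : |ζ.re - t₁| < r / 2 + η := by
          rw [abs_lt]; constructor <;> linarith [hζ.1.1, hζ.1.2]
        have a2 : |ζ.im - y₀| < η := by
          rw [abs_lt]; constructor <;> linarith [hζ.2.1, hζ.2.2]
        linarith
      · simp only [Complex.mem_reProdIm, mem_Ioo]
        simp [hη]
    classical
    refine ⟨η, hη, fun ζ => if ζ.re < s then h₁ ζ else h ζ, ?_, fun ζ hζ => ?_⟩
    · by_cases h0s : 0 < s
      · simpa [h0s] using h₁0
      · obtain rfl : s = 0 := le_antisymm (not_lt.1 h0s) hs.1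
        simpa using e₂
    simp only [Complex.mem_reProdIm, mem_Ioo] at hζ
    obtain ⟨⟨q1, q2⟩, q3, q4⟩ := hζ
    rcases lt_trichotomy ζ.re s with hlt | heq | hgt
    · have hev : (fun ζ => if ζ.re < s then h₁ ζ else h ζ) =ᶠ[𝓝 ζ] h₁ := by
        filter_upwards [(isOpen_lt Complex.continuous_re continuous_const).mem_nhds hlt] with w hw
        exact if_pos hw
      refine HasDerivAt.congr_of_eventuallyEq ?_ hev
      simp only [hlt, if_true]
      refine hh₁ ζ ?_
      simp only [Complex.mem_reProdIm, mem_Ioo]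
      refine ⟨⟨?_, ?_⟩, ?_, ?_⟩ <;> linarith
    · have hev : (fun ζ => if ζ.re < s then h₁ ζ else h ζ) =ᶠ[𝓝 ζ] h := by
        have hm : Ioo (s - η) (s + η) ×ℂ Ioo (y₀ - η) (y₀ + η) ∈ 𝓝 ζ := by
          refine (isOpen_Ioo.reProdIm isOpen_Ioo).mem_nhds ?_
          simp only [Complex.mem_reProdIm, mem_Ioo]
          refine ⟨⟨?_, ?_⟩, ?_, ?_⟩ <;> linarith
        filter_upwards [hm] with w hw
        split_ifs
        · exact hover hw
        · rfl
      refine HasDerivAt.congr_of_eventuallyEq ?_ hev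
      simp only [heq, lt_irrefl, if_false]
      refine hh ζ (hball ζ ?_)
      have a1 : |ζ.re - t₁| < r / 2 := by
        rw [heq, abs_lt]; exact hst
      have a2 : |ζ.im - y₀| < η := by
        rw [abs_lt]; constructor <;> linarith
      linarith
    · have hev : (fun ζ => if ζ.re < s then h₁ ζ else h ζ) =ᶠ[𝓝 ζ] h := by
        filter_upwards [(isOpen_lt continuous_const Complex.continuous_re).mem_nhds hgt] with w hw
        exact if_neg (not_lt.2 (le_of_lt hw))
      refine HasDerivAt.congr_of_eventuallyEq ?_ hev
      simp only [not_lt.2 hgt.le, if_false]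
      refine hh ζ (hball ζ ?_)
      have a1 : |ζ.re - t₁| < r / 2 + η := by
        rw [abs_lt]; constructor <;> linarith
      have a2 : |ζ.im - y₀| < η := by
        rw [abs_lt]; constructor <;> linarith
      linarith
  have hP0 : P 0 := by
    obtain ⟨r, hr, h, h₀, hh⟩ := exists_local_solution hf (y₀ * Complex.I) (z 0)
    refine ⟨r / 2, by positivity, h, h₀, fun ζ hζ => hh ζ ?_⟩
    simp only [Complex.mem_reProdIm, mem_Ioo] at hζ
    rw [mem_ball, dist_eq_norm]
    refine (Complex.norm_le_abs_re_add_abs_im _).trans_lt ?_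
    have a1 : |ζ.re| < r / 2 := by
      rw [abs_lt]; constructor <;> linarith [hζ.1.1, hζ.1.2]
    have a2 : |ζ.im - y₀| < r / 2 := by
      rw [abs_lt]; constructor <;> linarith [hζ.2.1, hζ.2.2]
    simp
    linarith
  refine isPreconnected_Icc.induction₂' (s := Icc 0 T) (fun s s' => P s → P s') (fun t₁ ht₁ => ?_)
    (fun _ _ _ _ _ _ hab hbc => hbc ∘ hab) ⟨le_rfl, hT⟩ ⟨hT, le_rfl⟩ hP0
  obtain ⟨r, hr, hP⟩ := hloc t₁ ht₁
  filter_upwards [self_mem_nhdsWithin, mem_nhdsWithin_of_mem_nhds (ball_mem_nhds t₁ hr)]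
    with s hs hsr
  rw [mem_ball, Real.dist_eq] at hsr
  exact ⟨hP t₁ ht₁ s hs (by simpa using hr) hsr, hP s hs t₁ ht₁ hsr (by simpa using hr)⟩

/-- The norm of the gradient of `z ↦ log (1 + log (1 + ‖z‖ ^ 2))`. -/
def logLogDensity (z : ℂ) : ℝ :=
  2 * ‖z‖ / (1 + ‖z‖ ^ 2) / (1 + Real.log (1 + ‖z‖ ^ 2))

theorem one_add_log_one_add_sq_pos (r : ℝ) : 0 < 1 + Real.log (1 + r ^ 2) := by
  have := Real.log_nonneg (le_add_of_nonneg_right (sq_nonneg r) : (1 : ℝ) ≤ 1 + r ^ 2)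
  linarith

theorem continuous_logLogDensity : Continuous logLogDensity := by
  have h1 : ∀ z : ℂ, 1 + ‖z‖ ^ 2 ≠ 0 := fun z => by positivity
  unfold logLogDensity
  refine Continuous.div (Continuous.div (by fun_prop) (by fun_prop) h1) ?_
    fun z => (one_add_log_one_add_sq_pos _).ne'
  exact continuous_const.add (Continuous.log (by fun_prop) h1)

theorem logLogDensity_nonneg (z : ℂ) : 0 ≤ logLogDensity z := by
  have := one_add_log_one_add_sq_pos ‖z‖
  unfold logLogDensity
  positivity

theorem integrable_logLogDensity_sq : Integrable (fun z : ℂ => logLogDensity z ^ 2) := by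
  have key : IntegrableOn (fun r : ℝ =>
      2 * (2 * r / (1 + r ^ 2) / (1 + Real.log (1 + r ^ 2)) ^ 2)) (Ioi 0) := by
    refine Integrable.const_mul ?_ 2
    have hd : ∀ x : ℝ, HasDerivAt (fun r : ℝ => -(1 + Real.log (1 + r ^ 2))⁻¹)
        (2 * x / (1 + x ^ 2) / (1 + Real.log (1 + x ^ 2)) ^ 2) x := by
      intro x
      have hx : (1 : ℝ) + x ^ 2 ≠ 0 := by positivity
      have h1 : HasDerivAt (fun r : ℝ => 1 + r ^ 2) (2 * x) x := by
        simpa using (hasDerivAt_pow 2 x).const_add 1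
      have h2 := ((h1.log hx).const_add 1).inv (one_add_log_one_add_sq_pos x).ne'
      refine h2.neg.congr_deriv ?_
      ring
    refine integrableOn_Ioi_deriv_of_nonneg (l := -0) (hd 0).continuousAt.continuousWithinAt
      (fun x _ => hd x) (fun x hx => ?_) ?_
    · have := one_add_log_one_add_sq_pos x
      have hx' : (0 : ℝ) < x := hx
      positivity
    · refine (Filter.Tendsto.inv_tendsto_atTop ?_).neg
      refine tendsto_atTop_add_const_left _ _ (Real.tendsto_log_atTop.comp ?_)
      exact tendsto_atTop_add_const_left _ _ (tendsto_pow_atTop two_ne_zero)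
  have hiff := integrable_fun_norm_addHaar (E := ℂ) volume
    (f := fun r : ℝ => (2 * r / (1 + r ^ 2) / (1 + Real.log (1 + r ^ 2))) ^ 2)
  refine hiff.2 ?_
  refine Integrable.mono' key ?_ ?_
  · refine Continuous.aestronglyMeasurable ?_
    have h1 : ∀ r : ℝ, 1 + r ^ 2 ≠ 0 := fun z => by positivity
    refine Continuous.smul (continuous_pow _) (Continuous.pow ?_ 2)
    refine Continuous.div (Continuous.div (by fun_prop) (by fun_prop) h1) ?_
      fun z => (one_add_log_one_add_sq_pos _).ne'
    exact continuous_const.add (Continuous.log (by fun_prop) h1)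
  · filter_upwards [self_mem_ae_restrict measurableSet_Ioi] with r hr
    have hr' : (0 : ℝ) < r := hr
    have hl := one_add_log_one_add_sq_pos r
    rw [Complex.finrank_real_complex, Real.norm_of_nonneg (by positivity)]
    have : r ^ (2 - 1) • (2 * r / (1 + r ^ 2) / (1 + Real.log (1 + r ^ 2))) ^ 2 =
        2 * (2 * r / (1 + r ^ 2) / (1 + Real.log (1 + r ^ 2)) ^ 2) * (r ^ 2 / (1 + r ^ 2)) := by
      simp only [smul_eq_mul]
      field_simp
      norm_num
    rw [this]
    refine mul_le_of_le_one_right (by positivity) ?_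
    rw [div_le_one (by positivity)]
    linarith

/-- Paths tending to infinity have infinite length for the metric of density `logLogDensity`. -/
theorem not_integrableOn_logLogDensity {z z' : ℝ → ℂ} {s c : ℝ} (hsc : s < c)
    (hz : ∀ t ∈ Ioo s c, HasDerivAt z (z' t) t) (hlim : Tendsto z (𝓝[<] c) (Bornology.cobounded ℂ)) :
    ¬ IntegrableOn (fun t => logLogDensity (z t) * ‖z' t‖) (Ioo s c) := by
  have hev : ∀ᶠ t in 𝓝[<] c, t ∈ Ioo s c := Ioo_mem_nhdsLT hsc
  have hd : ∀ t ∈ Ioo s c, HasDerivAt (fun t => Real.log (1 + Real.log (1 + ‖z t‖ ^ 2)))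
      (2 * inner ℝ (z t) (z' t) / (1 + ‖z t‖ ^ 2) / (1 + Real.log (1 + ‖z t‖ ^ 2))) t := by
    intro t ht
    exact ((((hz t ht).norm_sq).const_add 1).log (by positivity)).const_add 1 |>.log
      (one_add_log_one_add_sq_pos _).ne'
  have hinf : Tendsto (fun t => Real.log (1 + Real.log (1 + ‖z t‖ ^ 2))) (𝓝[<] c) atTop := by
    refine Real.tendsto_log_atTop.comp (tendsto_atTop_add_const_left _ _
      (Real.tendsto_log_atTop.comp (tendsto_atTop_add_const_left _ _ ?_)))
    exact (tendsto_pow_atTop two_ne_zero).comp (tendsto_norm_cobounded_atTop.comp hlim)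
  intro hint
  refine not_integrableOn_of_tendsto_norm_atTop_of_deriv_isBigO_filter (𝓝[<] c)
    (Ioo_mem_nhdsLT hsc) (hev.mono fun t ht => (hd t ht).differentiableAt)
    (tendsto_norm_atTop_atTop.comp hinf) (Asymptotics.IsBigO.of_bound 1 ?_) hint
  filter_upwards [hev] with t ht
  have hl := one_add_log_one_add_sq_pos ‖z t‖
  rw [(hd t ht).deriv, one_mul, Real.norm_of_nonneg
    (mul_nonneg (logLogDensity_nonneg _) (norm_nonneg _)), logLogDensity, norm_div, norm_div,
    norm_mul, Real.norm_of_nonneg hl.le, Real.norm_of_nonneg (by positivity : 0 ≤ 1 + ‖z t‖ ^ 2)]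
  have := norm_inner_le_norm (𝕜 := ℝ) (z t) (z' t)
  calc ‖(2 : ℝ)‖ * ‖inner ℝ (z t) (z' t)‖ / (1 + ‖z t‖ ^ 2) / (1 + Real.log (1 + ‖z t‖ ^ 2))
      ≤ 2 * (‖z t‖ * ‖z' t‖) / (1 + ‖z t‖ ^ 2) / (1 + Real.log (1 + ‖z t‖ ^ 2)) := by
        rw [Real.norm_two]; gcongr
    _ = _ := by ring

/-- `z` solves `ż = f(z)` on `[0, T]` with starting value `g (iy)`. -/
def SolvesFrom (f g : ℂ → ℂ) (y T : ℝ) (z : ℝ → ℂ) : Prop :=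
  z 0 = g (y * Complex.I) ∧ ∀ t ∈ Icc 0 T, HasDerivAt z (f (z t)) t

theorem SolvesFrom.mono {f g : ℂ → ℂ} {y T T' : ℝ} {z : ℝ → ℂ} (h : SolvesFrom f g y T z)
    (hT : T' ≤ T) : SolvesFrom f g y T' z :=
  ⟨h.1, fun t ht => h.2 t ⟨ht.1, ht.2.trans hT⟩⟩

theorem SolvesFrom.eqOn {f g : ℂ → ℂ} (hf : Differentiable ℂ f) {y T : ℝ} {z w : ℝ → ℂ}
    (hz : SolvesFrom f g y T z) (hw : SolvesFrom f g y T w) : EqOn z w (Icc 0 T) := by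
  intro t ht
  exact eqOn_Icc_of_hasDerivAt hf hz.2 hw.2 (t₀ := 0) ⟨le_rfl, ht.1.trans ht.2⟩
    (hz.1.trans hw.1.symm) ht

/-- The points `t + iy`, `|y| < δ`, such that the solution starting at `g (iy)` exists up to the
time `t > 0`. -/
def flowDomain (f g : ℂ → ℂ) (δ : ℝ) : Set ℂ :=
  {ζ | |ζ.im| < δ ∧ 0 < ζ.re ∧ ∃ z, SolvesFrom f g ζ.im ζ.re z}

open Classical in
/-- The value at time `Re ζ` of the solution starting at `g (i Im ζ)`. -/
def flowMap (f g : ℂ → ℂ) (ζ : ℂ) : ℂ :=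
  if h : ∃ z, SolvesFrom f g ζ.im ζ.re z then h.choose ζ.re else 0

theorem flowMap_eq {f g : ℂ → ℂ} (hf : Differentiable ℂ f) {ζ : ℂ} (hζ : 0 ≤ ζ.re) {z : ℝ → ℂ}
    (hz : SolvesFrom f g ζ.im ζ.re z) : flowMap f g ζ = z ζ.re := by
  have h : ∃ z, SolvesFrom f g ζ.im ζ.re z := ⟨z, hz⟩
  rw [flowMap, dif_pos h]
  exact h.choose_spec.eqOn hf hz ⟨hζ, le_rfl⟩

theorem mul_I_mem_ball {y r : ℝ} (hy : |y| < r) : (y * Complex.I : ℂ) ∈ ball (0 : ℂ) r := by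
  simpa using hy

theorem exists_local_flowMap {f g : ℂ → ℂ} (hf : Differentiable ℂ f) {r : ℝ}
    (hg : ∀ ζ ∈ ball (0 : ℂ) r, HasDerivAt g (f (g ζ)) ζ) {δ : ℝ} (hδ : δ ≤ r) {ζ₀ : ℂ}
    (hζ₀ : ζ₀ ∈ flowDomain f g δ) :
    ∃ h : ℂ → ℂ, HasDerivAt h (f (h ζ₀)) ζ₀ ∧
      ∀ᶠ ζ in 𝓝 ζ₀, ζ ∈ flowDomain f g δ ∧ flowMap f g ζ = h ζ := by
  obtain ⟨hy₀, ht₀, z, hz⟩ := hζ₀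
  obtain ⟨ε, hε, h, hh0, hh⟩ := exists_holomorphic_extension hf ht₀.le hz.2 ζ₀.im
  have hbox : ζ₀ ∈ Ioo 0 (ζ₀.re + ε) ×ℂ Ioo (ζ₀.im - ε) (ζ₀.im + ε) := by
    simp only [Complex.mem_reProdIm, mem_Ioo]
    refine ⟨⟨?_, ?_⟩, ?_, ?_⟩ <;> linarith
  have hsub : ∀ ζ ∈ Ioo 0 (ζ₀.re + ε) ×ℂ Ioo (ζ₀.im - ε) (ζ₀.im + ε),
      ζ ∈ Ioo (-ε) (ζ₀.re + ε) ×ℂ Ioo (ζ₀.im - ε) (ζ₀.im + ε) := by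
    intro ζ hζ
    simp only [Complex.mem_reProdIm, mem_Ioo] at hζ ⊢
    exact ⟨⟨by linarith [hζ.1.1], hζ.1.2⟩, hζ.2⟩
  have hagree : EqOn h g
      ((Ioo (-ε) (ζ₀.re + ε) ×ℂ Ioo (ζ₀.im - ε) (ζ₀.im + ε)) ∩ ball (0 : ℂ) r) := by
    refine eqOn_convex_of_hasDerivAt hf
      ((convex_reProdIm (convex_Ioo _ _) (convex_Ioo _ _)).inter (convex_ball _ _))
      (fun ζ hζ => hh ζ hζ.1) (fun ζ hζ => hg ζ hζ.2) (p := ζ₀.im * Complex.I)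
      ⟨?_, mul_I_mem_ball (hy₀.trans_le hδ)⟩ (hh0.trans hz.1)
    simp only [Complex.mem_reProdIm, mem_Ioo]
    simp [hε]
    linarith
  refine ⟨h, hh ζ₀ (hsub _ hbox), ?_⟩
  filter_upwards [(isOpen_Ioo.reProdIm isOpen_Ioo).mem_nhds hbox,
    (isOpen_lt Complex.continuous_im.abs continuous_const).mem_nhds hy₀] with ζ hζ hζδ
  have hm : ∀ t ∈ Icc 0 ζ.re, (t + ζ.im * Complex.I : ℂ) ∈
      Ioo (-ε) (ζ₀.re + ε) ×ℂ Ioo (ζ₀.im - ε) (ζ₀.im + ε) := by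
    intro t ht
    simp only [Complex.mem_reProdIm, mem_Ioo] at hζ ⊢
    simp
    refine ⟨⟨?_, ?_⟩, ?_, ?_⟩ <;> linarith [ht.1, ht.2, hζ.1.2, hζ.2.1, hζ.2.2]
  have hpos : 0 < ζ.re := hζ.1.1
  have hsol : SolvesFrom f g ζ.im ζ.re (fun t => h (t + ζ.im * Complex.I)) := by
    refine ⟨?_, fun t ht => hasDerivAt_comp_add_mul_I (hh _ (hm t ht))⟩
    have h0 := hm 0 ⟨le_rfl, hpos.le⟩
    simp only [Complex.ofReal_zero, zero_add] at h0 ⊢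
    exact hagree ⟨h0, mul_I_mem_ball (lt_of_lt_of_le hζδ hδ)⟩
  refine ⟨⟨hζδ, hpos, _, hsol⟩, ?_⟩
  rw [flowMap_eq hf hpos.le hsol, Complex.re_add_im]

theorem isOpen_flowDomain {f g : ℂ → ℂ} (hf : Differentiable ℂ f) {r : ℝ}
    (hg : ∀ ζ ∈ ball (0 : ℂ) r, HasDerivAt g (f (g ζ)) ζ) {δ : ℝ} (hδ : δ ≤ r) :
    IsOpen (flowDomain f g δ) := by
  refine isOpen_iff_mem_nhds.2 fun ζ₀ hζ₀ => ?_
  obtain ⟨h, -, hev⟩ := exists_local_flowMap hf hg hδ hζ₀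
  exact hev.mono fun ζ hζ => hζ.1

theorem hasDerivAt_flowMap {f g : ℂ → ℂ} (hf : Differentiable ℂ f) {r : ℝ}
    (hg : ∀ ζ ∈ ball (0 : ℂ) r, HasDerivAt g (f (g ζ)) ζ) {δ : ℝ} (hδ : δ ≤ r) {ζ₀ : ℂ}
    (hζ₀ : ζ₀ ∈ flowDomain f g δ) :
    HasDerivAt (flowMap f g) (f (flowMap f g ζ₀)) ζ₀ := by
  obtain ⟨h, hh, hev⟩ := exists_local_flowMap hf hg hδ hζ₀
  rw [hev.self_of_nhds.2]
  exact hh.congr_of_eventuallyEq (hev.mono fun ζ hζ => hζ.2)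

/-- The part of `flowDomain f g δ` over the time interval `(a, a + δ)`. -/
def flowStrip (f g : ℂ → ℂ) (δ a : ℝ) : Set ℂ :=
  flowDomain f g δ ∩ Complex.re ⁻¹' Ioo a (a + δ)

theorem injOn_flowMap {f g : ℂ → ℂ} (hf : Differentiable ℂ f) {δ : ℝ}
    (hg : ∀ ζ ∈ ball (0 : ℂ) (2 * δ), HasDerivAt g (f (g ζ)) ζ)
    (hinj : InjOn g (ball (0 : ℂ) (2 * δ))) (a : ℝ) :
    InjOn (flowMap f g) (flowStrip f g δ a) := by
  have key : ∀ ζ₁ ∈ flowStrip f g δ a, ∀ ζ₂ ∈ flowStrip f g δ a, ζ₁.re ≤ ζ₂.re →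
      flowMap f g ζ₁ = flowMap f g ζ₂ → ζ₁ = ζ₂ := by
    rintro ζ₁ ⟨⟨hy₁, ht₁, z₁, hz₁⟩, ha₁⟩ ζ₂ ⟨⟨hy₂, ht₂, z₂, hz₂⟩, ha₂⟩ hle heq
    rw [flowMap_eq hf ht₁.le hz₁, flowMap_eq hf ht₂.le hz₂] at heq
    have hτ0 : 0 ≤ ζ₂.re - ζ₁.re := sub_nonneg.2 hle
    have hτ : ζ₂.re - ζ₁.re < δ := by linarith [ha₁.1, ha₂.2]
    have hback : z₁ 0 = z₂ (0 + (ζ₂.re - ζ₁.re)) := by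
      refine eqOn_Icc_of_hasDerivAt hf (u := z₁) (v := fun t => z₂ (t + (ζ₂.re - ζ₁.re)))
        (a := 0) (b := ζ₁.re) (t₀ := ζ₁.re) hz₁.2 (fun t ht => ?_) ⟨ht₁.le, le_rfl⟩
        (by simpa using heq) ⟨le_rfl, ht₁.le⟩
      exact (hz₂.2 _ ⟨by linarith [ht.1], by linarith [ht.2]⟩).comp_add_const t _
    have hmem : ∀ t ∈ Icc 0 (ζ₂.re - ζ₁.re),
        (t + ζ₂.im * Complex.I : ℂ) ∈ ball (0 : ℂ) (2 * δ) := by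
      intro t ht
      rw [mem_ball_zero_iff]
      refine (Complex.norm_le_abs_re_add_abs_im _).trans_lt ?_
      simp [abs_of_nonneg ht.1]
      linarith [ht.2]
    have hfwd : z₂ (ζ₂.re - ζ₁.re) = g ((ζ₂.re - ζ₁.re : ℝ) + ζ₂.im * Complex.I) := by
      refine (hz₂.mono (T' := ζ₂.re - ζ₁.re) (by linarith)).eqOn hf
        (w := fun t : ℝ => g (t + ζ₂.im * Complex.I))
        ⟨by simp, fun t ht => hasDerivAt_comp_add_mul_I (hg _ (hmem t ht))⟩ ⟨hτ0, le_rfl⟩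
    rw [zero_add, hfwd, hz₁.1] at hback
    have := hinj (mul_I_mem_ball (by linarith [abs_nonneg ζ₁.im])) (hmem _ ⟨hτ0, le_rfl⟩) hback
    have hre := congrArg Complex.re this
    have him := congrArg Complex.im this
    simp at hre him
    exact Complex.ext (by linarith) him
  intro ζ₁ h₁ ζ₂ h₂ heq
  rcases le_total ζ₁.re ζ₂.re with hle | hle
  · exact key ζ₁ h₁ ζ₂ h₂ hle heq
  · exact (key ζ₂ h₂ ζ₁ h₁ hle heq.symm).symm

theorem ae_integrable_flowStrip {f g : ℂ → ℂ} (hf : Differentiable ℂ f) {δ : ℝ} (hδ : 0 < δ)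
    (hg : ∀ ζ ∈ ball (0 : ℂ) (2 * δ), HasDerivAt g (f (g ζ)) ζ)
    (hinj : InjOn g (ball (0 : ℂ) (2 * δ))) (a : ℝ) :
    ∀ᵐ y : ℝ, Integrable fun t : ℝ => (flowStrip f g δ a).indicator
      (fun ζ => logLogDensity (flowMap f g ζ) * ‖f (flowMap f g ζ)‖) (⟨t, y⟩ : ℂ) := by
  have hr : δ ≤ 2 * δ := by linarith
  have hS : IsOpen (flowStrip f g δ a) :=
    (isOpen_flowDomain hf hg hr).inter (isOpen_Ioo.preimage Complex.continuous_re)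
  have hderiv : ∀ ζ ∈ flowStrip f g δ a, HasDerivAt (flowMap f g) (f (flowMap f g ζ)) ζ :=
    fun ζ hζ => hasDerivAt_flowMap hf hg hr hζ.1
  have hcont : ContinuousOn (flowMap f g) (flowStrip f g δ a) :=
    fun ζ hζ => (hderiv ζ hζ).continuousAt.continuousWithinAt
  have hvol : volume (flowStrip f g δ a) ≠ ⊤ := by
    have hb : Bornology.IsBounded (flowStrip f g δ a) := by
      refine ((isBounded_Icc a (a + δ)).reProdIm (isBounded_Icc (-δ) δ)).subset fun ζ hζ => ?_
      obtain ⟨⟨h1, -, -⟩, h2⟩ := hζ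
      exact ⟨⟨h2.1.le, h2.2.le⟩, abs_le.1 h1.le⟩
    exact hb.measure_lt_top.ne
  have hsq : IntegrableOn
      (fun ζ => ‖f (flowMap f g ζ)‖ ^ 2 * logLogDensity (flowMap f g ζ) ^ 2)
      (flowStrip f g δ a) := by
    have := (integrableOn_image_iff_integrableOn_abs_det_fderiv_smul volume hS.measurableSet
      (fun ζ hζ => ((hderiv ζ hζ).hasFDerivAt.restrictScalars ℝ).hasFDerivWithinAt)
      (injOn_flowMap hf hg hinj a) (fun w => logLogDensity w ^ 2)).1
      integrable_logLogDensity_sq.integrableOn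
    refine this.congr_fun (fun ζ _ => ?_) hS.measurableSet
    simp [ContinuousLinearMap.det, LinearMap.det_restrictScalars, Algebra.norm_complex_apply,
      Complex.normSq_eq_norm_sq]
  have hint : IntegrableOn (fun ζ => logLogDensity (flowMap f g ζ) * ‖f (flowMap f g ζ)‖)
      (flowStrip f g δ a) := by
    refine Integrable.mono' ((integrableOn_const hvol (C := (1 : ℝ))).add hsq) ?_
      (Eventually.of_forall fun ζ => ?_)
    · refine ContinuousOn.aestronglyMeasurable ?_ hS.measurableSet
      exact (continuous_logLogDensity.comp_continuousOn hcont).mul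
        (hf.continuous.comp_continuousOn hcont).norm
    · have h1 := logLogDensity_nonneg (flowMap f g ζ)
      rw [Real.norm_of_nonneg (by positivity)]
      simp only [Pi.add_apply]
      nlinarith [sq_nonneg (logLogDensity (flowMap f g ζ) * ‖f (flowMap f g ζ)‖ - 1)]
  have hprod := (Complex.volume_preserving_equiv_real_prod.symm).integrable_comp_emb
    Complex.measurableEquivRealProd.symm.measurableEmbedding |>.2
    ((integrable_indicator_iff hS.measurableSet).2 hint)
  exact hprod.prod_left_ae

/-- Theorem 1.2 (Langley): with `F(z) = ∫_{z₀}^z du/f(u)` univalent near `z₀`, the set of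
`y ∈ (-δ, δ)` for which the trajectory of `ż = f(z)` starting at `F⁻¹(iy)` tends to
infinity in finite increasing time has Lebesgue measure zero. -/
theorem measure_zero_of_escaping_starting_values
    (f : ℂ → ℂ) (hf : TranscendentalEntire f) (z₀ : ℂ) (hz₀ : f z₀ ≠ 0)
    (F : ℂ → ℂ) (V : Set ℂ) (hV : IsOpen V) (hz₀V : z₀ ∈ V)
    (hF0 : F z₀ = 0) (hFderiv : ∀ z ∈ V, HasDerivAt F (f z)⁻¹ z)
    (hFinj : Set.InjOn F V) :
    ∃ δ₀ > (0 : ℝ), (∀ y : ℝ, |y| < δ₀ → ∃ w ∈ V, F w = Complex.I * y) ∧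
      ∀ δ : ℝ, 0 < δ → δ < δ₀ →
        MeasureTheory.volume
          {y : ℝ | y ∈ Set.Ioo (-δ) δ ∧ ∃ w ∈ V, F w = Complex.I * y ∧
            ∃ (a b : EReal) (z : ℝ → ℂ), a < (0 : EReal) ∧ (0 : EReal) < b ∧ z 0 = w ∧
              EscapesInFiniteTime f a b z} = 0 := by
  obtain ⟨r, hr, g, hg₀, hg⟩ := exists_local_inverse_of_primitive hf.1 hV hz₀V hz₀ hFderiv
  rw [hF0] at hg₀ hg
  obtain ⟨d, rfl⟩ : ∃ d, r = 2 * d := ⟨r / 2, by ring⟩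
  have hd : 0 < d := by linarith
  have hgd : ∀ ζ ∈ ball (0 : ℂ) (2 * d), HasDerivAt g (f (g ζ)) ζ := fun ζ hζ => (hg ζ hζ).2.2
  have hinj : InjOn g (ball (0 : ℂ) (2 * d)) := fun ζ hζ ξ hξ h => by
    rw [← (hg ζ hζ).2.1, ← (hg ξ hξ).2.1, h]
  have hball : ∀ y : ℝ, |y| < d → Complex.I * y ∈ ball (0 : ℂ) (2 * d) := fun y hy => by
    rw [mul_comm Complex.I]; exact mul_I_mem_ball (hy.trans (lt_two_mul_self hd))
  refine ⟨d, hd, fun y hy => ⟨_, (hg _ (hball y hy)).1, (hg _ (hball y hy)).2.1⟩,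
    fun δ hδ hδd => ?_⟩
  have hae : ∀ᵐ y : ℝ, ∀ k : ℕ, Integrable fun t : ℝ => (flowStrip f g d (k * d)).indicator
      (fun ζ => logLogDensity (flowMap f g ζ) * ‖f (flowMap f g ζ)‖) (⟨t, y⟩ : ℂ) :=
    ae_all_iff.2 fun k => ae_integrable_flowStrip hf.1 hd hgd hinj _
  refine measure_mono_null ?_ (ae_iff.1 hae)
  rintro y ⟨hy, w, hwV, hFw, a, b, z, ha, hb, hz0, ⟨⟨-, hflow⟩, -⟩, c, rfl, hlim⟩ hall
  have hyd : |y| < d := (abs_lt.2 hy).trans hδd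
  have hw : w = g (y * Complex.I) := by
    rw [mul_comm]
    exact hFinj hwV (hg _ (hball y hyd)).1 (hFw.trans (hg _ (hball y hyd)).2.1.symm)
  have hc : 0 < c := by exact_mod_cast hb
  have hzd : ∀ t, 0 ≤ t → t < c → HasDerivAt z (f (z t)) t := fun t h0 htc =>
    hflow t (ha.trans_le (by exact_mod_cast h0)) (by exact_mod_cast htc)
  have hsol : ∀ t < c, SolvesFrom f g y t z := fun t htc =>
    ⟨hz0.trans hw, fun s hs => hzd s hs.1 (hs.2.trans_lt htc)⟩
  obtain ⟨k, hk⟩ : ∃ k : ℕ, k * d < c ∧ c ≤ k * d + d := by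
    obtain ⟨k, hk⟩ := Nat.exists_eq_succ_of_ne_zero (Nat.ceil_pos.2 (div_pos hc hd)).ne'
    refine ⟨k, (lt_div_iff₀ hd).1 (Nat.lt_ceil.1 (hk ▸ k.lt_succ_self)), ?_⟩
    have h := (div_le_iff₀ hd).1 (Nat.ceil_le.1 hk.le)
    push_cast at h
    linarith
  have hk0 : 0 ≤ k * d := by positivity
  refine not_integrableOn_logLogDensity hk.1 (fun t ht => hzd t (hk0.trans ht.1.le) ht.2) hlim ?_
  refine ((hall k).integrableOn (s := Ioo (k * d) c)).congr_fun (fun t ht => ?_) measurableSet_Ioo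
  have hpos : 0 < t := hk0.trans_lt ht.1
  have hmem : (⟨t, y⟩ : ℂ) ∈ flowStrip f g d (k * d) :=
    ⟨⟨hyd, hpos, z, hsol t ht.2⟩, ht.1, ht.2.trans_le hk.2⟩
  have hval : flowMap f g ⟨t, y⟩ = z t := flowMap_eq hf.1 hpos.le (hsol t ht.2)
  simp only [indicator_of_mem hmem, hval]
end
end

section
/- There exists a transcendental entire function g such that the antiholomorphic flow ż = conj(g(z)) has no trajectories tending to infinity in finite increasing time. -/
open Filter Set

noncomputable section

/-- A planar curve `u + iv` whose argument varies slowly compared with `u` stays in the sector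
`|v| ≤ u`. -/
theorem sector_trap {u v u' v' : ℝ → ℝ} {s t : ℝ}
    (hu : ∀ τ ∈ Icc s t, HasDerivAt u (u' τ) τ) (hv : ∀ τ ∈ Icc s t, HasDerivAt v (v' τ) τ)
    (hu₀ : 9 / 10 ≤ u s) (hv₀ : |v s| ≤ 1 / 10)
    (hrot : ∀ τ ∈ Ioo s t, 1 / 2 ≤ u τ → |v τ| ≤ u τ →
      0 ≤ u' τ ∧ |u τ * v' τ - v τ * u' τ| ≤ 1 / 10 * u' τ) :
    ∀ τ ∈ Icc s t, 1 / 2 < u τ ∧ |v τ| < u τ := by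
  by_contra! hbad
  obtain ⟨τ₀, hτ₀, hbad₀⟩ := hbad
  have huc : ContinuousOn u (Icc s t) := fun τ hτ => (hu τ hτ).continuousAt.continuousWithinAt
  have hvc : ContinuousOn v (Icc s t) := fun τ hτ => (hv τ hτ).continuousAt.continuousWithinAt
  have hclosed : IsClosed {τ ∈ Icc s t | min (u τ - 1 / 2) (u τ - |v τ|) ≤ 0} :=
    ContinuousOn.preimage_isClosed_of_isClosed (t := Iic 0)
      (by fun_prop : ContinuousOn (fun τ => min (u τ - 1 / 2) (u τ - |v τ|)) (Icc s t))
      isClosed_Icc isClosed_Iic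
  have hcomp : IsCompact {τ ∈ Icc s t | min (u τ - 1 / 2) (u τ - |v τ|) ≤ 0} :=
    isCompact_Icc.of_isClosed_subset hclosed fun τ hτ => hτ.1
  have hne : {τ ∈ Icc s t | min (u τ - 1 / 2) (u τ - |v τ|) ≤ 0}.Nonempty := by
    refine ⟨τ₀, hτ₀, ?_⟩
    rw [min_le_iff]
    by_cases h : 1 / 2 < u τ₀
    · right; linarith [hbad₀ h]
    · left; linarith
  obtain ⟨e, ⟨he, hemin⟩, hleast⟩ := hcomp.exists_isLeast hne
  have hgood : ∀ τ ∈ Ioo s e, 1 / 2 ≤ u τ ∧ |v τ| ≤ u τ := by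
    intro τ hτ
    have : ¬ min (u τ - 1 / 2) (u τ - |v τ|) ≤ 0 := fun h =>
      absurd (hleast ⟨⟨hτ.1.le, hτ.2.le.trans he.2⟩, h⟩) (not_le.2 hτ.2)
    rw [min_le_iff] at this
    push Not at this
    constructor <;> linarith [this.1, this.2]
  have hsub : Icc s e ⊆ Icc s t := Icc_subset_Icc_right he.2
  have hder : ∀ τ ∈ Ioo s e, 0 ≤ u' τ ∧ |u τ * v' τ - v τ * u' τ| ≤ 1 / 10 * u' τ :=
    fun τ hτ => hrot τ ⟨hτ.1, hτ.2.trans_le he.2⟩ (hgood τ hτ).1 (hgood τ hτ).2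
  have hmono : MonotoneOn u (Icc s e) := by
    refine monotoneOn_of_deriv_nonneg (convex_Icc s e) (huc.mono hsub) ?_ ?_ <;>
      rw [interior_Icc] <;> intro τ hτ
    · exact (hu τ (hsub (Ioo_subset_Icc_self hτ))).differentiableAt.differentiableWithinAt
    · rw [(hu τ (hsub (Ioo_subset_Icc_self hτ))).deriv]
      exact (hder τ hτ).1
  have hlow : ∀ τ ∈ Icc s e, 9 / 10 ≤ u τ := fun τ hτ =>
    hu₀.trans (hmono (left_mem_Icc.2 he.1) hτ hτ.1)
  have hanti : ∀ σ : ℝ, |σ| ≤ 1 → (σ * v e + 1 / 10) / u e ≤ (σ * v s + 1 / 10) / u s := by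
    intro σ hσ
    have hd : ∀ τ ∈ Icc s e, HasDerivAt (fun τ => (σ * v τ + 1 / 10) / u τ)
        ((σ * v' τ * u τ - (σ * v τ + 1 / 10) * u' τ) / u τ ^ 2) τ := fun τ hτ =>
      (((hv τ (hsub hτ)).const_mul σ).add_const _).div (hu τ (hsub hτ))
        (by linarith [hlow τ hτ] : (0 : ℝ) < u τ).ne'
    refine antitoneOn_of_deriv_nonpos (convex_Icc s e)
      (fun τ hτ => (hd τ hτ).continuousAt.continuousWithinAt) ?_ ?_
      (left_mem_Icc.2 he.1) (right_mem_Icc.2 he.1) he.1 <;>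
      rw [interior_Icc] <;> intro τ hτ
    · exact (hd τ (Ioo_subset_Icc_self hτ)).differentiableAt.differentiableWithinAt
    · rw [(hd τ (Ioo_subset_Icc_self hτ)).deriv]
      refine div_nonpos_of_nonpos_of_nonneg ?_ (sq_nonneg _)
      have h1 : σ * (u τ * v' τ - v τ * u' τ) ≤ 1 / 10 * u' τ := by
        refine (le_abs_self _).trans ?_
        rw [abs_mul]
        exact (mul_le_of_le_one_left (abs_nonneg _) hσ).trans (hder τ hτ).2
      linarith
  have hs := hlow s (left_mem_Icc.2 he.1)
  have hee := hlow e (right_mem_Icc.2 he.1)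
  have hb : ∀ σ : ℝ, |σ| ≤ 1 → σ * v e ≤ u e / 2 := by
    intro σ hσ
    have h1 : (σ * v s + 1 / 10) / u s ≤ 1 / 2 := by
      rw [div_le_iff₀ (by linarith)]
      have : σ * v s ≤ 1 / 10 := by
        refine (le_abs_self _).trans ?_
        rw [abs_mul]
        exact (mul_le_of_le_one_left (abs_nonneg _) hσ).trans hv₀
      linarith
    have h2 := (hanti σ hσ).trans h1
    rw [div_le_iff₀ (by linarith)] at h2
    linarith
  have h3 : |v e| ≤ u e / 2 :=
    abs_le'.2 ⟨by linarith [hb 1 (by simp)], by linarith [hb (-1) (by simp)]⟩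
  rw [min_le_iff] at hemin
  rcases hemin with h | h <;> linarith

/-- Polynomials approximate `1 / W` on a truncated sector in the right half plane. -/
theorem exists_polynomial_approx_inv {L ε : ℝ} (hL : 1 ≤ L) (hε : 0 < ε) :
    ∃ k : Polynomial ℂ, ∀ W : ℂ, 1 / 2 ≤ W.re → |W.im| ≤ W.re → ‖W‖ ≤ L →
      ‖1 - W * k.eval W‖ ≤ ε := by
  set c : ℝ := 2 * L with hc
  have hc0 : 0 < c := by linarith
  obtain ⟨n, hn⟩ := exists_pow_lt_of_lt_one (pow_pos hε 2)
    (show 1 - 1 / (2 * c) < 1 by have : 0 < 1 / (2 * c) := by positivity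
                                 linarith)
  refine ⟨Polynomial.C (1 / (c : ℂ)) *
    ∑ j ∈ Finset.range n, (1 - Polynomial.C (1 / (c : ℂ)) * Polynomial.X) ^ j,
    fun W hre him hWL => ?_⟩
  have hcC : (c : ℂ) ≠ 0 := by exact_mod_cast hc0.ne'
  have hgeom : 1 - W * (1 / (c : ℂ) * ∑ j ∈ Finset.range n, (1 - 1 / (c : ℂ) * W) ^ j)
      = (1 - 1 / (c : ℂ) * W) ^ n := by
    have := mul_neg_geom_sum (1 - 1 / (c : ℂ) * W) n
    linear_combination -this
  have heval : (Polynomial.C (1 / (c : ℂ)) *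
      ∑ j ∈ Finset.range n, (1 - Polynomial.C (1 / (c : ℂ)) * Polynomial.X) ^ j).eval W
      = 1 / (c : ℂ) * ∑ j ∈ Finset.range n, (1 - 1 / (c : ℂ) * W) ^ j := by
    simp [Polynomial.eval_finsetSum]
  rw [heval, hgeom]
  have hreL : W.re ≤ L := (Complex.re_le_norm W).trans hWL
  have hsq : ‖1 - 1 / (c : ℂ) * W‖ ^ 2 ≤ 1 - 1 / (2 * c) := by
    have h1 : 1 / (c : ℂ) * W = ((1 / c : ℝ) : ℂ) * W := by push_cast; rfl
    rw [Complex.sq_norm, Complex.normSq_apply, h1]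
    simp only [Complex.sub_re, Complex.sub_im, Complex.one_re, Complex.one_im,
      Complex.re_ofReal_mul, Complex.im_ofReal_mul]
    have h2 : W.im ^ 2 ≤ W.re ^ 2 :=
      sq_le_sq' (by linarith [neg_abs_le W.im]) (by linarith [le_abs_self W.im])
    set d := 1 / c with hd
    have hd0 : 0 < d := by positivity
    have hdc : 1 / (2 * c) = d / 2 := by rw [hd]; field_simp
    have hdL : d * L = 1 / 2 := by rw [hd, hc]; field_simp
    rw [hdc]
    have h3 : d * W.re ≤ 1 / 2 := by rw [← hdL]; gcongr
    nlinarith [mul_le_mul_of_nonneg_left h2 (sq_nonneg d),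
      mul_le_mul_of_nonneg_right h3 (by positivity : 0 ≤ d * W.re),
      mul_le_mul_of_nonneg_left hre hd0.le]
  rw [norm_pow]
  refine le_of_sq_le_sq ?_ hε.le
  calc (‖1 - 1 / (c : ℂ) * W‖ ^ n) ^ 2 = (‖1 - 1 / (c : ℂ) * W‖ ^ 2) ^ n := by ring
    _ ≤ (1 - 1 / (2 * c)) ^ n := by gcongr
    _ ≤ ε ^ 2 := hn.le

/-- A trajectory of `ż = conj (g z)` leaving the disc of radius `r₀` needs at least unit time to
reach radius `A` if `w = z g(z)` traps `1 + (z / r) ^ M` in a sector where `|w| ≤ 7 A`. -/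
theorem one_le_crossing_time {g : ℂ → ℂ} {A r r₀ : ℝ} {M : ℕ} (hM : 1 ≤ M) (hr : 0 < r)
    (hA : r + 14 ≤ A)
    (hsmall : ∀ z : ℂ, ‖z‖ ≤ r₀ → ‖(z / r) ^ M‖ ≤ 1 / 10)
    (hfield : ∀ z X W w D : ℂ, ‖z‖ ≤ A → X = (z / r) ^ M → W = 1 + X → w = z * g z →
      D = X * (starRingEnd ℂ) w → 1 / 10 ≤ ‖X‖ → 1 / 2 ≤ W.re → |W.im| ≤ W.re →
      (0 ≤ D.re ∧ |W.re * D.im - W.im * D.re| ≤ 1 / 10 * D.re) ∧ ‖w‖ ≤ 7 * A)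
    {z : ℝ → ℂ} {a b : ℝ} (hab : a ≤ b)
    (hz : ∀ t ∈ Icc a b, HasDerivAt z ((starRingEnd ℂ) (g (z t))) t)
    (ha : ‖z a‖ ≤ r₀) (hb : A ≤ ‖z b‖) : 1 ≤ b - a := by
  have hzc : ContinuousOn z (Icc a b) := fun t ht => (hz t ht).continuousAt.continuousWithinAt
  obtain ⟨e, ⟨he, heA⟩, hleast⟩ : ∃ e, IsLeast {t ∈ Icc a b | A ≤ ‖z t‖} e :=
    (isCompact_Icc.of_isClosed_subset
      (hzc.norm.preimage_isClosed_of_isClosed isClosed_Icc isClosed_Ici)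
      fun t ht => ht.1).exists_isLeast ⟨b, right_mem_Icc.2 hab, hb⟩
  have hlt : ∀ t ∈ Ico a e, ‖z t‖ < A := fun t ht => by
    by_contra! h
    exact absurd (hleast ⟨⟨ht.1, ht.2.le.trans he.2⟩, h⟩) (not_le.2 ht.2)
  have hsub : Icc a e ⊆ Icc a b := Icc_subset_Icc_right he.2
  obtain ⟨s, ⟨hs, hsX⟩, hgreatest⟩ :
      ∃ s, IsGreatest {t ∈ Icc a e | ‖(z t / r) ^ M‖ ≤ 1 / 10} s := by
    have hXc : ContinuousOn (fun t => ‖(z t / r) ^ M‖) (Icc a e) := by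
      have := hzc.mono hsub
      fun_prop
    exact (isCompact_Icc.of_isClosed_subset
      (hXc.preimage_isClosed_of_isClosed isClosed_Icc isClosed_Iic)
      fun t ht => ht.1).exists_isGreatest ⟨a, left_mem_Icc.2 he.1, hsmall _ ha⟩
  have hgt : ∀ t ∈ Ioc s e, 1 / 10 < ‖(z t / r) ^ M‖ := fun t ht => by
    by_contra! h
    exact absurd (hgreatest ⟨⟨hs.1.trans ht.1.le, ht.2⟩, h⟩) (not_le.2 ht.1)
  have hsub' : Icc s e ⊆ Icc a b := (Icc_subset_Icc_left hs.1).trans hsub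
  have hzs : ‖z s‖ ≤ r := by
    by_contra! h
    have h1 : 1 ≤ ‖(z s / r) ^ M‖ := by
      rw [norm_pow, norm_div, Complex.norm_real, Real.norm_eq_abs, abs_of_pos hr]
      exact one_le_pow₀ ((one_le_div hr).2 h.le)
    linarith
  set X : ℝ → ℂ := fun t => (z t / r) ^ M with hX
  set X' : ℝ → ℂ := fun t => M * (z t / r) ^ (M - 1) * ((starRingEnd ℂ) (g (z t)) / r) with hX'
  have hXd : ∀ t ∈ Icc s e, HasDerivAt X (X' t) t := fun t ht =>
    ((hz t (hsub' ht)).div_const (r : ℂ)).pow M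
  have hre : ∀ t ∈ Icc s e, HasDerivAt (fun t => (1 + X t).re) (X' t).re t := fun t ht =>
    Complex.reCLM.hasFDerivAt.comp_hasDerivAt t ((hXd t ht).const_add 1)
  have him : ∀ t ∈ Icc s e, HasDerivAt (fun t => (1 + X t).im) (X' t).im t := fun t ht =>
    Complex.imCLM.hasFDerivAt.comp_hasDerivAt t ((hXd t ht).const_add 1)
  have hX'D : ∀ t ∈ Ioo s e, ∃ m : ℝ, 0 ≤ m ∧
      X' t = m * (X t * (starRingEnd ℂ) (z t * g (z t))) := fun t ht => by
    have hz0 : z t ≠ 0 := fun h => by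
      have := hgt t ⟨ht.1, ht.2.le⟩
      rw [h, zero_div, zero_pow (by omega), norm_zero] at this
      linarith
    refine ⟨M / Complex.normSq (z t), div_nonneg M.cast_nonneg (Complex.normSq_nonneg _), ?_⟩
    have hc : (starRingEnd ℂ) (z t) ≠ 0 := (map_ne_zero _).2 hz0
    have hr' : (r : ℂ) ≠ 0 := by exact_mod_cast hr.ne'
    obtain ⟨n, rfl⟩ : ∃ n, M = n + 1 := ⟨M - 1, by omega⟩
    simp only [hX, hX', map_mul, Complex.ofReal_div, Complex.ofReal_natCast,
      ← Complex.mul_conj, Nat.add_sub_cancel]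
    rw [pow_succ]
    field_simp
  have htrap := sector_trap hre him
    (by have := neg_abs_le (X s).re
        have := (Complex.abs_re_le_norm (X s)).trans hsX
        simp only [Complex.add_re, Complex.one_re]; linarith)
    (by simpa using (Complex.abs_im_le_norm (X s)).trans hsX)
    (fun t ht h1 h2 => by
      obtain ⟨m, hm, hmX⟩ := hX'D t ht
      obtain ⟨⟨h3, h4⟩, -⟩ := hfield (z t) (X t) _ _ _ (hlt t ⟨hs.1.trans ht.1.le, ht.2⟩).le rfl rfl
        rfl rfl (hgt t ⟨ht.1, ht.2.le⟩).le h1 h2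
      rw [hmX, Complex.re_ofReal_mul, Complex.im_ofReal_mul]
      refine ⟨mul_nonneg hm h3, ?_⟩
      rw [show ∀ p q x y : ℝ, p * (m * x) - q * (m * y) = m * (p * x - q * y) from
        fun _ _ _ _ => by ring, abs_mul, abs_of_nonneg hm]
      linarith [mul_le_mul_of_nonneg_left h4 hm])
  have hnd : ∀ t ∈ Icc s e, HasDerivAt (fun t => ‖z t‖ ^ 2)
      (2 * inner ℝ (z t) ((starRingEnd ℂ) (g (z t)))) t := fun t ht =>
    (hz t (hsub' ht)).norm_sq
  have hmv := (convex_Icc s e).image_sub_le_mul_sub_of_deriv_le (f := fun t => ‖z t‖ ^ 2)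
    (C := 14 * A) (fun t ht => (hnd t ht).continuousAt.continuousWithinAt)
    (by rw [interior_Icc]; exact fun t ht =>
          (hnd t (Ioo_subset_Icc_self ht)).differentiableAt.differentiableWithinAt)
    (by rw [interior_Icc]
        intro t ht
        rw [(hnd t (Ioo_subset_Icc_self ht)).deriv]
        obtain ⟨h1, h2⟩ := htrap t (Ioo_subset_Icc_self ht)
        have h3 := (hfield (z t) (X t) _ _ _ (hlt t ⟨hs.1.trans ht.1.le, ht.2⟩).le rfl rfl
          rfl rfl (hgt t ⟨ht.1, ht.2.le⟩).le h1.le h2.le).2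
        have h4 := real_inner_le_norm (z t) ((starRingEnd ℂ) (g (z t)))
        rw [RCLike.norm_conj, ← norm_mul] at h4
        linarith)
    s (left_mem_Icc.2 hs.2) e (right_mem_Icc.2 hs.2) hs.2
  have h1 : A ^ 2 ≤ ‖z e‖ ^ 2 := by gcongr; linarith
  have h2 : ‖z s‖ ^ 2 ≤ r ^ 2 := by gcongr
  have h3 : 14 * A * 1 ≤ 14 * A * (e - s) := by
    nlinarith
  have h4 := le_of_mul_le_mul_left h3 (by linarith)
  linarith [hs.1, he.2]


/-- For `|W - 1|` not too small, the field `w = A X k + b (1 - X k)² + e` with `X = W - 1` and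
`k ≈ 1 / W` is dominated by `A X / W`. -/
theorem field_estimate {A B L : ℝ} {X W k b e w : ℂ} (hB : 1 ≤ B) (hA : 100000 * B ≤ A)
    (hW : W = 1 + X) (hw : w = A * (X * k) + b * (1 - X * k) ^ 2 + e)
    (hre : 1 / 2 ≤ W.re) (hWL : ‖W‖ ≤ L)
    (hk : ‖1 - W * k‖ ≤ 1 / (A * L)) (hX : 1 / 10 ≤ ‖X‖) (hb : ‖b‖ ≤ B + ‖X‖)
    (he : ‖e‖ ≤ 1 / L) :
    ‖w‖ ≤ 7 * A ∧
      ‖W * (starRingEnd ℂ) X * w - ((A * ‖X‖ ^ 2 : ℝ) : ℂ)‖ ≤ 50 * B * ‖X‖ := by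
  set ρ := ‖X‖ with hρ
  set N := ‖W‖ with hN
  have hN2 : 1 / 2 ≤ N := hre.trans (Complex.re_le_norm W)
  have hN0 : 0 < N := by linarith
  have hL0 : 0 < L := by linarith
  have hA0 : 0 < A := by linarith
  have hρN : ρ ≤ N + 1 := by
    have : X = W - 1 := by rw [hW]; ring
    rw [hρ, this]; simpa using norm_sub_le W 1
  have half : ∀ {x y : ℝ}, 0 ≤ x → x * N ≤ y → x ≤ 2 * y := fun {x y} hx h => by
    linarith [mul_le_mul_of_nonneg_left hN2 hx]
  set E := 1 - W * k with hE
  have hE1 : ‖E‖ ≤ 1 / (A * N) := hk.trans (by gcongr)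
  have hE2 : ‖E‖ * (A * N) ≤ 1 := by rwa [le_div_iff₀ (by positivity)] at hE1
  have hE3 : ‖E‖ * N ≤ 1 :=
    le_trans (by gcongr; exact le_mul_of_one_le_left hN0.le (by linarith)) hE2
  have hEA : A * ‖E‖ ≤ 2 := by
    simpa using half (mul_nonneg hA0.le (norm_nonneg E)) (by linarith : A * ‖E‖ * N ≤ 1)
  have hEle : ‖E‖ ≤ 1 := by
    have : 2 * ‖E‖ ≤ A * ‖E‖ := by gcongr; linarith
    linarith
  have hkN : ‖k‖ * N ≤ 2 := by
    have : k * W = 1 - E := by rw [hE]; ring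
    rw [hN, ← norm_mul, this]
    refine (norm_sub_le _ _).trans ?_
    rw [norm_one]; linarith
  have hsN : ‖1 - X * k‖ * N ≤ 3 := by
    have h1 : 1 - X * k = E + k := by rw [hE, hW]; ring
    rw [h1]
    have := mul_le_mul_of_nonneg_right (norm_add_le E k) hN0.le
    linarith
  have hbs : ‖b * (1 - X * k) ^ 2‖ * N ≤ 45 * B := by
    rw [norm_mul, norm_pow]
    set σ := ‖1 - X * k‖
    have hσ : 0 ≤ σ := norm_nonneg _
    have h9 : (σ * N) ^ 2 ≤ 9 := by
      calc (σ * N) ^ 2 ≤ 3 ^ 2 := by gcongr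
        _ = 9 := by norm_num
    have hb5 : ‖b‖ ≤ 5 * B * N := by
      have h1 : B * (1 / 2) ≤ B * N := by gcongr
      have h2 : 1 * N ≤ B * N := by gcongr
      linarith
    calc ‖b‖ * σ ^ 2 * N ≤ 5 * B * N * σ ^ 2 * N := by gcongr
      _ = 5 * B * (σ * N) ^ 2 := by ring
      _ ≤ 5 * B * 9 := by gcongr
      _ = 45 * B := by ring
  have heN : ‖e‖ * N ≤ 1 := by
    have : ‖e‖ ≤ 1 / N := he.trans (by gcongr)
    rwa [le_div_iff₀ hN0] at this
  have hρ0 : 0 ≤ ρ := norm_nonneg _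
  have hwA : ‖w‖ ≤ 7 * A := by
    have h1 : ‖w‖ ≤ A * (ρ * ‖k‖) + ‖b * (1 - X * k) ^ 2‖ + ‖e‖ := by
      rw [hw]
      refine norm_add₃_le.trans (le_of_eq ?_)
      rw [norm_mul (A : ℂ), norm_mul X, Complex.norm_real, Real.norm_eq_abs, abs_of_pos hA0]
    have h2 : ρ * ‖k‖ ≤ 6 := by
      have h5 : ρ * ‖k‖ ≤ (N + 1) * ‖k‖ := by gcongr
      linarith [half (norm_nonneg k) hkN]
    have h3 := half (norm_nonneg (b * (1 - X * k) ^ 2)) hbs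
    have h4 := half (norm_nonneg e) heN
    have h6 : A * (ρ * ‖k‖) ≤ A * 6 := by gcongr
    linarith
  refine ⟨hwA, ?_⟩
  have hXX : (starRingEnd ℂ) X * X = ((ρ ^ 2 : ℝ) : ℂ) := by
    rw [mul_comm, Complex.mul_conj, Complex.normSq_eq_norm_sq]
  have h1 : W * (starRingEnd ℂ) X * w - ((A * ρ ^ 2 : ℝ) : ℂ) =
      -(((A * ρ ^ 2 : ℝ) : ℂ) * E) + W * (starRingEnd ℂ) X * (b * (1 - X * k) ^ 2)
      + W * (starRingEnd ℂ) X * e := by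
    rw [hw, hE, Complex.ofReal_mul, ← hXX]
    ring
  rw [h1]
  refine norm_add₃_le.trans ?_
  rw [norm_neg, norm_mul _ E, norm_mul _ (b * _), norm_mul _ e, norm_mul W, Complex.norm_real,
    RCLike.norm_conj, Real.norm_eq_abs, abs_of_nonneg (by positivity : 0 ≤ A * ρ ^ 2)]
  have e1 : A * ρ ^ 2 * ‖E‖ ≤ 3 * ρ := by
    have : A * ‖E‖ * ρ ≤ 3 := by
      have : A * ‖E‖ * ρ ≤ A * ‖E‖ * (N + 1) := by gcongr
      linarith
    calc A * ρ ^ 2 * ‖E‖ = A * ‖E‖ * ρ * ρ := by ring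
      _ ≤ 3 * ρ := by gcongr
  have e2 : ‖W‖ * ‖X‖ * ‖b * (1 - X * k) ^ 2‖ ≤ 45 * B * ρ := by
    calc N * ρ * ‖b * (1 - X * k) ^ 2‖ = ‖b * (1 - X * k) ^ 2‖ * N * ρ := by ring
      _ ≤ 45 * B * ρ := by gcongr
  have e3 : ‖W‖ * ‖X‖ * ‖e‖ ≤ ρ := by
    calc N * ρ * ‖e‖ = ‖e‖ * N * ρ := by ring
      _ ≤ 1 * ρ := by gcongr
      _ = ρ := one_mul ρ
  have e4 : 4 * ρ ≤ 5 * B * ρ := by gcongr; linarith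
  linarith

/-- If `W X̄ w` is close to `A |X|²` with `W = 1 + X` in the sector `|im W| ≤ re W`, then
`D = X w̄` points to the right and turns `W` slowly. -/
theorem direction_of_field {A B : ℝ} {X W w D : ℂ} (hB : 1 ≤ B) (hA : 100000 * B ≤ A)
    (hW : W = 1 + X) (hD : D = X * (starRingEnd ℂ) w) (hre : 1 / 2 ≤ W.re)
    (him : |W.im| ≤ W.re) (hX : 1 / 10 ≤ ‖X‖)
    (hErrb : ‖W * (starRingEnd ℂ) X * w - ((A * ‖X‖ ^ 2 : ℝ) : ℂ)‖ ≤ 50 * B * ‖X‖) :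
    0 ≤ D.re ∧ |W.re * D.im - W.im * D.re| ≤ 1 / 10 * D.re := by
  set ρ := ‖X‖ with hρ
  have hρ0 : 0 ≤ ρ := norm_nonneg _
  have hNρ : ‖W‖ ≤ ρ + 1 := by
    rw [hW, add_comm]; simpa using norm_add_le X 1
  set Z := (starRingEnd ℂ) W * D with hZ
  set Err := W * (starRingEnd ℂ) X * w - ((A * ρ ^ 2 : ℝ) : ℂ) with hErr
  have hZE : W * (starRingEnd ℂ) X * w = (starRingEnd ℂ) Z := by
    rw [hZ, hD]; simp only [map_mul, Complex.conj_conj]; ring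
  rw [hZE] at hErr
  have hZre : |Z.re - A * ρ ^ 2| ≤ 50 * B * ρ := by
    have : Err.re = Z.re - A * ρ ^ 2 := by simp [hErr, -Complex.ofReal_mul, -Complex.ofReal_pow]
    rw [← this]; exact (Complex.abs_re_le_norm _).trans hErrb
  have hZim : |Z.im| ≤ 50 * B * ρ := by
    have : Err.im = - Z.im := by simp [hErr, -Complex.ofReal_mul, -Complex.ofReal_pow]
    rw [← abs_neg, ← this]; exact (Complex.abs_im_le_norm _).trans hErrb
  have hZi : Z.im = W.re * D.im - W.im * D.re := by simp [hZ, Complex.mul_im]; ring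
  have hZr : Z.re = W.re * D.re + W.im * D.im := by simp [hZ, Complex.mul_re]
  have hur := Complex.re_le_norm W
  rw [← hZi]
  clear hErrb
  clear_value ρ Err Z
  generalize W.re = u at *
  generalize W.im = v at *
  generalize D.re = dr at *
  generalize D.im = di at *
  generalize Z.re = zr at *
  generalize Z.im = zi at *
  have hDre : dr * (u ^ 2 + v ^ 2) = zr * u - zi * v := by rw [hZr, hZi]; ring
  have hv2 : v ^ 2 ≤ u ^ 2 := sq_le_sq' (by linarith [neg_abs_le v]) (by linarith [le_abs_self v])
  have hZre' : A * ρ ^ 2 - 50 * B * ρ ≤ zr := by linarith [neg_abs_le (zr - A * ρ ^ 2)]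
  have hZbig : 9950 * B * ρ ≤ zr := by nlinarith [mul_nonneg (by linarith : 0 ≤ B) hρ0]
  have hBρ : 0 < B * ρ := mul_pos (by linarith) (by linarith)
  have hZiv : zi * v ≤ 50 * B * ρ * u := by
    refine (le_abs_self _).trans ?_
    rw [abs_mul]
    gcongr
  have hD1 : 99 / 100 * zr * u ≤ dr * (u ^ 2 + v ^ 2) := by
    rw [hDre]; nlinarith
  have hDpos : 0 ≤ dr := by
    have hz : 0 ≤ zr := by linarith
    have : 0 ≤ dr * (u ^ 2 + v ^ 2) := le_trans (by positivity) hD1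
    exact nonneg_of_mul_nonneg_left this (by positivity)
  refine ⟨hDpos, hZim.trans ?_⟩
  have hD2 : 99 / 100 * zr ≤ 2 * dr * u := by
    have : dr * (u ^ 2 + v ^ 2) ≤ dr * (2 * u ^ 2) := by gcongr; linarith
    nlinarith
  have hu : u ≤ 11 * ρ := by linarith
  have hD3 : 99 / 100 * zr ≤ 22 * dr * ρ := by nlinarith
  have hZ4 : 99500 * B * ρ ^ 2 ≤ zr := by nlinarith [mul_nonneg (by linarith : 0 ≤ B) hρ0]
  nlinarith

/-- A polynomial is bounded on every disc. -/
theorem exists_norm_eval_le (p : Polynomial ℂ) (ρ : ℝ) :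
    ∃ B : ℝ, 1 ≤ B ∧ ∀ z : ℂ, ‖z‖ ≤ ρ → ‖p.eval z‖ ≤ B := by
  obtain ⟨C, hC⟩ := (isCompact_closedBall (0 : ℂ) ρ).exists_bound_of_continuousOn
    (f := fun z => p.eval z) p.continuous.continuousOn
  exact ⟨max 1 C, le_max_left _ _, fun z hz => (hC z (by simpa using hz)).trans (le_max_right _ _)⟩

/-- A polynomial `p` can be modified slightly on a disc so that every nearby vector field needs
unit time to go from that disc to some large radius `R`, while `R` itself is not a point of growth. -/
theorem exists_slow_polynomial (p : Polynomial ℂ) {r₀ η : ℝ} (hr₀ : 0 < r₀) (hη : 0 < η) :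
    ∃ (q : Polynomial ℂ) (R ε : ℝ), r₀ + 1 ≤ R ∧ 0 < ε ∧
      (∀ z : ℂ, ‖z‖ ≤ r₀ → ‖q.eval z - p.eval z‖ ≤ η) ∧ ‖q.eval (R : ℂ)‖ ≤ 7 ∧
      ∀ g : ℂ → ℂ, (∀ z : ℂ, ‖z‖ ≤ R → ‖g z - q.eval z‖ ≤ ε) →
        ∀ (z : ℝ → ℂ) (a b : ℝ), a ≤ b →
          (∀ t ∈ Icc a b, HasDerivAt z ((starRingEnd ℂ) (g (z t))) t) →
          ‖z a‖ ≤ r₀ → R ≤ ‖z b‖ → 1 ≤ b - a := by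
  set r : ℝ := r₀ + 1 with hr
  have hr1 : 1 ≤ r := by linarith
  have hr0 : 0 < r := by linarith
  obtain ⟨B, hB, hpB⟩ := exists_norm_eval_le (Polynomial.X * p) (2 * r)
  obtain ⟨A, hAdef⟩ : ∃ A, A = 100000 * B + 2 * r := ⟨_, rfl⟩
  have hAB : 100000 * B ≤ A := by linarith
  have hAr : 2 * r ≤ A := by linarith
  have hA0 : 0 < A := by linarith
  obtain ⟨B', -, hpB'⟩ := exists_norm_eval_le (Polynomial.X * p) A
  obtain ⟨P, hP, hpP⟩ := exists_norm_eval_le p r₀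
  have hθ : r₀ / r < 1 := (div_lt_one hr0).2 (by linarith)
  have hδ : 0 < min (η / (9 * P + 3 * A)) (1 / 10) := by positivity
  obtain ⟨m, hmδ, hmB⟩ :=
    (((tendsto_pow_atTop_nhds_zero_of_lt_one (by positivity) hθ).eventually_le_const hδ).and
    ((tendsto_pow_atTop_atTop_of_one_lt (one_lt_two : (1 : ℝ) < 2)).eventually_ge_atTop B')).exists
  have hm1 := hmδ.trans (min_le_left _ _)
  have hm2 := hmδ.trans (min_le_right _ _)
  rw [le_div_iff₀ (by positivity)] at hm1
  set M := m + 1 with hM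
  set δ := (r₀ / r) ^ m with hδdef
  have hδ0 : 0 ≤ δ := by positivity
  have hnX : ∀ z : ℂ, ‖(z / r) ^ M‖ = (‖z‖ / r) ^ M := fun z => by
    rw [norm_pow, norm_div, Complex.norm_real, Real.norm_eq_abs, abs_of_pos hr0]
  set L : ℝ := 1 + (A / r) ^ M with hL
  have hAr1 : 2 ≤ A / r := by rwa [le_div_iff₀ hr0]
  have hL1 : 1 ≤ L := by
    have : 0 ≤ (A / r) ^ M := by positivity
    linarith
  have hL0 : 0 < L := by linarith
  have hA1 : 1 ≤ A := by linarith
  have hXL : ∀ z : ℂ, ‖z‖ ≤ A → ‖1 + (z / r) ^ M‖ ≤ L := fun z hz => by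
    refine (norm_add_le _ _).trans ?_
    rw [hnX, norm_one, hL]
    gcongr
  obtain ⟨k, hk⟩ := exists_polynomial_approx_inv hL1 (show 0 < 1 / (A * L) by positivity)
  have hbX : ∀ z : ℂ, ‖z‖ ≤ A → ‖z * p.eval z‖ ≤ B + ‖(z / r) ^ M‖ := fun z hz => by
    by_cases h : ‖z‖ ≤ 2 * r
    · have := hpB z h
      rw [Polynomial.eval_mul, Polynomial.eval_X] at this
      linarith [norm_nonneg ((z / r) ^ M)]
    · have h1 := hpB' z hz
      rw [Polynomial.eval_mul, Polynomial.eval_X] at h1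
      have h2 : (2 : ℝ) ^ m ≤ ‖(z / r) ^ M‖ := by
        rw [hnX]
        have : 2 ≤ ‖z‖ / r := by rw [le_div_iff₀ hr0]; linarith
        calc (2 : ℝ) ^ m ≤ 2 ^ M := pow_le_pow_right₀ one_le_two (by omega)
          _ ≤ _ := by gcongr
      linarith
  set Xp : Polynomial ℂ := Polynomial.C (1 / (r : ℂ) ^ M) * Polynomial.X ^ M with hXp
  set K : Polynomial ℂ := k.comp (1 + Xp) with hK
  set q : Polynomial ℂ := p * (1 - Xp * K) ^ 2 +
    Polynomial.C (A / (r : ℂ) ^ M) * Polynomial.X ^ m * K with hq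
  have hXpe : ∀ z : ℂ, Xp.eval z = (z / r) ^ M := fun z => by
    simp [hXp, div_pow]; ring
  have hKe : ∀ z : ℂ, K.eval z = k.eval (1 + (z / r) ^ M) := fun z => by
    simp [hK, Polynomial.eval_comp, hXpe]
  have hqe : ∀ z : ℂ, q.eval z = p.eval z * (1 - (z / r) ^ M * K.eval z) ^ 2 +
      A / (r : ℂ) ^ M * z ^ m * K.eval z := fun z => by
    simp [hq, hXpe]
  have hrC : (r : ℂ) ≠ 0 := by exact_mod_cast hr0.ne'
  have hzq : ∀ z : ℂ, z * q.eval z = A * ((z / r) ^ M * K.eval z) +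
      z * p.eval z * (1 - (z / r) ^ M * K.eval z) ^ 2 := fun z => by
    rw [hqe, div_pow z, hM]
    field_simp
    ring
  have hsmallX : ∀ z : ℂ, ‖z‖ ≤ r₀ → ‖(z / r) ^ M‖ ≤ δ := fun z hz => by
    rw [hnX, hδdef]
    calc (‖z‖ / r) ^ M ≤ (r₀ / r) ^ M := by gcongr
      _ ≤ (r₀ / r) ^ m := pow_le_pow_of_le_one (by positivity) hθ.le (by omega)
  refine ⟨q, A, 1 / (A * L), by linarith, by positivity, ?_, ?_, ?_⟩
  · intro z hz
    set X := (z / r) ^ M with hX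
    have hXδ := hsmallX z hz
    have hX10 := hXδ.trans hm2
    have hre := neg_abs_le X.re
    have hre' := Complex.abs_re_le_norm X
    have him := Complex.abs_im_le_norm X
    have hkz := hk (1 + X) (by simp only [Complex.add_re, Complex.one_re]; linarith)
      (by simp only [Complex.add_re, Complex.one_re, Complex.add_im, Complex.one_im, zero_add]
          linarith) (hXL z (by linarith))
    rw [← hKe] at hkz
    set κ := K.eval z
    have hAL : 1 / (A * L) ≤ 1 := by
      rw [div_le_one (by positivity)]
      exact one_le_mul_of_one_le_of_one_le hA1 hL1
    have hκ : ‖κ‖ ≤ 3 := by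
      have h1 : κ = 1 - (1 - (1 + X) * κ) - X * κ := by ring
      have h2 : ‖κ‖ ≤ 1 + 1 + ‖X‖ * ‖κ‖ := by
        conv_lhs => rw [h1]
        refine (norm_sub_le _ _).trans (add_le_add ((norm_sub_le _ _).trans ?_) (norm_mul_le _ _))
        rw [norm_one]; linarith
      have h3 : ‖X‖ * ‖κ‖ ≤ 1 / 10 * ‖κ‖ := by gcongr
      linarith
    have hXκ : ‖X * κ‖ ≤ 3 * δ := by
      rw [norm_mul]
      calc ‖X‖ * ‖κ‖ ≤ δ * 3 := by gcongr
        _ = 3 * δ := by ring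
    have h1 : q.eval z - p.eval z = p.eval z * (X * κ * (X * κ - 2)) +
        A / (r : ℂ) ^ M * z ^ m * κ := by rw [hqe]; ring
    have h2 : ‖X * κ - 2‖ ≤ 3 := by
      refine (norm_sub_le _ _).trans ?_
      rw [Complex.norm_ofNat]; linarith
    have h3 : ‖(A : ℂ) / (r : ℂ) ^ M * z ^ m‖ ≤ A * δ := by
      rw [norm_mul, norm_div, norm_pow, norm_pow, Complex.norm_real, Complex.norm_real,
        Real.norm_eq_abs, Real.norm_eq_abs, abs_of_pos hA0, abs_of_pos hr0]
      calc A / r ^ M * ‖z‖ ^ m = A * (‖z‖ / r) ^ m / r := by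
            rw [hM, div_pow, pow_succ]; field_simp
        _ ≤ A * (‖z‖ / r) ^ m := div_le_self (by positivity) hr1
        _ ≤ A * δ := by rw [hδdef]; gcongr
    rw [h1]
    refine (norm_add_le _ _).trans ?_
    rw [norm_mul (p.eval z), norm_mul (X * κ), norm_mul (A / (r : ℂ) ^ M * z ^ m)]
    calc ‖p.eval z‖ * (‖X * κ‖ * ‖X * κ - 2‖) + ‖(A : ℂ) / (r : ℂ) ^ M * z ^ m‖ * ‖κ‖
        ≤ P * (3 * δ * 3) + A * δ * 3 := by
          gcongr
          exact hpP z hz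
      _ = δ * (9 * P + 3 * A) := by ring
      _ ≤ η := hm1
  · have hXR : ((A : ℂ) / r) ^ M = (((A / r) ^ M : ℝ) : ℂ) := by push_cast; rfl
    have hpos : 1 ≤ (A / r) ^ M := one_le_pow₀ (by linarith)
    have hnA : ‖(A : ℂ)‖ = A := by simp [abs_of_pos hA0]
    have hre : (1 + ((A : ℂ) / r) ^ M).re = 1 + (A / r) ^ M := by
      rw [hXR, Complex.add_re, Complex.ofReal_re, Complex.one_re]
    have him : (1 + ((A : ℂ) / r) ^ M).im = 0 := by
      rw [hXR, Complex.add_im, Complex.ofReal_im, Complex.one_im, add_zero]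
    have h1 : 1 / 2 ≤ (1 + ((A : ℂ) / r) ^ M).re := by rw [hre]; linarith
    have h2 := hXL A hnA.le
    have h3 := (field_estimate (X := (A / r) ^ M) (k := K.eval (A : ℂ)) (b := A * p.eval (A : ℂ))
      (e := 0) (w := A * q.eval (A : ℂ)) hB hAB rfl (by rw [hzq, add_zero]) h1 h2
      (by rw [hKe]; exact hk _ h1 (by rw [him, hre, abs_zero]; linarith) h2)
      (by rw [hnX, hnA]; linarith) (hbX A hnA.le) (by rw [norm_zero]; positivity)).1
    rw [norm_mul, hnA, mul_comm] at h3
    exact le_of_mul_le_mul_right h3 hA0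
  · intro g hg z a b hab hz ha hb
    refine one_le_crossing_time (M := M) (r := r) (r₀ := r₀) (by omega) hr0 (by linarith)
      (fun z hz => (hsmallX z hz).trans hm2) ?_ hab hz ha hb
    intro z X W w D hzA hX hW hw hD hX10 hre him
    have hWL : ‖W‖ ≤ L := by rw [hW, hX]; exact hXL z hzA
    obtain ⟨h1, h2⟩ := field_estimate (k := K.eval z) (b := z * p.eval z) (w := w)
      (e := z * (g z - q.eval z)) hB hAB hW
      (by rw [hw, mul_sub, hzq, hX]; ring) hre hWL
      (by rw [hKe, ← hX, ← hW]; exact hk W hre him hWL) hX10 (by rw [hX]; exact hbX z hzA)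
      (by rw [norm_mul]
          calc ‖z‖ * ‖g z - q.eval z‖ ≤ A * (1 / (A * L)) := by gcongr; exact hg z hzA
            _ = 1 / L := by field_simp)
    exact ⟨direction_of_field hB hAB hW hD hre him hX10 h2, h1⟩

/-- A sequence of polynomials, close on growing discs of radii `r n`, such that every function `g`
close to `p (n + 1)` is slow between the radii `r n` and `r (n + 1)`. -/
theorem exists_slow_sequence :
    ∃ (p : ℕ → Polynomial ℂ) (r δ : ℕ → ℝ), p 0 = Polynomial.X ∧ r 0 = 1 ∧ δ 0 = 1 / 10 ∧
      ∀ n, r n + 1 ≤ r (n + 1) ∧ 0 < δ n ∧ δ (n + 1) ≤ δ n / 2 ∧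
        (∀ z : ℂ, ‖z‖ ≤ r n → ‖(p (n + 1)).eval z - (p n).eval z‖ ≤ δ n) ∧
        ‖(p (n + 1)).eval (r (n + 1) : ℂ)‖ ≤ 7 ∧
        ∀ g : ℂ → ℂ, (∀ z : ℂ, ‖z‖ ≤ r (n + 1) → ‖g z - (p (n + 1)).eval z‖ ≤ 2 * δ (n + 1)) →
          ∀ (z : ℝ → ℂ) (a b : ℝ), a ≤ b →
            (∀ t ∈ Icc a b, HasDerivAt z ((starRingEnd ℂ) (g (z t))) t) →
            ‖z a‖ ≤ r n → r (n + 1) ≤ ‖z b‖ → 1 ≤ b - a := by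
  have step : ∀ s : {s : Polynomial ℂ × ℝ × ℝ // 0 < s.2.1 ∧ 0 < s.2.2},
      ∃ s' : {s : Polynomial ℂ × ℝ × ℝ // 0 < s.2.1 ∧ 0 < s.2.2},
        s.1.2.1 + 1 ≤ s'.1.2.1 ∧ s'.1.2.2 ≤ s.1.2.2 / 2 ∧
        (∀ z : ℂ, ‖z‖ ≤ s.1.2.1 → ‖s'.1.1.eval z - s.1.1.eval z‖ ≤ s.1.2.2) ∧
        ‖s'.1.1.eval (s'.1.2.1 : ℂ)‖ ≤ 7 ∧
        ∀ g : ℂ → ℂ, (∀ z : ℂ, ‖z‖ ≤ s'.1.2.1 → ‖g z - s'.1.1.eval z‖ ≤ 2 * s'.1.2.2) →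
          ∀ (z : ℝ → ℂ) (a b : ℝ), a ≤ b →
            (∀ t ∈ Icc a b, HasDerivAt z ((starRingEnd ℂ) (g (z t))) t) →
            ‖z a‖ ≤ s.1.2.1 → s'.1.2.1 ≤ ‖z b‖ → 1 ≤ b - a := by
    rintro ⟨⟨p, r, δ⟩, hr, hδ⟩
    obtain ⟨q, R, ε, hR, hε, hqp, hqR, hq⟩ := exists_slow_polynomial p hr hδ
    dsimp only at hr hδ ⊢
    refine ⟨⟨⟨q, R, min (δ / 2) (ε / 2)⟩, by dsimp only; linarith, by dsimp only; positivity⟩, hR,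
      min_le_left _ _, hqp, hqR, fun g hg => hq g fun z hz => (hg z hz).trans ?_⟩
    dsimp only
    linarith [min_le_right (δ / 2) (ε / 2)]
  choose f hf using step
  let s : ℕ → {s : Polynomial ℂ × ℝ × ℝ // 0 < s.2.1 ∧ 0 < s.2.2} := fun n =>
    f^[n] ⟨⟨Polynomial.X, 1, 1 / 10⟩, by norm_num, by norm_num⟩
  refine ⟨fun n => (s n).1.1, fun n => (s n).1.2.1, fun n => (s n).1.2.2, rfl, rfl, rfl,
    fun n => ?_⟩
  have hs : s (n + 1) = f (s n) := Function.iterate_succ_apply' f n _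
  simp only [hs]
  obtain ⟨h1, h2, h3, h4, h5⟩ := hf (s n)
  exact ⟨h1, (s n).2.2, h2, h3, h4, h5⟩

/-- A sequence of polynomials with geometrically small increments on growing discs converges to
an entire function. -/
theorem exists_entire_limit {p : ℕ → Polynomial ℂ} {r δ : ℕ → ℝ}
    (hr : ∀ n, r n + 1 ≤ r (n + 1)) (hδ : ∀ n, δ (n + 1) ≤ δ n / 2)
    (hp : ∀ n, ∀ z : ℂ, ‖z‖ ≤ r n → ‖(p (n + 1)).eval z - (p n).eval z‖ ≤ δ n) :
    ∃ g : ℂ → ℂ, Differentiable ℂ g ∧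
      ∀ n, ∀ z : ℂ, ‖z‖ ≤ r n → ‖g z - (p n).eval z‖ ≤ 2 * δ n := by
  have hmono : Monotone r := monotone_nat_of_le_succ fun n => by linarith [hr n]
  have hrtop : Tendsto r atTop atTop := by
    have h : ∀ n : ℕ, r 0 + n ≤ r n := fun n => by
      induction n with
      | zero => simp
      | succ n ih => push_cast; linarith [hr n]
    exact tendsto_atTop_mono h (tendsto_atTop_add_const_left _ _ tendsto_natCast_atTop_atTop)
  have hδpow : ∀ n k, δ (n + k) ≤ δ n / 2 ^ k := fun n k => by
    induction k with
    | zero => simp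
    | succ k ih =>
      calc δ (n + (k + 1)) ≤ δ (n + k) / 2 := hδ (n + k)
        _ ≤ δ n / 2 ^ k / 2 := by gcongr
        _ = δ n / 2 ^ (k + 1) := by rw [pow_succ, div_div]
  have hgeom : ∀ n, ∀ z : ℂ, ‖z‖ ≤ r n → ∀ k,
      dist ((p (n + k)).eval z) ((p (n + (k + 1))).eval z) ≤ 2 * δ n / 2 / 2 ^ k := by
    intro n z hz k
    rw [dist_comm, dist_eq_norm, mul_div_cancel_left₀ _ (two_ne_zero)]
    exact (hp (n + k) z (hz.trans (hmono (Nat.le_add_right n k)))).trans (hδpow n k)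
  have hlim : ∀ z : ℂ, ∃ l, Tendsto (fun n => (p n).eval z) atTop (nhds l) := by
    intro z
    obtain ⟨n, hn⟩ := (hrtop.eventually_ge_atTop ‖z‖).exists
    obtain ⟨l, hl⟩ := cauchySeq_tendsto_of_complete (cauchySeq_of_le_geometric_two (hgeom n z hn))
    refine ⟨l, (tendsto_add_atTop_iff_nat n).1 ?_⟩
    simpa only [add_comm n] using hl
  choose g hg using hlim
  have hbound : ∀ n, ∀ z : ℂ, ‖z‖ ≤ r n → ‖g z - (p n).eval z‖ ≤ 2 * δ n := by
    intro n z hz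
    have := dist_le_of_le_geometric_two_of_tendsto₀ (hgeom n z hz)
      (by simpa only [add_comm n] using (tendsto_add_atTop_iff_nat n).2 (hg z))
    rwa [dist_comm, dist_eq_norm] at this
  refine ⟨g, ?_, hbound⟩
  have hunif : TendstoLocallyUniformlyOn (fun n z => (p n).eval z) g atTop univ := by
    rw [Metric.tendstoLocallyUniformlyOn_iff]
    intro ε hε x _
    refine ⟨Metric.ball x 1, by simpa using Metric.ball_mem_nhds x one_pos, ?_⟩
    have hδ0 : Tendsto (fun n : ℕ => 2 * (δ 0 / 2 ^ n)) atTop (nhds 0) := by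
      have h := (tendsto_pow_atTop_nhds_zero_of_lt_one (r := (1 / 2 : ℝ)) (by norm_num)
        (by norm_num)).const_mul (2 * δ 0)
      rw [mul_zero] at h
      refine h.congr fun n => ?_
      rw [one_div, inv_pow]; ring
    filter_upwards [hrtop.eventually_ge_atTop (‖x‖ + 1), hδ0.eventually_lt_const hε]
      with n hn hnε y hy
    have hy' : ‖y‖ ≤ r n := by
      have := norm_sub_norm_le y x
      rw [Metric.mem_ball, dist_eq_norm] at hy
      linarith
    rw [dist_eq_norm]
    have := hδpow 0 n
    rw [zero_add] at this
    linarith [hbound n y hy']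
  exact differentiableOn_univ.1 (hunif.differentiableOn
    (Eventually.of_forall fun n => (p n).differentiable.differentiableOn) isOpen_univ)

/-- A function that is bounded along a sequence tending to infinity and takes two values is not
a polynomial. -/
theorem not_polynomial_of_bounded_along {g : ℂ → ℂ} {x : ℕ → ℂ} {C : ℝ}
    (hx : Tendsto (fun n => ‖x n‖) atTop atTop) (hC : ∀ n, ‖g (x n)‖ ≤ C) {u v : ℂ}
    (huv : g u ≠ g v) : ¬ ∃ p : Polynomial ℂ, ∀ z : ℂ, g z = p.eval z := by
  rintro ⟨p, hp⟩
  by_cases hdeg : 0 < p.degree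
  · obtain ⟨n, hn⟩ := ((p.tendsto_norm_atTop hdeg hx).eventually_gt_atTop C).exists
    exact absurd (hC n) (by rw [hp]; exact not_le.2 hn)
  · rw [Polynomial.eq_C_of_degree_le_zero (not_lt.1 hdeg)] at hp
    exact huv (by simp [hp])

/-- A trajectory cannot escape to infinity in finite time if it needs unit time to cross each of
the annuli `r n ≤ |z| ≤ r (n + 1)`. -/
theorem not_escapes_of_slow {f : ℂ → ℂ} {r : ℕ → ℝ} (hr : Tendsto r atTop atTop)
    (hslow : ∀ n, ∀ (z : ℝ → ℂ) (a b : ℝ), a ≤ b → (∀ t ∈ Icc a b, HasDerivAt z (f (z t)) t) →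
      ‖z a‖ ≤ r n → r (n + 1) ≤ ‖z b‖ → 1 ≤ b - a)
    (a b : EReal) (z : ℝ → ℂ) : ¬ EscapesInFiniteTime f a b z := by
  rintro ⟨⟨⟨hab, hz⟩, -⟩, c, rfl, htend⟩
  obtain ⟨s, has, hsc⟩ : ∃ s : ℝ, max a ((c - 1 / 2 : ℝ) : EReal) < s ∧ (s : EReal) < c :=
    EReal.lt_iff_exists_real_btwn.1
      (max_lt hab (EReal.coe_lt_coe_iff.2 (by linarith)))
  obtain ⟨has, hs⟩ := max_lt_iff.1 has
  rw [EReal.coe_lt_coe_iff] at hs hsc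
  obtain ⟨n, hn⟩ := (hr.eventually_ge_atTop ‖z s‖).exists
  have h1 := (tendsto_norm_cobounded_atTop.comp htend).eventually_ge_atTop (r (n + 1))
  obtain ⟨t, ht, hst⟩ := (h1.and (Ioo_mem_nhdsLT hsc)).exists
  have := hslow n z s t hst.1.le (fun τ hτ => hz τ
    (has.trans_le (EReal.coe_le_coe_iff.2 hτ.1))
    (EReal.coe_lt_coe_iff.2 (hτ.2.trans_lt hst.2))) hn ht
  linarith [hst.2]

/-- Theorem: there is a transcendental entire function `g` for which the antiholomorphic
flow `ż = conj (g z)` has no trajectories tending to infinity in finite increasing time. -/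
theorem exists_transcendental_entire_no_finite_time_escape :
    ∃ g : ℂ → ℂ, TranscendentalEntire g ∧
      ¬ ∃ (a b : EReal) (z : ℝ → ℂ),
          EscapesInFiniteTime (fun w => (starRingEnd ℂ) (g w)) a b z := by
  obtain ⟨p, r, δ, hp0, hr0, hδ0, h⟩ := exists_slow_sequence
  choose hr hδpos hδ hp h7 hslow using h
  obtain ⟨g, hg, hgp⟩ := exists_entire_limit hr hδ hp
  have hrn : ∀ n : ℕ, (n : ℝ) ≤ r n := fun n => by
    induction n with
    | zero => simp [hr0]
    | succ n ih => push_cast; linarith [hr n]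
  have hrtop : Tendsto r atTop atTop := tendsto_atTop_mono hrn tendsto_natCast_atTop_atTop
  have hnorm : ∀ n, ‖(r n : ℂ)‖ = r n := fun n => by
    rw [Complex.norm_real, Real.norm_eq_abs, abs_of_nonneg (n.cast_nonneg.trans (hrn n))]
  refine ⟨g, ⟨hg, ?_⟩, ?_⟩
  · refine not_polynomial_of_bounded_along (x := fun n => (r (n + 1) : ℂ)) (C := 8) (u := 1)
      (v := 0) ?_ (fun n => ?_) fun h01 => ?_
    · simp only [hnorm]
      exact (tendsto_add_atTop_iff_nat 1).2 hrtop
    · have hδn : ∀ n, δ n ≤ 1 / 10 := fun n => by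
        induction n with
        | zero => exact hδ0.le
        | succ n ih => linarith [hδ n, hδpos n]
      have h1 := hgp (n + 1) _ (hnorm (n + 1)).le
      have h2 := norm_sub_norm_le (g (r (n + 1))) ((p (n + 1)).eval (r (n + 1) : ℂ))
      linarith [h7 n, hδn (n + 1)]
    · have h1 := hgp 0 1 (by simp [hr0])
      have h2 := hgp 0 0 (by simp [hr0])
      rw [hp0, Polynomial.eval_X, hδ0] at h1 h2
      have h3 := norm_sub_le (g 0 - 0) (g 1 - 1)
      rw [h01, show g 0 - 0 - (g 0 - 1) = 1 by ring, norm_one] at h3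
      rw [h01] at h1
      linarith
  · rintro ⟨a, b, z, hesc⟩
    exact not_escapes_of_slow hrtop (fun n => hslow n g (hgp (n + 1))) a b z hesc
end
end

section
/- Let g be analytic near z₃ with g(z₃) = 0, and let z : (α, β) → ℂ be a non-constant trajectory of the flow ż = conj(g(z)) with z(t) → z₃ as t → β⁻. Then β = +∞; that is, a zero of g cannot be reached in finite time by a trajectory of the antiholomorphic flow. -/
open Filter Set

noncomputable section

/-- A curve solving an autonomous equation on `(d, c)` and converging to an equilibrium at `c`,
continued by the equilibrium, is differentiable at `c` with derivative zero. -/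
theorem hasDerivAt_extend_equilibrium {f : ℂ → ℂ} {p : ℂ} (hf : ContinuousAt f p) (hp : f p = 0)
    {z : ℝ → ℂ} {c d : ℝ} (hdc : d < c) (hz : ∀ t ∈ Ioo d c, HasDerivAt z (f (z t)) t)
    (hlim : Tendsto z (nhdsWithin c (Iio c)) (nhds p)) :
    HasDerivAt (fun t => if t < c then z t else p) 0 c := by
  set w : ℝ → ℂ := fun t => if t < c then z t else p with hw
  have hwc : w c = p := by simp [hw]
  have hwd : ∀ t ∈ Ioo d c, HasDerivAt w (f (z t)) t := fun t ht =>
    (hz t ht).congr_of_eventuallyEq <| by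
      filter_upwards [Iio_mem_nhds ht.2] with s hs
      exact if_pos hs
  have hmem : Ioo d c ∈ nhdsWithin c (Iio c) := Ioo_mem_nhdsLT hdc
  have hleft : HasDerivWithinAt w 0 (Iic c) c := by
    refine hasDerivWithinAt_Iic_of_tendsto_deriv (s := Ioo d c)
      (fun t ht => (hwd t ht).differentiableAt.differentiableWithinAt) ?_ hmem ?_
    · rw [ContinuousWithinAt, hwc]
      refine (hlim.mono_left (nhdsWithin_mono c fun t ht => ht.2)).congr' ?_
      filter_upwards [self_mem_nhdsWithin] with t ht
      exact (if_pos ht.2).symm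
    · have h0 : Tendsto (fun t => f (z t)) (nhdsWithin c (Iio c)) (nhds 0) :=
        hp ▸ hf.tendsto.comp hlim
      refine h0.congr' ?_
      filter_upwards [hmem] with t ht
      exact (hwd t ht).deriv.symm
  have hright : HasDerivWithinAt w 0 (Ici c) c :=
    (hasDerivWithinAt_const c (Ici c) p).congr (fun t ht => if_neg (not_lt.2 ht)) hwc
  rw [← hasDerivWithinAt_univ, ← Iic_union_Ici (a := c)]
  exact hleft.union hright

/-- A zero of `g` cannot be reached in finite time: if a non-constant maximal trajectory of
`ż = conj (g z)` satisfies `z(t) → z₃` as `t → b⁻`, where `g` is analytic at `z₃` with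
`g(z₃) = 0`, then `b = +∞`. -/
theorem zero_not_reached_in_finite_time
    (g : ℂ → ℂ) (z₃ : ℂ) (hg : AnalyticAt ℂ g z₃) (hgz : g z₃ = 0)
    (a b : EReal) (z : ℝ → ℂ)
    (hz : MaxFlowSol (fun w => (starRingEnd ℂ) (g w)) a b z)
    (hnc : ∃ t : ℝ, a < (t : EReal) ∧ (t : EReal) < b ∧ z t ≠ z₃)
    (hlim : Tendsto z (Filter.comap (fun t : ℝ => (t : EReal)) (nhdsWithin b (Set.Iio b)))
      (nhds z₃)) :
    b = ⊤ := by
  induction b with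
  | top => rfl
  | bot => exact absurd hz.1.1 not_lt_bot
  | coe c =>
    obtain ⟨⟨hac, hsol⟩, hmax⟩ := hz
    have hle : nhdsWithin c (Iio c) ≤
        Filter.comap (fun t : ℝ => (t : EReal)) (nhdsWithin (c : EReal) (Iio (c : EReal))) := by
      rw [← Filter.map_le_iff_le_comap]
      exact tendsto_nhdsWithin_iff.2
        ⟨continuous_coe_real_ereal.continuousAt.tendsto.mono_left nhdsWithin_le_nhds,
          by filter_upwards [self_mem_nhdsWithin] with t ht using EReal.coe_lt_coe_iff.2 ht⟩
    obtain ⟨d, had, hdc⟩ := EReal.lt_iff_exists_real_btwn.1 hac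
    have hderiv := hasDerivAt_extend_equilibrium (f := fun w => (starRingEnd ℂ) (g w))
      (Complex.continuous_conj.continuousAt.comp hg.continuousAt) (by simp [hgz])
      (EReal.coe_lt_coe_iff.1 hdc)
      (fun t ht => hsol t (had.trans (EReal.coe_lt_coe_iff.2 ht.1)) (EReal.coe_lt_coe_iff.2 ht.2))
      (hlim.mono_left hle)
    refine (hmax a ⊤ (fun t => if t < c then z t else z₃) ⟨hac.trans (EReal.coe_lt_top c), ?_⟩
      le_rfl le_top fun t _ ht => if_pos (EReal.coe_lt_coe_iff.1 ht)).2.symm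
    intro t hat _
    rcases lt_trichotomy t c with htc | rfl | hct
    · simp only [if_pos htc]
      refine (hsol t hat (EReal.coe_lt_coe_iff.2 htc)).congr_of_eventuallyEq ?_
      filter_upwards [Iio_mem_nhds htc] with s hs
      exact if_pos hs
    · simpa [hgz] using hderiv
    · simp only [if_neg hct.not_gt, hgz, map_zero]
      refine (hasDerivAt_const t z₃).congr_of_eventuallyEq ?_
      filter_upwards [Ioi_mem_nhds hct] with s hs
      exact if_neg (not_lt.2 (le_of_lt hs))
end
end
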